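/- Let f be an E-function transcendental over ℂ(z), and let {α_1, …, α_s} be the (finite) set of nonzero algebraic numbers α such that f(α) ∈ ℚ̄, with the α_j pairwise distinct. If s ≥ 1, then there exist positive integers m_1, …, m_s, a polynomial p ∈ ℚ̄[z] of degree at most m_1 + … + m_s − 1, and an E-function g transcendental over ℚ̄(z) such that f(z) = p(z) + (∏_{j=1}^s (z − α_j)^{m_j}) · g(z) identically, and g(α) is transcendental for every nonzero algebraic number α. -/

import Mathlib

noncomputable section

/-- `ℚ̄`: the field of algebraic numbers, i.e. the algebraic closure of `ℚ` inside `ℂ`. -/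
def Qbar : IntermediateField ℚ ℂ := algebraicClosure ℚ ℂ

/-- `f : ℂ → ℂ` is the E-function with Taylor coefficients `aₙ/n!` (the `aₙ` being
algebraic numbers): `f(z) = ∑ aₙ/n! zⁿ`; the conjugates of the `aₙ` grow at most
geometrically; the `aₙ` admit denominators growing at most geometrically; and `f`
satisfies a nonzero linear differential equation with coefficients in `ℚ̄(z)`
(equivalently, after clearing denominators, with polynomial coefficients all of
whose coefficients are algebraic). -/
def IsEFunctionWith (a : ℕ → Qbar) (f : ℂ → ℂ) : Prop :=
  (∀ z : ℂ, HasSum (fun n : ℕ => (a n : ℂ) / n.factorial * z ^ n) (f z)) ∧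
  (∃ C : ℝ, 0 < C ∧ ∀ σ : Qbar →+* ℂ, ∀ n : ℕ, ‖σ (a n)‖ ≤ C ^ (n + 1)) ∧
  (∃ D : ℝ, 0 < D ∧ ∃ d : ℕ → ℕ, (∀ n : ℕ, d n ≠ 0 ∧ (d n : ℝ) ≤ D ^ (n + 1)) ∧
    ∀ n : ℕ, ∀ m ≤ n, IsIntegral ℤ ((d n : ℂ) * (a m : ℂ))) ∧
  (∃ r : ℕ, ∃ p : Fin (r + 1) → Polynomial ℂ,
    (∀ j, ∀ i, IsAlgebraic ℚ ((p j).coeff i)) ∧ (∃ j, p j ≠ 0) ∧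
    ∀ z : ℂ, ∑ j : Fin (r + 1), (p j).eval z * iteratedDeriv (j : ℕ) f z = 0)

/-- `f : ℂ → ℂ` is an E-function. -/
def IsEFunction (f : ℂ → ℂ) : Prop := ∃ a : ℕ → Qbar, IsEFunctionWith a f

/-- The function `f` is algebraic over `ℂ(z)`: there is a nonzero two-variable
polynomial `P ∈ ℂ[z][Y]` with `P(z, f(z)) = 0` for all `z`. -/
def IsAlgebraicFunc (f : ℂ → ℂ) : Prop :=
  ∃ P : Polynomial (Polynomial ℂ), P ≠ 0 ∧
    ∀ z : ℂ, ((P.eval (Polynomial.C (f z))).eval z) = 0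

/-- The function `f` is algebraic over `ℚ̄(z)`: there is a nonzero two-variable
polynomial `P ∈ ℚ̄[z][Y]` with `P(z, f(z)) = 0` for all `z`. -/
def IsAlgebraicFuncQbar (f : ℂ → ℂ) : Prop :=
  ∃ P : Polynomial (Polynomial ℂ), P ≠ 0 ∧
    (∀ i k, IsAlgebraic ℚ ((P.coeff i).coeff k)) ∧
    ∀ z : ℂ, ((P.eval (Polynomial.C (f z))).eval z) = 0

open scoped Polynomial

namespace EFun

section Wronskian

open PowerSeries

variable {F : Type*} [Field F] [CharZero F]

theorem eq_zero_of_wronskian_of_coeff_order {g h : F⟦X⟧} (hg : g ≠ 0)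
    (hw : g * d⁄dX F h = d⁄dX F g * h) (hc : coeff g.order.toNat h = 0) : h = 0 := by
  by_contra hh
  obtain ⟨a, ha⟩ := X_pow_order_dvd (φ := g)
  obtain ⟨b, hb⟩ := X_pow_order_dvd (φ := h)
  set n := g.order.toNat
  set m := h.order.toNat with hm
  have hb0 : coeff m h ≠ 0 := coeff_order hh
  have ha0 : coeff n g ≠ 0 := coeff_order hg
  have hXd : ∀ (k : ℕ) (p : F⟦X⟧), X * d⁄dX F (X ^ k * p) = X ^ k * ((k : F⟦X⟧) * p + X * d⁄dX F p) := by
    intro k p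
    rw [Derivation.leibniz, Derivation.leibniz_pow]
    rcases k with _ | k
    · simp
    · simp only [smul_eq_mul, nsmul_eq_mul, derivative_X, Nat.add_sub_cancel]
      push_cast
      ring
  have h1 : X ^ (n + m) * (a * ((m : F⟦X⟧) * b + X * d⁄dX F b) -
      b * ((n : F⟦X⟧) * a + X * d⁄dX F a)) = 0 := by
    have : X * (g * d⁄dX F h) = X * (d⁄dX F g * h) := by rw [hw]
    rw [ha, hb] at this
    have e1 := hXd n a
    have e2 := hXd m b
    rw [pow_add]
    linear_combination this - (X ^ n * a) * e2 + (X ^ m * b) * e1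
  have h2 := (mul_eq_zero.mp h1).resolve_left (pow_ne_zero _ X_ne_zero)
  have h3 := congrArg (constantCoeff (R := F)) h2
  simp only [map_sub, map_mul, map_add, map_natCast, constantCoeff_X, zero_mul, add_zero, map_zero] at h3
  have ea : constantCoeff (R := F) a = coeff n g := by
    rw [ha, coeff_X_pow_mul']; simp
  have eb : constantCoeff (R := F) b = coeff m h := by
    rw [hb, coeff_X_pow_mul']; simp
  rw [ea, eb] at h3
  have h4 : ((m : F) - n) * (coeff n g * coeff m h) = 0 := by linear_combination h3
  have h5 := (mul_eq_zero.mp h4).resolve_right (mul_ne_zero ha0 hb0)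
  have h6 : m = n := by exact_mod_cast sub_eq_zero.mp h5
  rw [h6] at hb0
  exact hb0 hc

theorem exists_eq_C_mul_of_wronskian {g h : F⟦X⟧} (hg : g ≠ 0)
    (hw : g * d⁄dX F h = d⁄dX F g * h) : ∃ c : F, h = C c * g := by
  have ha0 : coeff g.order.toNat g ≠ 0 := coeff_order hg
  refine ⟨coeff g.order.toNat h / coeff g.order.toNat g, ?_⟩
  rw [← sub_eq_zero]
  refine eq_zero_of_wronskian_of_coeff_order hg ?_ ?_
  · rw [map_sub, Derivation.leibniz]
    simp only [derivative_C, smul_eq_mul]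
    linear_combination hw
  · rw [map_sub, coeff_C_mul, div_mul_cancel₀ _ ha0, sub_self]

theorem linearIndependent_of_isSol {ι n : Type*} [Fintype n] {t : F⟦X⟧} (ht : t ≠ 0)
    {A : n → n → F⟦X⟧} {Y : ι → n → F⟦X⟧}
    (hY : ∀ j i, t * d⁄dX F (Y j i) = ∑ k, A i k * Y j k) (hli : LinearIndependent F Y) :
    LinearIndependent F⟦X⟧ Y := by
  classical
  rw [linearIndependent_iff']
  intro s
  induction hs : s.card generalizing s with
  | zero => intro g _ i hi; rw [Finset.card_eq_zero] at hs; simp [hs] at hi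
  | succ c ih =>
    intro g hg
    by_contra! hne
    obtain ⟨j0, hj0, hgj⟩ := hne
    have hgi : ∀ i, ∑ j ∈ s, g j * Y j i = 0 := fun i => by
      have := congrFun hg i
      simpa using this
    have hd : ∀ i, ∑ j ∈ s, d⁄dX F (g j) * Y j i = 0 := by
      intro i
      have h1 := congrArg (d⁄dX F) (hgi i)
      rw [map_sum, map_zero] at h1
      simp only [Derivation.leibniz, smul_eq_mul, Finset.sum_add_distrib] at h1
      have h2 : t * ∑ j ∈ s, g j * d⁄dX F (Y j i) = 0 := by
        have : t * ∑ j ∈ s, g j * d⁄dX F (Y j i) = ∑ k, A i k * ∑ j ∈ s, g j * Y j k := by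
          simp only [Finset.mul_sum]
          rw [Finset.sum_comm]
          refine Finset.sum_congr rfl fun j _ => ?_
          rw [mul_left_comm, hY, Finset.mul_sum]
          exact Finset.sum_congr rfl fun k _ => by ring
        rw [this]; simp [hgi]
      have h3 := (mul_eq_zero.mp h2).resolve_left ht
      rw [h3, zero_add] at h1
      rw [← h1]
      exact Finset.sum_congr rfl fun j _ => by ring
    have hh : ∀ j ∈ s.erase j0, g j0 * d⁄dX F (g j) - d⁄dX F (g j0) * g j = 0 := by
      refine ih (s.erase j0) (by rw [Finset.card_erase_of_mem hj0, hs]; rfl) _ ?_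
      funext i
      simp only [Finset.sum_apply, Pi.smul_apply, smul_eq_mul, Pi.zero_apply]
      have e : ∑ j ∈ s, (g j0 * d⁄dX F (g j) - d⁄dX F (g j0) * g j) * Y j i = 0 := by
        have : ∑ j ∈ s, (g j0 * d⁄dX F (g j) - d⁄dX F (g j0) * g j) * Y j i
          = g j0 * ∑ j ∈ s, d⁄dX F (g j) * Y j i - d⁄dX F (g j0) * ∑ j ∈ s, g j * Y j i := by
          rw [Finset.mul_sum, Finset.mul_sum, ← Finset.sum_sub_distrib]
          exact Finset.sum_congr rfl fun j _ => by ring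
        rw [this, hd, hgi]; ring
      rw [← Finset.add_sum_erase _ _ hj0] at e
      rw [← e]; ring
    have hc : ∀ j, ∃ c : F, j ∈ s → g j = C c * g j0 := by
      intro j
      by_cases hj : j ∈ s
      · by_cases hjj : j = j0
        · exact ⟨1, fun _ => by simp [hjj]⟩
        · obtain ⟨c, hc⟩ := exists_eq_C_mul_of_wronskian hgj (h := g j)
            (by linear_combination hh j (Finset.mem_erase.mpr ⟨hjj, hj⟩))
          exact ⟨c, fun _ => hc⟩
      · exact ⟨0, fun h => absurd h hj⟩
    choose c hc using hc
    have hz : ∑ j ∈ s, c j • Y j = 0 := by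
      funext i
      have h1 := hgi i
      rw [Finset.sum_congr rfl fun j hj => by rw [hc j hj]] at h1
      have h2 : g j0 * ∑ j ∈ s, c j • Y j i = 0 := by
        rw [← h1, Finset.mul_sum]
        exact Finset.sum_congr rfl fun j _ => by rw [PowerSeries.smul_eq_C_mul]; ring
      simpa using (mul_eq_zero.mp h2).resolve_left hgj
    have := linearIndependent_iff'.mp hli s c hz j0 hj0
    apply hgj
    rw [hc j0 hj0, this]; simp

end Wronskian

section LinearAlgebra

theorem linearIndependent_map_fractionRing {R : Type*} [CommRing R] [IsDomain R] {ι n : Type*}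
    (Q : Type*) [Field Q] [Algebra R Q] [IsFractionRing R Q] {v : ι → n → R}
    (hv : LinearIndependent R v) :
    LinearIndependent Q (fun x i => algebraMap R Q (v x i)) := by
  rw [← LinearIndependent.iff_fractionRing R Q]
  let f : (n → R) →ₗ[R] (n → Q) := LinearMap.pi fun i => (Algebra.linearMap R Q) ∘ₗ LinearMap.proj i
  refine hv.map' f ?_
  rw [LinearMap.ker_eq_bot]
  intro x y hxy
  funext i
  exact IsFractionRing.injective R Q (congrFun hxy i)

theorem card_add_card_le_of_orthogonal_of_field {Q : Type*} [Field Q] {ι κ n : Type*}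
    [Fintype ι] [Fintype κ] [Fintype n] {a : ι → n → Q} {b : κ → n → Q}
    (ha : LinearIndependent Q a) (hb : LinearIndependent Q b)
    (h : ∀ x y, ∑ i, a x i * b y i = 0) :
    Fintype.card ι + Fintype.card κ ≤ Fintype.card n := by
  classical
  have h1 : (Matrix.of a).rank = _ := LinearIndependent.rank_matrix ha
  have h2 : (Matrix.of b).rank = _ := LinearIndependent.rank_matrix hb
  have := Matrix.rank_add_rank_le_card_of_mul_eq_zero
    (A := Matrix.of a) (B := (Matrix.of b).transpose) (by
      ext x y
      simpa [Matrix.mul_apply] using h x y)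
  rwa [Matrix.rank_transpose, h1, h2] at this

theorem card_add_card_le_of_orthogonal {R : Type*} [CommRing R] [IsDomain R] {ι κ n : Type*}
    [Fintype ι] [Fintype κ] [Fintype n] {a : ι → n → R} {b : κ → n → R}
    (ha : LinearIndependent R a) (hb : LinearIndependent R b)
    (h : ∀ x y, ∑ i, a x i * b y i = 0) :
    Fintype.card ι + Fintype.card κ ≤ Fintype.card n := by
  refine card_add_card_le_of_orthogonal_of_field
    (linearIndependent_map_fractionRing (FractionRing R) ha)
    (linearIndependent_map_fractionRing (FractionRing R) hb) fun x y => ?_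
  rw [← map_zero (algebraMap R (FractionRing R)), ← h x y, map_sum]
  simp only [map_mul]

end LinearAlgebra

section Minors

theorem exists_minor_ne_zero_of_field {Q : Type*} [Field Q] {ι n : Type*} [Fintype ι] [DecidableEq ι]
    [Fintype n] {v : ι → n → Q} (hv : LinearIndependent Q v) :
    ∃ e : ι → n, (Matrix.of fun i j => v i (e j)).det ≠ 0 := by
  classical
  have h1 : (Matrix.of v).rank = _ := LinearIndependent.rank_matrix hv
  obtain ⟨κ, a, ha, hsp, hli⟩ := exists_linearIndependent' Q (Matrix.of v).col
  have : Fintype κ := Fintype.ofInjective a ha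
  have h2 : Fintype.card κ = Fintype.card ι := by
    rw [← h1, Matrix.rank_eq_finrank_span_cols, ← hsp, finrank_span_eq_card hli]
  let f : ι ≃ κ := (Fintype.equivOfCardEq h2).symm
  refine ⟨a ∘ f, ?_⟩
  have h3 := hli.comp f f.injective
  have h4 : LinearIndependent Q (Matrix.of fun i j => v i ((a ∘ f) j)).col := h3
  rw [Matrix.linearIndependent_cols_iff_isUnit, Matrix.isUnit_iff_isUnit_det] at h4
  exact h4.ne_zero

theorem exists_minor_ne_zero {R : Type*} [CommRing R] [IsDomain R] {ι n : Type*} [Fintype ι]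
    [DecidableEq ι] [Fintype n] {v : ι → n → R} (hv : LinearIndependent R v) :
    ∃ e : ι → n, (Matrix.of fun i j => v i (e j)).det ≠ 0 := by
  obtain ⟨e, he⟩ := exists_minor_ne_zero_of_field
    (linearIndependent_map_fractionRing (FractionRing R) hv)
  refine ⟨e, fun h => he ?_⟩
  rw [← map_zero (algebraMap R (FractionRing R)), ← h, RingHom.map_det]
  rfl

theorem linearIndependent_of_minor_ne_zero {R : Type*} [CommRing R] [IsDomain R] {ι n : Type*}
    [Fintype ι] [DecidableEq ι] {v : ι → n → R} (e : ι → n)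
    (h : (Matrix.of fun i j => v i (e j)).det ≠ 0) : LinearIndependent R v :=
  LinearIndependent.of_comp (LinearMap.funLeft R R e)
    (Matrix.linearIndependent_rows_of_det_ne_zero h)

theorem linearIndependent_map_of_injective {R S : Type*} [CommRing R] [IsDomain R] [CommRing S]
    [IsDomain S] {φ : R →+* S} (hφ : Function.Injective φ) {ι n : Type*} [Fintype ι]
    [Fintype n] {v : ι → n → R} (hv : LinearIndependent R v) :
    LinearIndependent S (fun i j => φ (v i j)) := by
  classical
  obtain ⟨e, he⟩ := exists_minor_ne_zero hv
  refine linearIndependent_of_minor_ne_zero e fun h => he (hφ ?_)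
  rw [map_zero, ← h, RingHom.map_det]
  rfl

theorem det_ne_zero_of_linearIndependent {R : Type*} [CommRing R] [IsDomain R] {ι : Type*}
    [Fintype ι] [DecidableEq ι] {v : ι → ι → R} (hv : LinearIndependent R v) :
    (Matrix.of v).det ≠ 0 := by
  have h1 := linearIndependent_map_fractionRing (FractionRing R) hv
  have h4 : LinearIndependent (FractionRing R)
    (Matrix.of fun i j => algebraMap R (FractionRing R) (v i j)).row := h1
  rw [Matrix.linearIndependent_rows_iff_isUnit, Matrix.isUnit_iff_isUnit_det] at h4
  intro h
  apply h4.ne_zero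
  rw [← map_zero (algebraMap R (FractionRing R)), ← h, RingHom.map_det]
  rfl

theorem natDegree_det_le_of_forall_le {R : Type*} [CommRing R] {n : Type*} [Fintype n] [DecidableEq n]
    (M : Matrix n n R[X]) (c : ℕ) (h : ∀ i j, (M i j).natDegree ≤ c) :
    M.det.natDegree ≤ Fintype.card n * c := by
  rw [Matrix.det_apply]
  refine Polynomial.natDegree_sum_le_of_forall_le _ _ fun σ _ => ?_
  refine (Polynomial.natDegree_smul_le _ _).trans ?_
  refine (Polynomial.natDegree_prod_le _ _).trans ?_
  refine (Finset.sum_le_sum fun i _ => h _ _).trans ?_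
  simp

/-- A matrix of polynomials of bounded degree with a nonzero kernel vector has one of bounded
degree. -/
theorem exists_small_kernel_vector {F : Type*} [Field F] {ρ n : Type*} [Fintype n]
    (v : ρ → n → F[X]) (c : ℕ) (hdeg : ∀ i j, (v i j).natDegree ≤ c)
    (b : n → F[X]) (hb : b ≠ 0) (hvb : ∀ i, ∑ j, v i j * b j = 0) :
    ∃ w : n → F[X], w ≠ 0 ∧ (∀ j, (w j).natDegree ≤ Fintype.card n * c) ∧
      ∀ i, ∑ j, v i j * w j = 0 := by
  classical
  let Q := FractionRing F[X]
  let φ : F[X] →+* Q := algebraMap F[X] Q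
  have hφ : Function.Injective φ := IsFractionRing.injective F[X] Q
  obtain ⟨κ, a, ha, hsp, hli⟩ := exists_linearIndependent' Q (fun i j => φ (v i j))
  have : Finite κ := hli.finite
  have : Fintype κ := Fintype.ofFinite κ
  have hli' : LinearIndependent F[X] (v ∘ a) := by
    have : LinearIndependent F[X] ((fun i j => φ (v i j)) ∘ a) := by
      rwa [LinearIndependent.iff_fractionRing F[X] Q]
    let f : (n → F[X]) →ₗ[F[X]] (n → Q) :=
      LinearMap.pi fun i => (Algebra.linearMap F[X] Q) ∘ₗ LinearMap.proj i
    exact LinearIndependent.of_comp f this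
  obtain ⟨e, he⟩ := exists_minor_ne_zero hli'
  set V := Matrix.of fun i j => (v ∘ a) i (e j) with hV
  have hcard : Fintype.card κ < Fintype.card n := by
    have hb' : LinearIndependent F[X] (fun _ : Unit => b) := by
      rw [linearIndependent_unique_iff]; exact hb
    have := card_add_card_le_of_orthogonal hli' hb' (fun x _ => hvb (a x))
    simp only [Fintype.card_unit] at this
    omega
  obtain ⟨j, hj⟩ : ∃ j, j ∉ Set.range e := by
    by_contra! h
    have : Function.Surjective e := h
    have := Fintype.card_le_of_surjective e this
    omega
  have hVdeg : ∀ i j, (V i j).natDegree ≤ c := fun i j => hdeg _ _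
  have hadj : ∀ i j, (V.adjugate i j).natDegree ≤ Fintype.card κ * c := by
    intro x y
    rw [Matrix.adjugate_apply]
    refine natDegree_det_le_of_forall_le _ _ fun i j => ?_
    rw [Matrix.updateRow_apply]
    split_ifs
    · rw [Pi.single_apply]; split_ifs <;> simp
    · exact hVdeg i j
  have hdet : V.det.natDegree ≤ Fintype.card κ * c := natDegree_det_le_of_forall_le _ _ hVdeg
  let u : κ → F[X] := V.adjugate.mulVec fun i => v (a i) j
  let w : n → F[X] := fun k => (∑ i, if k = e i then - u i else 0) + if k = j then V.det else 0
  have hu : ∀ i, (u i).natDegree ≤ Fintype.card κ * c + c := fun i =>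
    Polynomial.natDegree_sum_le_of_forall_le _ _ fun k _ =>
      Polynomial.natDegree_mul_le.trans (add_le_add (hadj _ _) (hdeg _ _))
  have hle : Fintype.card κ * c + c ≤ Fintype.card n * c := by
    calc _ = (Fintype.card κ + 1) * c := by ring
      _ ≤ _ := Nat.mul_le_mul_right _ hcard
  have hwk : ∀ i, ∑ k, v (a i) k * w k = 0 := by
    intro i
    simp only [w, mul_add, Finset.sum_add_distrib, Finset.mul_sum]
    rw [Finset.sum_comm]
    simp only [mul_ite, mul_zero, Finset.sum_ite_eq', Finset.mem_univ, if_true]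
    have : ∑ k, V i k * u k = V.det * v (a i) j := by
      have h1 : V.mulVec (V.adjugate.mulVec fun i => v (a i) j) = V.det • fun i => v (a i) j := by
        rw [Matrix.mulVec_mulVec, Matrix.mul_adjugate, Matrix.smul_mulVec, Matrix.one_mulVec]
      exact congrFun h1 i
    simp only [hV, Matrix.of_apply, Function.comp] at this
    simp only [mul_neg, Finset.sum_neg_distrib]
    simp only [hV, Function.comp] at *
    rw [this]; ring
  refine ⟨w, fun h => he ?_, fun k => ?_, fun i => ?_⟩
  · have := congrFun h j
    simp only [w, if_true, Pi.zero_apply] at this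
    rw [Finset.sum_eq_zero, zero_add] at this
    · exact this
    · intro i _
      rw [if_neg]
      rintro rfl
      exact hj ⟨i, rfl⟩
  · refine (Polynomial.natDegree_add_le_of_degree_le (n := Fintype.card n * c) ?_ ?_)
    · refine Polynomial.natDegree_sum_le_of_forall_le _ _ fun i _ => ?_
      split_ifs
      · rw [Polynomial.natDegree_neg]; exact (hu i).trans hle
      · simp
    · split_ifs
      · exact hdet.trans (by omega)
      · simp
  · have hmem : (fun j => φ (v i j)) ∈ Submodule.span Q (Set.range ((fun i j => φ (v i j)) ∘ a)) := by
      rw [hsp]; exact Submodule.subset_span ⟨i, rfl⟩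
    have hle : Submodule.span Q (Set.range ((fun i j => φ (v i j)) ∘ a)) ≤
        LinearMap.ker (∑ k, φ (w k) • (LinearMap.proj k : (n → Q) →ₗ[Q] Q)) := by
      rw [Submodule.span_le]
      rintro _ ⟨k, rfl⟩
      rw [SetLike.mem_coe, LinearMap.mem_ker]
      simp only [LinearMap.sum_apply, LinearMap.smul_apply, LinearMap.proj_apply, smul_eq_mul,
        Function.comp]
      rw [← map_zero φ, ← hwk k, map_sum]
      exact Finset.sum_congr rfl fun _ _ => by rw [map_mul, mul_comm]
    have h0 := hle hmem
    rw [LinearMap.mem_ker] at h0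
    simp only [LinearMap.sum_apply, LinearMap.smul_apply, LinearMap.proj_apply, smul_eq_mul] at h0
    apply hφ
    rw [map_zero, ← h0, map_sum]
    exact Finset.sum_congr rfl fun _ _ => by rw [map_mul, mul_comm]

end Minors

theorem exists_order_bound {F V σ : Type*} [Field F] [AddCommGroup V] [Module F V]
    [FiniteDimensional F V] (φ : V →ₗ[F] (σ → PowerSeries F)) (hφ : Function.Injective φ) :
    ∃ c : ℕ, ∀ v, (∀ s, PowerSeries.X ^ c ∣ φ v s) → v = 0 := by
  let S : ℕ → Submodule F V := fun c => ⨅ i : Fin c, ⨅ s : σ,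
    LinearMap.ker ((PowerSeries.coeff (R := F) i) ∘ₗ LinearMap.proj s ∘ₗ φ)
  have hS : ∀ c v, v ∈ S c ↔ ∀ s, PowerSeries.X ^ c ∣ φ v s := by
    intro c v
    simp only [PowerSeries.X_pow_dvd_iff]
    simp only [S, Submodule.mem_iInf, LinearMap.mem_ker, LinearMap.comp_apply,
      LinearMap.proj_apply]
    exact ⟨fun h s m hm => h ⟨m, hm⟩ s, fun h m s => h s m m.2⟩
  obtain ⟨c, hc⟩ := IsArtinian.monotone_stabilizes (R := F) (M := V)
    ⟨fun c => OrderDual.toDual (S c), fun a b hab => by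
      change S b ≤ S a
      intro v hv
      rw [hS] at hv ⊢
      exact fun s => (pow_dvd_pow _ hab).trans (hv s)⟩
  refine ⟨c, fun v hv => hφ ?_⟩
  rw [map_zero]
  funext s
  ext m
  have hm : v ∈ S (max c (m+1)) := by
    have : S c = S (max c (m+1)) := hc _ (le_max_left _ _)
    rw [← this, hS]; exact hv
  rw [hS] at hm
  exact PowerSeries.X_pow_dvd_iff.mp (hm s) m (by omega)

section Systems

variable {F : Type*} [Field F]

/-- Expansion of a polynomial at the point `c`. -/
def sh (c : F) : F[X] →+* PowerSeries F :=
  (Polynomial.coeToPowerSeries.ringHom (R := F)).comp (Polynomial.taylorAlgHom c : F[X] →+* F[X])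

theorem sh_apply (c : F) (p : F[X]) : sh c p = (Polynomial.taylor c p : PowerSeries F) := rfl

theorem sh_injective (c : F) : Function.Injective (sh c) := fun _ _ h =>
  Polynomial.taylor_injective c (Polynomial.coe_injective F h)

theorem sh_ne_zero (c : F) {p : F[X]} (hp : p ≠ 0) : sh c p ≠ 0 :=
  (map_ne_zero_iff _ (sh_injective c)).mpr hp

theorem sh_zero (p : F[X]) : sh 0 p = (p : PowerSeries F) := by
  rw [sh_apply, Polynomial.taylor_zero]

theorem sh_C (c a : F) : sh c (Polynomial.C a) = PowerSeries.C a := by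
  rw [sh_apply, Polynomial.taylor_C, Polynomial.coe_C]

theorem sh_X (c : F) : sh c Polynomial.X = PowerSeries.X + PowerSeries.C c := by
  rw [sh_apply, Polynomial.taylor_X, Polynomial.coe_add, Polynomial.coe_C, Polynomial.coe_X]

theorem constantCoeff_sh (c : F) (p : F[X]) :
    PowerSeries.constantCoeff (sh c p) = p.eval c := by
  rw [sh_apply, ← PowerSeries.coeff_zero_eq_constantCoeff_apply, Polynomial.coeff_coe,
    Polynomial.taylor_coeff_zero]

theorem derivative_sh (c : F) (p : F[X]) :
    PowerSeries.derivative F (sh c p) = sh c (Polynomial.derivative p) := by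
  rw [sh_apply, sh_apply, PowerSeries.derivative_coe]
  simp [Polynomial.taylor_apply, Polynomial.derivative_comp]

theorem X_pow_dvd_sh_iff (c : F) (p : F[X]) (k : ℕ) :
    PowerSeries.X ^ k ∣ sh c p ↔ (Polynomial.X - Polynomial.C c) ^ k ∣ p := by
  constructor
  · intro h
    have h1 : Polynomial.X ^ k ∣ Polynomial.taylor c p := by
      rw [Polynomial.X_pow_dvd_iff]
      rw [PowerSeries.X_pow_dvd_iff] at h
      intro d hd
      have := h d hd
      rwa [sh_apply, Polynomial.coeff_coe] at this
    obtain ⟨q, hq⟩ := h1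
    refine ⟨Polynomial.taylor (-c) q, ?_⟩
    apply Polynomial.taylor_injective c
    rw [Polynomial.taylor_mul, Polynomial.taylor_taylor, hq]
    simp [Polynomial.taylor_apply]
  · rintro ⟨q, rfl⟩
    rw [map_mul, map_pow, map_sub, sh_X, sh_C]
    simp

variable {ι : Type*} [Fintype ι]

/-- The vector `y` of expansions at `c` solves the differential system `t y' = A y`. -/
def IsSol (c : F) (t : F[X]) (A : ι → ι → F[X]) (y : ι → PowerSeries F) : Prop :=
  ∀ i, sh c t * PowerSeries.derivative F (y i) = ∑ k, sh c (A i k) * y k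

/-- The value of a linear form with polynomial coefficients at a vector of expansions at `c`. -/
def app (c : F) (P : ι → F[X]) (y : ι → PowerSeries F) : PowerSeries F := ∑ i, sh c (P i) * y i

/-- The action of `t d/dz` on linear forms in a solution of the system `t y' = A y`. -/
def opD (t : F[X]) (A : ι → ι → F[X]) (P : ι → F[X]) : ι → F[X] := fun i =>
  t * Polynomial.derivative (P i) + ∑ k, P k * A k i

theorem app_opD {c : F} {t : F[X]} {A : ι → ι → F[X]} {y : ι → PowerSeries F}
    (hy : IsSol c t A y) (P : ι → F[X]) :
    app c (opD t A P) y = sh c t * PowerSeries.derivative F (app c P y) := by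
  simp only [app, opD, map_sum, Derivation.leibniz, smul_eq_mul, map_add, map_mul, derivative_sh]
  simp only [add_mul, Finset.sum_add_distrib, mul_add, Finset.mul_sum, Finset.sum_mul]
  rw [add_comm]
  congr 1
  · rw [Finset.sum_comm]
    refine Finset.sum_congr rfl fun i _ => ?_
    rw [mul_left_comm, hy, Finset.mul_sum]
    exact Finset.sum_congr rfl fun k _ => by ring
  · exact Finset.sum_congr rfl fun i _ => by ring

theorem X_pow_dvd_app_opD_iterate {c : F} {t : F[X]} {A : ι → ι → F[X]} {y : ι → PowerSeries F}
    (hy : IsSol c t A y) {P : ι → F[X]} {k : ℕ} (h : PowerSeries.X ^ k ∣ app c P y) (j : ℕ) :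
    PowerSeries.X ^ (k - j) ∣ app c ((opD t A)^[j] P) y := by
  induction j with
  | zero => simpa using h
  | succ j ih =>
    rw [Function.iterate_succ_apply', app_opD hy]
    refine Dvd.dvd.mul_left ?_ _
    rw [PowerSeries.X_pow_dvd_iff] at ih ⊢
    intro m hm
    rw [PowerSeries.coeff_derivative, ih _ (by omega), zero_mul]

theorem natDegree_opD_iterate_le {t : F[X]} {A : ι → ι → F[X]} {g : ℕ} (ht : t.natDegree ≤ g)
    (hA : ∀ i k, (A i k).natDegree ≤ g) {P : ι → F[X]} {N : ℕ} (hP : ∀ i, (P i).natDegree ≤ N)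
    (j : ℕ) (i : ι) : ((opD t A)^[j] P i).natDegree ≤ N + j * g := by
  induction j generalizing i with
  | zero => simpa using hP i
  | succ j ih =>
    rw [Function.iterate_succ_apply']
    refine Polynomial.natDegree_add_le_of_degree_le ?_ ?_
    · refine Polynomial.natDegree_mul_le.trans ?_
      have := Polynomial.natDegree_derivative_le ((opD t A)^[j] P i)
      have := ih i
      rw [add_mul, one_mul]
      omega
    · refine Polynomial.natDegree_sum_le_of_forall_le _ _ fun k _ => ?_
      refine Polynomial.natDegree_mul_le.trans ?_
      have := ih k
      have := hA k i
      rw [add_mul, one_mul]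
      omega

end Systems

section Fundamental

variable {F : Type*} [Field F] [CharZero F] {ι : Type*} [Fintype ι] [DecidableEq ι]

/-- Coefficients of the fundamental matrix of `Y' = B Y` normalised by `Y(0) = 1`. -/
def fundCoeff (B : ℕ → Matrix ι ι F) : ℕ → Matrix ι ι F
  | 0 => 1
  | k + 1 => ((k : F) + 1)⁻¹ • ∑ i : Fin (k + 1), B i * fundCoeff B (k - i)

/-- A differential system has, at a regular point, a basis of solutions. -/
theorem exists_fundamental (c : F) (t : F[X]) (A : ι → ι → F[X]) (hc : t.eval c ≠ 0) :
    ∃ Φ : ι → ι → PowerSeries F, (∀ h, IsSol c t A (Φ h)) ∧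
      ∀ h i, PowerSeries.constantCoeff (Φ h i) = if i = h then 1 else 0 := by
  have hu : sh c t * (sh c t)⁻¹ = 1 := PowerSeries.mul_inv_cancel _ (by rwa [constantCoeff_sh])
  let B : ℕ → Matrix ι ι F := fun m => Matrix.of fun i k =>
    PowerSeries.coeff m ((sh c t)⁻¹ * sh c (A i k))
  let Φ : ι → ι → PowerSeries F := fun h i => PowerSeries.mk fun m => fundCoeff B m i h
  refine ⟨Φ, fun h i => ?_, fun h i => ?_⟩
  · have key : PowerSeries.derivative F (Φ h i) = ∑ k, ((sh c t)⁻¹ * sh c (A i k)) * Φ h k := by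
      ext m
      rw [PowerSeries.coeff_derivative, PowerSeries.coeff_mk, fundCoeff, map_sum]
      rw [Finset.sum_congr rfl fun k _ => PowerSeries.coeff_mul _ _ _]
      rw [Finset.sum_comm, Finset.Nat.sum_antidiagonal_eq_sum_range_succ_mk, Finset.sum_range]
      have hm : ((m : F) + 1) ≠ 0 := by exact_mod_cast Nat.succ_ne_zero m
      rw [Matrix.smul_apply, smul_eq_mul, mul_comm, mul_inv_cancel_left₀ hm, Matrix.sum_apply]
      refine Finset.sum_congr rfl fun j _ => ?_
      simp [Matrix.mul_apply, B, Φ]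
    rw [key, Finset.mul_sum]
    refine Finset.sum_congr rfl fun k _ => ?_
    rw [← mul_assoc, ← mul_assoc, hu, one_mul]
  · simp [Φ, ← PowerSeries.coeff_zero_eq_constantCoeff_apply, fundCoeff, Matrix.one_apply]

end Fundamental

/-- A finite family in an algebra over a domain is, up to a common denominator, generated by a
linearly independent subfamily. -/
theorem exists_relation_basis_of_subset {R S : Type*} [CommRing R] [IsDomain R] [CommRing S]
    (φ : R →+* S) {σ : Type*} [Fintype σ] (x : σ → S) {s₀ : Finset σ}
    (h₀ : ∀ q : σ → R, ∑ j ∈ s₀, φ (q j) * x j = 0 → ∀ j ∈ s₀, q j = 0) :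
    ∃ (s : Finset σ) (g : R) (p : σ → σ → R), s₀ ⊆ s ∧ g ≠ 0 ∧
      (∀ q : σ → R, ∑ j ∈ s, φ (q j) * x j = 0 → ∀ j ∈ s, q j = 0) ∧
      ∀ i, φ g * x i = ∑ j ∈ s, φ (p i j) * x j := by
  classical
  obtain ⟨s, hs, hmax⟩ := (Finset.univ.filter fun s : Finset σ => s₀ ⊆ s ∧
    ∀ q : σ → R, ∑ j ∈ s, φ (q j) * x j = 0 → ∀ j ∈ s, q j = 0).exists_max_image
      Finset.card ⟨s₀, by simpa using h₀⟩
  rw [Finset.mem_filter] at hs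
  have h1 : ∀ i, ∃ (a : R) (c : σ → R), a ≠ 0 ∧ φ a * x i = ∑ j ∈ s, φ (c j) * x j := by
    intro i
    by_cases hi : i ∈ s
    · refine ⟨1, Pi.single i 1, one_ne_zero, ?_⟩
      rw [Finset.sum_eq_single_of_mem i hi fun j _ hj => by
        rw [Pi.single_eq_of_ne hj, map_zero, zero_mul], Pi.single_eq_same]
    · by_contra! hcon
      have hins : ∀ q : σ → R, ∑ j ∈ insert i s, φ (q j) * x j = 0 → ∀ j ∈ insert i s, q j = 0 := by
        intro q hq
        rw [Finset.sum_insert hi] at hq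
        have hqi : q i = 0 := by
          by_contra hne
          refine hcon (q i) (fun j => -q j) hne ?_
          simp only [map_neg, neg_mul, Finset.sum_neg_distrib]
          exact eq_neg_of_add_eq_zero_left hq
        rw [hqi, map_zero, zero_mul, zero_add] at hq
        intro j hj
        rcases Finset.mem_insert.mp hj with rfl | hj
        exacts [hqi, hs.2.2 q hq j hj]
      have := hmax (insert i s) (Finset.mem_filter.mpr
        ⟨Finset.mem_univ _, hs.2.1.trans (Finset.subset_insert i s), hins⟩)
      rw [Finset.card_insert_of_notMem hi] at this
      omega
  choose a c ha hac using h1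
  refine ⟨s, ∏ k, a k, fun i j => (∏ k ∈ Finset.univ.erase i, a k) * c i j, hs.2.1,
    Finset.prod_ne_zero_iff.mpr fun i _ => ha i, hs.2.2, fun i => ?_⟩
  rw [← Finset.prod_erase_mul _ _ (Finset.mem_univ i), map_mul, mul_assoc, hac, Finset.mul_sum]
  exact Finset.sum_congr rfl fun j _ => by rw [map_mul, mul_assoc]

theorem exists_relation_basis {R S : Type*} [CommRing R] [IsDomain R] [CommRing S] (φ : R →+* S)
    {σ : Type*} [Fintype σ] (x : σ → S) :
    ∃ (s : Finset σ) (g : R) (p : σ → σ → R), g ≠ 0 ∧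
      (∀ q : σ → R, ∑ j ∈ s, φ (q j) * x j = 0 → ∀ j ∈ s, q j = 0) ∧
      ∀ i, φ g * x i = ∑ j ∈ s, φ (p i j) * x j := by
  obtain ⟨s, g, p, -, h⟩ := exists_relation_basis_of_subset φ x (s₀ := ∅) (by simp)
  exact ⟨s, g, p, h⟩

section Shidlovskii

variable {F : Type*} [Field F]

theorem X_pow_sub_dvd_of_mul {x y : PowerSeries F} {a c : ℕ} (h : PowerSeries.X ^ a ∣ x * y)
    (hy : ¬ PowerSeries.X ^ c ∣ y) : PowerSeries.X ^ (a - c) ∣ x := by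
  rw [PowerSeries.X_pow_dvd_iff] at h hy ⊢
  have h1 : (a : ℕ∞) ≤ (x * y).order := PowerSeries.nat_le_order _ _ h
  rw [PowerSeries.order_mul] at h1
  have h2 : y.order < c := by
    by_contra! h2
    exact hy fun m hm => PowerSeries.coeff_of_lt_order m (lt_of_lt_of_le (by exact_mod_cast hm) h2)
  intro m hm
  apply PowerSeries.coeff_of_lt_order
  by_contra! h3
  have h4 : (a : ℕ∞) ≤ m + c := h1.trans (add_le_add h3 h2.le)
  have : a ≤ m + c := by exact_mod_cast h4
  omega

theorem app_add_right {ι : Type*} [Fintype ι] (c : F) (P : ι → F[X]) (y z : ι → PowerSeries F) :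
    app c P (y + z) = app c P y + app c P z := by
  simp [app, mul_add, Finset.sum_add_distrib]

theorem app_smul_right {ι : Type*} [Fintype ι] (c : F) (P : ι → F[X]) (a : F)
    (y : ι → PowerSeries F) : app c P (a • y) = a • app c P y := by
  simp [app, Finset.smul_sum]

/-- `app` as a linear map in the solution. -/
def appHom {ι : Type*} [Fintype ι] (c : F) (P : ι → F[X]) :
    (ι → PowerSeries F) →ₗ[F] PowerSeries F where
  toFun := app c P
  map_add' := app_add_right c P
  map_smul' := app_smul_right c P

theorem IsSol.add {ι : Type*} [Fintype ι] {c : F} {t : F[X]} {A : ι → ι → F[X]}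
    {y z : ι → PowerSeries F} (hy : IsSol c t A y) (hz : IsSol c t A z) : IsSol c t A (y + z) := by
  intro i
  simp only [Pi.add_apply, map_add, mul_add, Finset.sum_add_distrib]
  rw [hy i, hz i]

theorem IsSol.smul {ι : Type*} [Fintype ι] {c : F} {t : F[X]} {A : ι → ι → F[X]}
    {y : ι → PowerSeries F} (hy : IsSol c t A y) (a : F) : IsSol c t A (a • y) := by
  intro i
  simp only [Pi.smul_apply, (PowerSeries.derivative F).map_smul, mul_smul_comm,
    ← Finset.smul_sum]
  rw [hy i]

theorem IsSol.zero {ι : Type*} [Fintype ι] {c : F} {t : F[X]} {A : ι → ι → F[X]} :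
    IsSol c t A (0 : ι → PowerSeries F) := by
  intro i
  simp

/-- The space of solutions of a system. -/
def solSpace {ι : Type*} [Fintype ι] (c : F) (t : F[X]) (A : ι → ι → F[X]) :
    Submodule F (ι → PowerSeries F) where
  carrier := {y | IsSol c t A y}
  add_mem' := IsSol.add
  zero_mem' := IsSol.zero
  smul_mem' a _ h := h.smul a

variable [CharZero F]

theorem IsSol.linearIndependent {κ ι : Type*} [Fintype ι] {c : F} {t : F[X]} (ht : t ≠ 0)
    {A : ι → ι → F[X]} {Y : κ → ι → PowerSeries F} (hY : ∀ j, IsSol c t A (Y j))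
    (h : LinearIndependent F Y) : LinearIndependent (PowerSeries F) Y :=
  linearIndependent_of_isSol (sh_ne_zero c ht) hY h

theorem IsSol.card_le {κ ι : Type*} [Fintype κ] [Fintype ι] {c : F} {t : F[X]} (ht : t ≠ 0)
    {A : ι → ι → F[X]} {Y : κ → ι → PowerSeries F} (hY : ∀ j, IsSol c t A (Y j))
    (h : LinearIndependent F Y) : Fintype.card κ ≤ Fintype.card ι := by
  have h1 := IsSol.linearIndependent ht hY h
  have := card_add_card_le_of_orthogonal (b := fun x : Empty => x.elim) h1
    (linearIndependent_empty_type) (fun _ y => y.elim)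
  simpa using this

theorem finrank_le_of_forall_isSol {ι : Type*} [Fintype ι] {c : F} {t : F[X]} (ht : t ≠ 0)
    {A : ι → ι → F[X]} (W : Submodule F (ι → PowerSeries F)) [FiniteDimensional F W]
    (hW : ∀ y ∈ W, IsSol c t A y) : Module.finrank F W ≤ Fintype.card ι := by
  let b := Module.finBasis F W
  have := IsSol.card_le ht (Y := fun j => (b j : ι → PowerSeries F)) (fun j => hW _ (b j).2)
    (b.linearIndependent.map' W.subtype (Submodule.ker_subtype W))
  simpa using this

variable {ι : Type*} [Fintype ι]

theorem exists_order_bound_of_degree_le {u : ι → PowerSeries F}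
    (hli : ∀ P : ι → F[X], app 0 P u = 0 → P = 0) (d : ℕ) :
    ∃ c, ∀ b : ι → F[X], b ≠ 0 → (∀ i, (b i).natDegree ≤ d) → ¬ PowerSeries.X ^ c ∣ app 0 b u := by
  have : FiniteDimensional F (Polynomial.degreeLT F (d + 1)) :=
    Module.Finite.equiv (Polynomial.degreeLTEquiv F (d + 1)).symm
  let φ : (ι → Polynomial.degreeLT F (d + 1)) →ₗ[F] PowerSeries F :=
    { toFun := fun b => app 0 (fun i => (b i : F[X])) u
      map_add' := fun x y => by simp [app, add_mul, Finset.sum_add_distrib]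
      map_smul' := fun a x => by
        simp only [app, Pi.smul_apply, Submodule.coe_smul, Polynomial.smul_eq_C_mul, map_mul, sh_C,
          mul_assoc, ← Finset.mul_sum, RingHom.id_apply, PowerSeries.smul_eq_C_mul] }
  obtain ⟨c, hc⟩ := exists_order_bound (LinearMap.pi fun _ : Unit => φ) (by
    rw [← LinearMap.ker_eq_bot, LinearMap.ker_eq_bot']
    intro v hv
    have := hli _ (congrFun hv ())
    funext i
    exact Subtype.ext (congrFun this i))
  refine ⟨c, fun b hb hd hX => hb ?_⟩
  have hm : ∀ i, b i ∈ Polynomial.degreeLT F (d + 1) := fun i => by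
    rw [Polynomial.mem_degreeLT]
    exact (Polynomial.natDegree_le_iff_degree_le.mp (hd i)).trans_lt (by exact_mod_cast Nat.lt_succ_self d)
  have := hc (fun i => ⟨b i, hm i⟩) (fun _ => hX)
  funext i
  exact congrArg Subtype.val (congrFun this i)

/-- If a subspace of the span of finitely many vectors of power series is annihilated by a nonzero
linear form with polynomial coefficients, it is annihilated by one of uniformly bounded degree. -/
theorem exists_uniform_annihilator (c : F) {σ : Type*} [Fintype σ] (Φ : σ → ι → PowerSeries F) :
    ∃ d : ℕ, ∀ W : Set (σ → F), (∃ b : ι → F[X], b ≠ 0 ∧ ∀ a ∈ W, app c b (∑ h, a h • Φ h) = 0) →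
      ∃ b : ι → F[X], b ≠ 0 ∧ (∀ i, (b i).natDegree ≤ d) ∧
        ∀ a ∈ W, app c b (∑ h, a h • Φ h) = 0 := by
  classical
  obtain ⟨s, g, p, hg, hs, hp⟩ := exists_relation_basis (sh c) (fun x : σ × ι => Φ x.1 x.2)
  let d0 := Finset.univ.sup fun x : (σ × ι) × (σ × ι) => (p x.1 x.2).natDegree
  have hd0 : ∀ x y, (p x y).natDegree ≤ d0 := fun x y =>
    Finset.le_sup (f := fun x : (σ × ι) × (σ × ι) => (p x.1 x.2).natDegree) (Finset.mem_univ (x, y))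
  refine ⟨Fintype.card ι * d0, fun W ⟨b, hb, hbW⟩ => ?_⟩
  let v : W × s → ι → F[X] := fun x i => ∑ h, Polynomial.C (x.1.1 h) * p (h, i) x.2.1
  have key : ∀ (b : ι → F[X]) (a : σ → F), sh c g * app c b (∑ h, a h • Φ h) =
      ∑ j ∈ s, sh c (∑ i, (∑ h, Polynomial.C (a h) * p (h, i) j) * b i) * Φ j.1 j.2 := by
    intro b a
    simp only [app, Finset.sum_apply, Pi.smul_apply, Finset.mul_sum, PowerSeries.smul_eq_C_mul]
    have : ∀ i h, sh c g * (sh c (b i) * (PowerSeries.C (a h) * Φ h i)) =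
        ∑ j ∈ s, sh c (b i) * PowerSeries.C (a h) * sh c (p (h, i) j) * Φ j.1 j.2 := by
      intro i h
      have h1 : sh c g * Φ h i = ∑ j ∈ s, sh c (p (h, i) j) * Φ j.1 j.2 := hp (h, i)
      calc _ = sh c (b i) * PowerSeries.C (a h) * (sh c g * Φ h i) := by ring
        _ = _ := by
          rw [h1, Finset.mul_sum]
          exact Finset.sum_congr rfl fun j _ => by ring
    simp only [this, map_sum, map_mul, sh_C, Finset.sum_mul]
    simp only [Finset.sum_comm (s := Finset.univ) (t := s)]
    refine Finset.sum_congr rfl fun j _ => Finset.sum_congr rfl fun i _ =>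
      Finset.sum_congr rfl fun h _ => by ring
  have hiff : ∀ b : ι → F[X], (∀ a ∈ W, app c b (∑ h, a h • Φ h) = 0) ↔
      ∀ x : W × s, ∑ i, v x i * b i = 0 := by
    intro b
    constructor
    · rintro h ⟨⟨a, ha⟩, ⟨j, hj⟩⟩
      have h1 := key b a
      rw [h a ha, mul_zero] at h1
      exact hs _ h1.symm j hj
    · intro h a ha
      have h1 := key b a
      refine (mul_eq_zero.mp (h1.trans (Finset.sum_eq_zero fun j hj => ?_))).resolve_left
        (sh_ne_zero c hg)
      have := h (⟨a, ha⟩, ⟨j, hj⟩)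
      simp only [v] at this
      rw [this, map_zero, zero_mul]
  obtain ⟨w, hw, hwd, hwv⟩ := exists_small_kernel_vector v d0 (fun x i => by
    refine Polynomial.natDegree_sum_le_of_forall_le _ _ fun h _ => ?_
    exact (Polynomial.natDegree_C_mul_le _ _).trans (hd0 _ _)) b hb ((hiff b).mp hbW)
  exact ⟨w, hw, hwd, (hiff w).mpr hwv⟩

end Shidlovskii

section Shidlovskii

variable {F : Type*} [Field F] [CharZero F] {ι : Type*} [Fintype ι]

/-- If `w` is dependent on the linearly independent family `v`, then `Δ w` is a polynomial
combination of `v`, for any nonzero maximal minor `Δ` of `v`. -/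
theorem exists_det_smul_eq {R κ n : Type*} [CommRing R] [IsDomain R] [Fintype κ] [DecidableEq κ]
    {v : κ → n → R} (e : κ → n) {w : n → R} {q : R} {p : κ → R}
    (h : q • w = ∑ j, p j • v j) (hq : q ≠ 0) :
    ∃ γ : κ → R, (Matrix.of fun i j => v i (e j)).det • w = ∑ j, γ j • v j := by
  set V : Matrix κ κ R := Matrix.of fun i j => v i (e j) with hV
  refine ⟨Matrix.vecMul (fun j => w (e j)) V.adjugate, ?_⟩
  have h1 : (q • fun j => w (e j)) = Matrix.vecMul p V := by
    funext j
    have := congrFun h (e j)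
    simpa [Matrix.vecMul, dotProduct, hV] using this
  have h2 : q • Matrix.vecMul (fun j => w (e j)) V.adjugate = V.det • p := by
    rw [← Matrix.smul_vecMul, h1, Matrix.vecMul_vecMul, Matrix.mul_adjugate, Matrix.vecMul_smul,
      Matrix.vecMul_one]
  apply smul_right_injective (n → R) hq
  simp only
  rw [smul_comm, h, Finset.smul_sum, Finset.smul_sum]
  refine Finset.sum_congr rfl fun j _ => ?_
  rw [smul_smul, smul_smul]
  congr 1
  exact (congrFun h2 j).symm

theorem exists_relation_of_not_linearIndependent {R M : Type*} [CommRing R] [AddCommGroup M]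
    [Module R M] {k : ℕ} {v : Fin (k + 1) → M} (h : LinearIndependent R fun j : Fin k => v j.castSucc)
    (h' : ¬ LinearIndependent R v) :
    ∃ (q : R) (p : Fin k → R), q ≠ 0 ∧ q • v (Fin.last k) = ∑ j, p j • v j.castSucc := by
  rw [Fintype.not_linearIndependent_iff] at h'
  obtain ⟨g, hg, i, hi⟩ := h'
  rw [Fin.sum_univ_castSucc] at hg
  refine ⟨g (Fin.last k), fun j => - g j.castSucc, fun h0 => hi ?_, ?_⟩
  · rw [h0, zero_smul, add_zero] at hg
    have := Fintype.linearIndependent_iff.mp h _ hg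
    refine Fin.lastCases h0 this i
  · simp only [neg_smul, Finset.sum_neg_distrib]
    exact eq_neg_of_add_eq_zero_right hg

/-- The values of the iterates of a linear form at the solutions satisfy the companion system. -/
theorem exists_companion {c : F} {t : F[X]} {A : ι → ι → F[X]} {P : ι → F[X]} {κ : ℕ} {q : F[X]}
    {p : Fin κ → F[X]} (hrel : q • (opD t A)^[κ] P = ∑ j : Fin κ, p j • (opD t A)^[j] P) :
    ∃ B : Fin κ → Fin κ → F[X], ∀ y, IsSol c t A y →
      IsSol c (q * t) B (fun j => app c ((opD t A)^[j] P) y) := by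
  refine ⟨fun i k => if (i : ℕ) + 1 = κ then p k else if (k : ℕ) = i + 1 then q else 0, ?_⟩
  intro y hy i
  rw [map_mul, mul_assoc, ← app_opD hy, ← Function.iterate_succ_apply' (opD t A)]
  have h0 : ∀ (r : F[X]) (Q : ι → F[X]), sh c r * app c Q y = app c (r • Q) y := by
    intro r Q
    simp [app, Finset.mul_sum, mul_assoc]
  by_cases hi : (i : ℕ) + 1 = κ
  · simp only [if_pos hi]
    rw [show (i : ℕ).succ = κ from hi, h0, hrel]
    simp only [h0]
    simp only [app, Finset.sum_apply, map_sum, Finset.sum_mul]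
    exact Finset.sum_comm
  · have hlt : (i : ℕ) + 1 < κ := lt_of_le_of_ne i.2 hi
    simp only [if_neg hi]
    rw [Finset.sum_eq_single ⟨i + 1, hlt⟩]
    · simp
    · intro b _ hb
      rw [if_neg, map_zero, zero_mul]
      intro h
      exact hb (Fin.ext h)
    · simp

/-- A nonzero linear form of degree at most `N` in a linearly independent solution of a system,
vanishing at the origin to high order, has linearly independent iterated derivatives. -/
theorem shidlovskii {t : F[X]} (ht : t ≠ 0) {A : ι → ι → F[X]} {u : ι → PowerSeries F}
    (hu : IsSol 0 t A u) (hli : ∀ P : ι → F[X], app 0 P u = 0 → P = 0) :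
    ∃ c : ℕ, ∀ (N : ℕ) (P : ι → F[X]), P ≠ 0 → (∀ i, (P i).natDegree ≤ N) →
      PowerSeries.X ^ ((Fintype.card ι - 1) * N + c) ∣ app 0 P u →
      LinearIndependent F[X] (fun j : Fin (Fintype.card ι) => (opD t A)^[j] P) := by
  classical
  obtain ⟨z0, hz0⟩ : ∃ z0 : F, t.eval z0 ≠ 0 := by
    by_contra! h
    exact ht (Polynomial.funext fun x => by rw [h, Polynomial.eval_zero])
  obtain ⟨Φ, hΦ, hΦ0⟩ := exists_fundamental z0 t A hz0
  obtain ⟨c1, hc1⟩ := exists_uniform_annihilator z0 Φ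
  obtain ⟨c2, hc2⟩ := exists_order_bound_of_degree_le hli c1
  obtain ⟨g, hgt, hgA⟩ : ∃ g : ℕ, t.natDegree ≤ g ∧ ∀ i k, (A i k).natDegree ≤ g := by
    refine ⟨t.natDegree + Finset.univ.sup fun x : ι × ι => (A x.1 x.2).natDegree, by omega, ?_⟩
    intro i k
    have := Finset.le_sup (f := fun x : ι × ι => (A x.1 x.2).natDegree) (Finset.mem_univ (i, k))
    simp only at this
    omega
  set n := Fintype.card ι with hn
  refine ⟨n * n * g + n + c2 + 1, fun N P hP hPN hX => ?_⟩
  by_contra hnot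
  let LI : ℕ → Prop := fun k => LinearIndependent F[X] (fun j : Fin k => (opD t A)^[j] P)
  have hex : ∃ k, ¬ LI k := ⟨n, hnot⟩
  have hle : Nat.find hex ≤ n := Nat.find_min' hex hnot
  obtain ⟨κ, hκ⟩ : ∃ κ, Nat.find hex = κ + 1 := by
    refine Nat.exists_eq_succ_of_ne_zero fun h0 => ?_
    have := Nat.find_spec hex
    rw [h0] at this
    exact this linearIndependent_empty_type
  have hLIκ : LI κ := not_not.mp (Nat.find_min hex (by omega))
  have hnLI : ¬ LI (κ + 1) := hκ ▸ Nat.find_spec hex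
  have hκ1 : 1 ≤ κ := by
    rw [Nat.one_le_iff_ne_zero]
    rintro rfl
    apply hnLI
    change LinearIndependent F[X] (fun j : Fin 1 => (opD t A)^[j] P)
    rw [linearIndependent_unique_iff]
    simpa using hP
  obtain ⟨q, p, hq, hrel⟩ := exists_relation_of_not_linearIndependent
    (v := fun j : Fin (κ + 1) => (opD t A)^[j] P) (by simpa using hLIκ) hnLI
  simp only [Fin.val_last, Fin.val_castSucc] at hrel
  obtain ⟨B, hB⟩ := exists_companion (c := z0) hrel
  -- the solutions `∑ a h • Φ h`
  let sol : (ι → F) →ₗ[F] (ι → PowerSeries F) := Fintype.linearCombination F Φ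
  have hsol : ∀ a, sol a = ∑ h, a h • Φ h := fun a => Fintype.linearCombination_apply F Φ a
  have hsolS : ∀ a, IsSol z0 t A (sol a) := by
    intro a
    rw [hsol]
    exact (solSpace z0 t A).sum_mem fun h _ => (solSpace z0 t A).smul_mem _ (hΦ h)
  have hsol0 : ∀ a i, PowerSeries.constantCoeff (sol a i) = a i := by
    intro a i
    rw [hsol, Finset.sum_apply, map_sum]
    simp [hΦ0]
  let L : (ι → F) →ₗ[F] (Fin κ → PowerSeries F) :=
    LinearMap.pi fun j => appHom z0 ((opD t A)^[j] P) ∘ₗ sol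
  have hL : ∀ a j, L a j = app z0 ((opD t A)^[j] P) (sol a) := fun a j => rfl
  have hrank : Module.finrank F (LinearMap.range L) ≤ κ := by
    have := finrank_le_of_forall_isSol (c := z0) (mul_ne_zero hq ht) (A := B) (LinearMap.range L) (by
      rintro _ ⟨a, rfl⟩
      exact hB _ (hsolS a))
    simpa using this
  have hker : n ≤ κ + Module.finrank F (LinearMap.ker L) := by
    have := LinearMap.finrank_range_add_finrank_ker L
    rw [Module.finrank_fintype_fun_eq_card] at this
    omega
  obtain ⟨w, hw, hwd, hwann⟩ := hc1 (LinearMap.ker L : Set (ι → F)) ⟨P, hP, fun a ha => by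
    have h1 : L a = 0 := ha
    have h2 := congrFun h1 ⟨0, hκ1⟩
    rw [hL] at h2
    rw [← hsol]
    exact h2⟩
  have hrel2 : ∃ (r : F[X]) (s : Fin κ → F[X]), r ≠ 0 ∧
      r • w = ∑ j : Fin κ, s j • (opD t A)^[j] P := by
    let v : Fin (κ + 1) → ι → F[X] := Fin.snoc (fun j : Fin κ => (opD t A)^[j] P) w
    have hv1 : ∀ j : Fin κ, v j.castSucc = (opD t A)^[j] P := fun j => by simp [v]
    have hv2 : v (Fin.last κ) = w := by simp [v]
    have hnv : ¬ LinearIndependent F[X] v := by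
      intro hv
      let b := Module.finBasis F (LinearMap.ker L)
      have h1 : LinearIndependent F (fun x => sol (b x)) := by
        have : LinearIndependent F (fun x => (b x : ι → F)) :=
          b.linearIndependent.map' (LinearMap.ker L).subtype (Submodule.ker_subtype _)
        refine this.map' sol ?_
        rw [LinearMap.ker_eq_bot']
        intro a ha
        funext i
        rw [← hsol0 a i, ha]
        simp
      have h2 := IsSol.linearIndependent ht (fun x => hsolS (b x)) h1
      have h3 := linearIndependent_map_of_injective (sh_injective z0) hv
      have := card_add_card_le_of_orthogonal h3 h2 (fun x y => by
        change app z0 (v x) (sol (b y)) = 0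
        have hy : ((b y : ι → F)) ∈ LinearMap.ker L := (b y).2
        refine Fin.lastCases ?_ (fun j => ?_) x
        · rw [hv2, hsol]; exact hwann _ hy
        · rw [hv1]
          have h1 : L (b y) = 0 := hy
          exact congrFun h1 j)
      simp only [Fintype.card_fin] at this
      omega
    obtain ⟨r, s, hr, h⟩ := exists_relation_of_not_linearIndependent
      (by simpa only [hv1] using hLIκ) hnv
    exact ⟨r, s, hr, by simpa only [hv1, hv2] using h⟩
  obtain ⟨r, s, hr, hrel2⟩ := hrel2
  obtain ⟨e, he⟩ := exists_minor_ne_zero hLIκ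
  obtain ⟨γ, hγ⟩ := exists_det_smul_eq e hrel2 hr
  set Δ := (Matrix.of fun (i : Fin κ) (j : Fin κ) => (opD t A)^[i] P (e j)).det with hΔ
  have hΔdeg : Δ.natDegree ≤ κ * (N + κ * g) := by
    have := natDegree_det_le_of_forall_le
      (Matrix.of fun (i : Fin κ) (j : Fin κ) => (opD t A)^[i] P (e j)) (N + κ * g) (fun i j =>
        (natDegree_opD_iterate_le hgt hgA hPN i (e j)).trans (by
          have := Nat.mul_le_mul_right g i.2.le
          omega))
    simpa using this
  set M := (n - 1) * N + (n * n * g + n + c2 + 1) with hM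
  have hdvd : PowerSeries.X ^ (M - κ) ∣ sh 0 Δ * app 0 w u := by
    have h1 : sh 0 Δ * app 0 w u = app 0 (Δ • w) u := by
      simp [app, Finset.mul_sum, mul_assoc]
    have h2 : app 0 (∑ j, γ j • (opD t A)^[(j : Fin κ)] P) u =
        ∑ j, sh 0 (γ j) * app 0 ((opD t A)^[(j : Fin κ)] P) u := by
      simp only [app, Finset.sum_apply, map_sum, Finset.sum_mul, Finset.mul_sum, Pi.smul_apply,
        smul_eq_mul, map_mul, mul_assoc]
      exact Finset.sum_comm
    rw [h1, hγ, h2]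
    refine Finset.dvd_sum fun j _ => Dvd.dvd.mul_left ?_ _
    exact (pow_dvd_pow _ (by omega)).trans (X_pow_dvd_app_opD_iterate hu hX j)
  have h5 := X_pow_sub_dvd_of_mul hdvd (hc2 w hw hwd)
  rw [X_pow_dvd_sh_iff] at h5
  have h6 := Polynomial.natDegree_le_of_dvd h5 he
  rw [Polynomial.natDegree_pow, Polynomial.natDegree_X_sub_C, mul_one] at h6
  have h7 : κ * (N + κ * g) ≤ (n - 1) * N + n * n * g := by
    rw [mul_add, ← mul_assoc]
    exact add_le_add (Nat.mul_le_mul_right _ (by omega))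
      (Nat.mul_le_mul_right _ (Nat.mul_le_mul (by omega) (by omega)))
  omega

/-- A linear form with linearly independent iterated derivatives that vanishes to high order at the
origin cannot vanish to high order along a local solution at another point. -/
theorem order_le_of_linearIndependent {t : F[X]} {A : ι → ι → F[X]}
    {u : ι → PowerSeries F} (hu : IsSol 0 t A u) {i0 : ι} (hi0 : u i0 ≠ 0) :
    ∃ c : ℕ, ∀ y : ι → PowerSeries F, IsSol 1 t A y → ∀ c', ¬ PowerSeries.X ^ c' ∣ y i0 →
      ∀ (N M : ℕ) (P : ι → F[X]), (∀ i, (P i).natDegree ≤ N) →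
      PowerSeries.X ^ M ∣ app 0 P u →
      LinearIndependent F[X] (fun j : Fin (Fintype.card ι) => (opD t A)^[j] P) →
      ∀ k, PowerSeries.X ^ k ∣ app 1 P y → k + M ≤ Fintype.card ι * N + c + c' := by
  classical
  obtain ⟨g, hgt, hgA⟩ : ∃ g : ℕ, t.natDegree ≤ g ∧ ∀ i k, (A i k).natDegree ≤ g := by
    refine ⟨t.natDegree + Finset.univ.sup fun x : ι × ι => (A x.1 x.2).natDegree, by omega, ?_⟩
    intro i k
    have := Finset.le_sup (f := fun x : ι × ι => (A x.1 x.2).natDegree) (Finset.mem_univ (i, k))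
    simp only at this
    omega
  obtain ⟨c0, hc0⟩ : ∃ c0, ¬ PowerSeries.X ^ c0 ∣ u i0 := by
    refine ⟨(u i0).order.toNat + 1, fun h => ?_⟩
    rw [PowerSeries.X_pow_dvd_iff] at h
    exact PowerSeries.coeff_order hi0 (h _ (Nat.lt_succ_self _))
  set n := Fintype.card ι with hn
  refine ⟨n * (n * g) + 2 * n + c0, fun y hy c' hc' N M P hPN hX hLI k hk => ?_⟩
  let eq : ι ≃ Fin n := Fintype.equivFin ι
  let V : Matrix ι ι F[X] := Matrix.of fun i => (opD t A)^[eq i] P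
  have hdet : V.det ≠ 0 := det_ne_zero_of_linearIndependent (hLI.comp eq eq.injective)
  have hVdeg : V.det.natDegree ≤ n * (N + n * g) :=
    natDegree_det_le_of_forall_le V _ fun i j =>
      (natDegree_opD_iterate_le hgt hgA hPN (eq i) j).trans (by
        have := Nat.mul_le_mul_right g (eq i).2.le
        omega)
  have key : ∀ (c : F) (x : ι → PowerSeries F) (m l : ℕ), IsSol c t A x →
      PowerSeries.X ^ m ∣ app c P x → ¬ PowerSeries.X ^ l ∣ x i0 →
      (Polynomial.X - Polynomial.C c) ^ (m - n - l) ∣ V.det := by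
    intro c x m l hx hm hl
    rw [← X_pow_dvd_sh_iff]
    refine X_pow_sub_dvd_of_mul (y := x i0) ?_ hl
    have h1 : sh c V.det * x i0 = ∑ j, sh c (V.adjugate i0 j) * app c (V j) x := by
      have h2 : V.adjugate * V = V.det • (1 : Matrix ι ι F[X]) := Matrix.adjugate_mul V
      have h3 : ∀ i, ∑ j, V.adjugate i0 j * V j i = if i0 = i then V.det else 0 := by
        intro i
        have := congrFun (congrFun h2 i0) i
        rw [Matrix.mul_apply] at this
        rw [this, Matrix.smul_apply, Matrix.one_apply]
        simp
      simp only [app, Finset.mul_sum]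
      rw [Finset.sum_comm]
      have : ∀ i, ∑ j, sh c (V.adjugate i0 j) * (sh c (V j i) * x i) =
          (if i0 = i then sh c V.det else 0) * x i := by
        intro i
        rw [← map_zero (sh c), ← apply_ite (sh c), ← h3, map_sum, Finset.sum_mul]
        exact Finset.sum_congr rfl fun j _ => by rw [map_mul]; ring
      simp [this]
    rw [h1]
    refine Finset.dvd_sum fun j _ => Dvd.dvd.mul_left ?_ _
    exact (pow_dvd_pow _ (by have := (eq j).2; omega)).trans (X_pow_dvd_app_opD_iterate hx hm (eq j))
  have h0 := key 0 u M c0 hu hX hc0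
  have h1 := key 1 y k c' hy hk hc'
  have hcop : IsCoprime ((Polynomial.X - Polynomial.C (0 : F)) ^ (M - n - c0))
      ((Polynomial.X - Polynomial.C (1 : F)) ^ (k - n - c')) :=
    (Polynomial.isCoprime_X_sub_C_of_isUnit_sub (by simp)).pow
  have h2 := Polynomial.natDegree_le_of_dvd (hcop.mul_dvd h0 h1) hdet
  rw [Polynomial.natDegree_mul (pow_ne_zero _ (Polynomial.X_sub_C_ne_zero _))
    (pow_ne_zero _ (Polynomial.X_sub_C_ne_zero _)), Polynomial.natDegree_pow,
    Polynomial.natDegree_pow, Polynomial.natDegree_X_sub_C, Polynomial.natDegree_X_sub_C] at h2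
  rw [mul_add] at hVdeg
  omega

end Shidlovskii

section Tay

/-- The Taylor series of `G` at `c`. -/
def tay (c : ℂ) (G : ℂ → ℂ) : PowerSeries ℂ := PowerSeries.mk fun n => iteratedDeriv n G c / n.factorial

theorem coeff_tay (c : ℂ) (G : ℂ → ℂ) (n : ℕ) :
    PowerSeries.coeff n (tay c G) = iteratedDeriv n G c / n.factorial := PowerSeries.coeff_mk _ _

theorem constantCoeff_tay (c : ℂ) (G : ℂ → ℂ) : PowerSeries.constantCoeff (tay c G) = G c := by
  rw [← PowerSeries.coeff_zero_eq_constantCoeff_apply, coeff_tay]; simp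

theorem derivative_tay (c : ℂ) (G : ℂ → ℂ) :
    PowerSeries.derivative ℂ (tay c G) = tay c (deriv G) := by
  ext n
  rw [PowerSeries.coeff_derivative, coeff_tay, coeff_tay, iteratedDeriv_succ', Nat.factorial_succ]
  have : (n.factorial : ℂ) ≠ 0 := by exact_mod_cast n.factorial_ne_zero
  have : (n : ℂ) + 1 ≠ 0 := by exact_mod_cast n.succ_ne_zero
  push_cast
  field_simp

variable {G H : ℂ → ℂ}

theorem tay_add (hG : Differentiable ℂ G) (hH : Differentiable ℂ H) (c : ℂ) :
    tay c (G + H) = tay c G + tay c H := by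
  ext n
  rw [map_add, coeff_tay, coeff_tay, coeff_tay,
    iteratedDeriv_add hG.contDiff.contDiffAt hH.contDiff.contDiffAt, add_div]

theorem tay_mul (hG : Differentiable ℂ G) (hH : Differentiable ℂ H) (c : ℂ) :
    tay c (G * H) = tay c G * tay c H := by
  ext n
  rw [PowerSeries.coeff_mul, coeff_tay,
    iteratedDeriv_mul hG.contDiff.contDiffAt hH.contDiff.contDiffAt, Finset.sum_div,
    Finset.Nat.sum_antidiagonal_eq_sum_range_succ_mk]
  refine Finset.sum_congr rfl fun i hi => ?_
  have hi' : i ≤ n := Nat.lt_succ_iff.mp (Finset.mem_range.mp hi)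
  rw [coeff_tay, coeff_tay, Nat.cast_choose ℂ hi']
  have h1 : (n.factorial : ℂ) ≠ 0 := by exact_mod_cast n.factorial_ne_zero
  field_simp

theorem tay_const (c a : ℂ) : tay c (fun _ => a) = PowerSeries.C a := by
  ext n
  rw [coeff_tay, PowerSeries.coeff_C, iteratedDeriv_const]
  split_ifs with h <;> simp [h]

theorem tay_sum {ι : Type*} (s : Finset ι) {G : ι → ℂ → ℂ} (hG : ∀ i, Differentiable ℂ (G i))
    (c : ℂ) : tay c (∑ i ∈ s, G i) = ∑ i ∈ s, tay c (G i) := by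
  classical
  induction s using Finset.induction_on with
  | empty => rw [Finset.sum_empty, Finset.sum_empty]; exact (tay_const c 0).trans (map_zero _)
  | insert a s ha ih =>
    rw [Finset.sum_insert ha, Finset.sum_insert ha, tay_add (hG a) _ c, ih]
    rw [show ∑ i ∈ s, G i = fun z => ∑ i ∈ s, G i z by ext z; simp]
    exact Differentiable.fun_sum fun i _ => hG i

theorem tay_id (c : ℂ) : tay c (fun z => z) = sh c Polynomial.X := by
  ext n
  rw [sh_X, coeff_tay]
  rcases n with _ | _ | n
  · simp
  · simp [iteratedDeriv_one]
  · rw [iteratedDeriv_succ', iteratedDeriv_succ']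
    simp [PowerSeries.coeff_X]

theorem tay_eval (c : ℂ) (p : ℂ[X]) : tay c (fun z => p.eval z) = sh c p := by
  induction p using Polynomial.induction_on' with
  | add p q hp hq =>
    rw [map_add, ← hp, ← hq, ← tay_add p.differentiable q.differentiable]
    congr 1; ext z; simp
  | monomial n a =>
    rw [← Polynomial.C_mul_X_pow_eq_monomial]
    induction n with
    | zero => simpa [sh_C] using tay_const c a
    | succ n ih =>
      rw [pow_succ, ← mul_assoc, map_mul, ← ih, ← tay_id,
        ← tay_mul (Polynomial.differentiable _) differentiable_fun_id]
      congr 1; ext z; simp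

theorem eq_of_tay_eq (hG : Differentiable ℂ G) (hH : Differentiable ℂ H) {c : ℂ}
    (h : tay c G = tay c H) : G = H := by
  ext z
  refine (Complex.hasSum_taylorSeries_of_entire hG c z).unique ?_
  convert Complex.hasSum_taylorSeries_of_entire hH c z using 4 with n
  have := congrArg (PowerSeries.coeff n) h
  rw [coeff_tay, coeff_tay, div_left_inj' (by exact_mod_cast n.factorial_ne_zero)] at this
  exact this

theorem hasSum_tay (hG : Differentiable ℂ G) (c z : ℂ) :
    HasSum (fun n => PowerSeries.coeff n (tay c G) * (z - c) ^ n) (G z) := by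
  refine (Complex.hasSum_taylorSeries_of_entire hG c z).congr_fun fun n => ?_
  rw [coeff_tay, smul_eq_mul, smul_eq_mul]; ring

/-- An everywhere convergent power series defines an entire function with these Taylor
coefficients. -/
theorem differentiable_and_tay_of_hasSum {c : ℕ → ℂ} (h : ∀ z, HasSum (fun n => c n * z ^ n) (G z)) :
    Differentiable ℂ G ∧ tay 0 G = PowerSeries.mk c := by
  have hf : HasFPowerSeriesOnBall G (FormalMultilinearSeries.ofScalars ℂ c) 0 ⊤ := by
    refine ⟨?_, by simp, fun {y} _ => ?_⟩
    · refine le_of_eq (Eq.symm ?_)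
      refine FormalMultilinearSeries.radius_eq_top_of_forall_nnreal_isBigO _ fun r => ?_
      have := (h (r : ℂ)).summable.tendsto_atTop_zero.isBigO_one ℝ
      refine this.norm_left.congr_left fun n => ?_
      rw [FormalMultilinearSeries.ofScalars_norm, norm_mul, norm_pow, Complex.norm_real,
        NNReal.norm_eq]
    · have := h y
      rw [zero_add]
      refine this.congr_fun fun n => ?_
      rw [FormalMultilinearSeries.ofScalars_apply_eq, smul_eq_mul]
  have hd : Differentiable ℂ G := by
    intro z
    exact (hf.analyticAt_of_mem (by simp)).differentiableAt
  refine ⟨hd, ?_⟩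
  have h2 := hf.analyticAt.hasFPowerSeriesAt
  have h3 := h2.eq_formalMultilinearSeries hf.hasFPowerSeriesAt
  ext n
  have := congrArg (fun p : FormalMultilinearSeries ℂ ℂ ℂ => p.coeff n) h3
  simpa [coeff_tay, FormalMultilinearSeries.coeff_ofScalars] using this

theorem differentiable_and_tay_mk_of_norm_le {c : ℕ → ℂ} {C : ℝ}
    (h : ∀ n, ‖c n‖ ≤ C ^ (n + 1) / n.factorial) :
    ∃ G : ℂ → ℂ, Differentiable ℂ G ∧ tay 0 G = PowerSeries.mk c := by
  refine ⟨fun z => ∑' n, c n * z ^ n, differentiable_and_tay_of_hasSum fun z => ?_⟩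
  refine Summable.hasSum (Summable.of_norm_bounded
    (((Real.summable_pow_div_factorial (C * ‖z‖)).mul_left C)) fun n => ?_)
  rw [norm_mul, norm_pow]
  calc ‖c n‖ * ‖z‖ ^ n ≤ (C ^ (n + 1) / n.factorial) * ‖z‖ ^ n := by gcongr; exact h n
    _ = _ := by rw [mul_pow]; ring

end Tay

section BaseChange

variable {F F' : Type*} [Field F] [Field F'] (φ : F →+* F')

theorem map_sh (c : F) (p : F[X]) : PowerSeries.map φ (sh c p) = sh (φ c) (p.map φ) := by
  rw [sh_apply, sh_apply, Polynomial.taylor_apply, Polynomial.taylor_apply, ← Polynomial.map_C,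
    ← Polynomial.map_X φ, ← Polynomial.map_add, ← Polynomial.map_comp]
  ext n
  simp

theorem map_derivative (y : PowerSeries F) :
    PowerSeries.map φ (PowerSeries.derivative F y) =
      PowerSeries.derivative F' (PowerSeries.map φ y) := by
  ext n
  simp [PowerSeries.coeff_derivative]

variable {ι : Type*} [Fintype ι]

theorem map_app (c : F) (P : ι → F[X]) (y : ι → PowerSeries F) :
    PowerSeries.map φ (app c P y) =
      app (φ c) (fun i => (P i).map φ) fun i => PowerSeries.map φ (y i) := by
  simp only [app, map_sum, map_mul, map_sh]

theorem IsSol.map {c : F} {t : F[X]} {A : ι → ι → F[X]} {y : ι → PowerSeries F}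
    (h : IsSol c t A y) :
    IsSol (φ c) (t.map φ) (fun i k => (A i k).map φ) fun i => PowerSeries.map φ (y i) := by
  intro i
  have := congrArg (PowerSeries.map φ) (h i)
  simpa only [map_sum, map_mul, map_sh, map_derivative] using this

end BaseChange

section Transfer

variable {ι : Type*} [Fintype ι] {G : ι → ℂ → ℂ}

theorem tay_sum_eval_mul (hG : ∀ i, Differentiable ℂ (G i)) (P : ι → ℂ[X]) (c : ℂ) :
    tay c (fun z => ∑ i, (P i).eval z * G i z) = app c P fun i => tay c (G i) := by
  have : (fun z => ∑ i, (P i).eval z * G i z) =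
      ∑ i, ((fun z => (P i).eval z) * G i) := by ext z; simp
  rw [this, tay_sum _ fun i => (P i).differentiable.mul (hG i)]
  refine Finset.sum_congr rfl fun i _ => ?_
  rw [tay_mul (P i).differentiable (hG i), tay_eval]

theorem differentiable_sum_eval_mul (hG : ∀ i, Differentiable ℂ (G i)) (P : ι → ℂ[X]) :
    Differentiable ℂ (fun z => ∑ i, (P i).eval z * G i z) :=
  Differentiable.fun_sum fun i _ => (P i).differentiable.mul (hG i)

theorem app_tay_eq_zero (hG : ∀ i, Differentiable ℂ (G i)) {P : ι → ℂ[X]} {c : ℂ}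
    (h : app c P (fun i => tay c (G i)) = 0) (c' : ℂ) : app c' P (fun i => tay c' (G i)) = 0 := by
  rw [← tay_sum_eval_mul hG, ← (tay_const c 0).trans (map_zero _)] at h
  rw [← tay_sum_eval_mul hG, eq_of_tay_eq (differentiable_sum_eval_mul hG P)
    (differentiable_const _) h, tay_const, map_zero]

/-- A differential system satisfied by expansions at one point is satisfied everywhere. -/
theorem isSol_tay (hG : ∀ i, Differentiable ℂ (G i)) {t : ℂ[X]} {A : ι → ι → ℂ[X]} {c : ℂ}
    (h : IsSol c t A fun i => tay c (G i)) (c' : ℂ) : IsSol c' t A fun i => tay c' (G i) := by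
  intro i
  have key : (fun z => t.eval z) * deriv (G i) = fun z => ∑ k, (A i k).eval z * G k z := by
    refine eq_of_tay_eq (c := c) (t.differentiable.mul ((hG i).deriv))
      (differentiable_sum_eval_mul hG _) ?_
    rw [tay_mul t.differentiable (hG i).deriv, tay_eval, ← derivative_tay, tay_sum_eval_mul hG]
    exact h i
  have := congrArg (tay c') key
  rwa [tay_mul t.differentiable (hG i).deriv, tay_eval, ← derivative_tay,
    tay_sum_eval_mul hG] at this

end Transfer

section House

open NumberField

variable {K : Type*} [Field K] [NumberField K]

theorem house_le_of_forall {α : K} {B : ℝ} (h : ∀ σ : K →+* ℂ, ‖σ α‖ ≤ B) : house α ≤ B := by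
  have hB : 0 ≤ B := (norm_nonneg _).trans (h (Classical.arbitrary _))
  rw [house, pi_norm_le_iff_of_nonneg hB]
  exact h

theorem house_natCast (n : ℕ) : house (n : K) = n := by
  simpa using house_intCast (K := K) (n : ℤ)

theorem house_neg (α : K) : house (-α) = house α := by
  rw [house, house, map_neg, norm_neg]

theorem exists_natCast_mul_isIntegral (α : K) : ∃ d : ℕ, d ≠ 0 ∧ IsIntegral ℤ ((d : K) * α) := by
  obtain ⟨y, hy, h⟩ := exists_integral_multiples ℤ ℚ {α}
  refine ⟨y.natAbs, by simpa using hy, ?_⟩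
  have := h α (Finset.mem_singleton_self _)
  rw [zsmul_eq_mul] at this
  rcases Int.natAbs_eq y with h1 | h1
  · rw [h1] at this; simpa using this
  · rw [h1] at this; simpa using this.neg

theorem isIntegral_natCast (n : ℕ) : IsIntegral ℤ (n : K) := by
  simpa using isIntegral_algebraMap (R := ℤ) (A := K) (x := (n : ℤ))

end House

section EType

open NumberField

variable {K : Type*} [Field K] [NumberField K]

/-- The arithmetic growth conditions in the definition of an E-function. -/
def EType (φ : PowerSeries K) : Prop := ∃ C : ℝ, ∃ d : ℕ → ℕ, 1 ≤ C ∧ ∀ n,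
  house ((n.factorial : K) * PowerSeries.coeff n φ) ≤ C ^ (n + 1) ∧ d n ≠ 0 ∧
    (d n : ℝ) ≤ C ^ (n + 1) ∧
    ∀ m ≤ n, IsIntegral ℤ ((d n : K) * ((m.factorial : K) * PowerSeries.coeff m φ))

theorem EType.mul {φ ψ : PowerSeries K} (hφ : EType φ) (hψ : EType ψ) : EType (φ * ψ) := by
  obtain ⟨C, d, hC, h⟩ := hφ
  obtain ⟨C', d', hC', h'⟩ := hψ
  have key : ∀ n, (n.factorial : K) * PowerSeries.coeff n (φ * ψ) =
      ∑ i ∈ Finset.range (n + 1), ((n.choose i : ℕ) : K) *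
        (((i.factorial : K) * PowerSeries.coeff i φ) *
          (((n - i).factorial : K) * PowerSeries.coeff (n - i) ψ)) := by
    intro n
    rw [PowerSeries.coeff_mul, Finset.Nat.sum_antidiagonal_eq_sum_range_succ_mk, Finset.mul_sum]
    refine Finset.sum_congr rfl fun i hi => ?_
    have hi' : i ≤ n := Nat.lt_succ_iff.mp (Finset.mem_range.mp hi)
    rw [← Nat.choose_mul_factorial_mul_factorial hi']
    push_cast; ring
  have hCC : 1 ≤ C * C' := one_le_mul_of_one_le_of_one_le hC hC'
  have hpow : ∀ n : ℕ, C ^ (n + 1) * C' ^ (n + 1) ≤ (2 * (C * C')) ^ (n + 1) := fun n => by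
    rw [← mul_pow]; exact pow_le_pow_left₀ (by positivity) (by linarith) _
  refine ⟨2 * (C * C'), fun n => d n * d' n, by linarith, fun n =>
    ⟨?_, mul_ne_zero (h n).2.1 (h' n).2.1, ?_, fun m hm => ?_⟩⟩
  · rw [key]
    refine (house_sum_le_sum_house _ _).trans ?_
    calc ∑ i ∈ Finset.range (n + 1), house (((n.choose i : ℕ) : K) *
        (((i.factorial : K) * PowerSeries.coeff i φ) *
          (((n - i).factorial : K) * PowerSeries.coeff (n - i) ψ)))
        ≤ ∑ i ∈ Finset.range (n + 1), (n.choose i : ℝ) * (C ^ (n + 1) * C' ^ (n + 1)) := by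
          refine Finset.sum_le_sum fun i hi => ?_
          have hi' : i ≤ n := Nat.lt_succ_iff.mp (Finset.mem_range.mp hi)
          rw [house_nat_mul]
          refine mul_le_mul_of_nonneg_left ((house_mul_le _ _).trans ?_) (by positivity)
          exact mul_le_mul ((h i).1.trans (pow_le_pow_right₀ hC (by omega)))
            ((h' (n - i)).1.trans (pow_le_pow_right₀ hC' (by omega))) (house_nonneg _)
            (by positivity)
      _ = 2 ^ n * (C ^ (n + 1) * C' ^ (n + 1)) := by
          rw [← Finset.sum_mul]; congr 1; exact_mod_cast Nat.sum_range_choose n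
      _ ≤ 2 ^ (n + 1) * (C ^ (n + 1) * C' ^ (n + 1)) := by
          gcongr
          · norm_num
          · omega
      _ = _ := by rw [mul_pow, mul_pow]
  · push_cast
    exact (mul_le_mul (h n).2.2.1 (h' n).2.2.1 (by positivity) (by positivity)).trans (hpow n)
  · rw [key, Finset.mul_sum]
    refine IsIntegral.sum _ fun i hi => ?_
    have hi' : i ≤ m := Nat.lt_succ_iff.mp (Finset.mem_range.mp hi)
    have := (isIntegral_natCast (m.choose i)).mul
      (((h n).2.2.2 i (hi'.trans hm)).mul ((h' n).2.2.2 (m - i) ((Nat.sub_le _ _).trans hm)))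
    convert this using 1
    push_cast; ring

theorem EType.derivative {φ : PowerSeries K} (hφ : EType φ) :
    EType (PowerSeries.derivative K φ) := by
  obtain ⟨C, d, hC, h⟩ := hφ
  have key : ∀ n, (n.factorial : K) * PowerSeries.coeff n (PowerSeries.derivative K φ) =
      ((n + 1).factorial : K) * PowerSeries.coeff (n + 1) φ := fun n => by
    rw [PowerSeries.coeff_derivative, Nat.factorial_succ]; push_cast; ring
  have hp : ∀ n : ℕ, C ^ (n + 1 + 1) ≤ (C ^ 2) ^ (n + 1) := fun n => by
    rw [← pow_mul]; exact pow_le_pow_right₀ hC (by omega)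
  refine ⟨C ^ 2, fun n => d (n + 1), one_le_pow₀ hC, fun n => ⟨?_, (h _).2.1,
    (h _).2.2.1.trans (hp n), fun m hm => ?_⟩⟩
  · rw [key]; exact (h _).1.trans (hp n)
  · rw [key]; exact (h _).2.2.2 _ (by omega)

theorem EType.one : EType (1 : PowerSeries K) := by
  have key : ∀ n, (n.factorial : K) * PowerSeries.coeff n (1 : PowerSeries K) =
      ((if n = 0 then 1 else 0 : ℕ) : K) := fun n => by
    rw [PowerSeries.coeff_one]; split_ifs with h <;> simp [h]
  refine ⟨1, fun _ => 1, le_rfl, fun n => ⟨?_, one_ne_zero, by simp, fun m _ => ?_⟩⟩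
  · rw [key, house_natCast]; split_ifs <;> simp
  · rw [key]; exact (isIntegral_natCast 1).mul (isIntegral_natCast _)

theorem EType.norm_le {φ : PowerSeries K} (hφ : EType φ) (σ : K →+* ℂ) :
    ∃ C : ℝ, 1 ≤ C ∧ ∀ n, ‖σ (PowerSeries.coeff n φ)‖ ≤ C ^ (n + 1) / n.factorial := by
  obtain ⟨C, d, hC, h⟩ := hφ
  refine ⟨C, hC, fun n => ?_⟩
  have h1 := (norm_embedding_le_house _ σ).trans (h n).1
  rw [map_mul, map_natCast, norm_mul, Complex.norm_natCast] at h1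
  rw [le_div_iff₀ (by exact_mod_cast n.factorial_pos), mul_comm]
  exact h1

theorem EType.exists_entire {φ : PowerSeries K} (hφ : EType φ) (σ : K →+* ℂ) :
    ∃ G : ℂ → ℂ, Differentiable ℂ G ∧ tay 0 G = PowerSeries.map σ φ := by
  obtain ⟨C, -, h⟩ := hφ.norm_le σ
  obtain ⟨G, hG, h'⟩ := differentiable_and_tay_mk_of_norm_le h
  refine ⟨G, hG, h'.trans ?_⟩
  ext n; simp

/-- The growth constants can be chosen uniformly for a finite family. -/
theorem EType.exists_uniform {ι : Type*} [Fintype ι] {u : ι → PowerSeries K}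
    (hu : ∀ i, EType (u i)) : ∃ C : ℝ, ∃ d : ℕ → ℕ, 1 ≤ C ∧ ∀ n, d n ≠ 0 ∧
      (d n : ℝ) ≤ C ^ (n + 1) ∧ ∀ i,
      house ((n.factorial : K) * PowerSeries.coeff n (u i)) ≤ C ^ (n + 1) ∧
      ∀ m ≤ n, IsIntegral ℤ ((d n : K) * ((m.factorial : K) * PowerSeries.coeff m (u i))) := by
  classical
  choose C d hC h using hu
  have hle : ∀ i, C i ≤ ∏ j, C j := fun i => by
    rw [← Finset.mul_prod_erase _ _ (Finset.mem_univ i)]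
    exact le_mul_of_one_le_right (zero_le_one.trans (hC i))
      (Finset.one_le_prod fun j _ => hC j)
  refine ⟨∏ i, C i, fun n => ∏ i, d i n, Finset.one_le_prod fun j _ => hC j, fun n =>
    ⟨Finset.prod_ne_zero_iff.mpr fun i _ => (h i n).2.1, ?_, fun i => ⟨?_, fun m hm => ?_⟩⟩⟩
  · push_cast
    rw [← Finset.prod_pow]
    exact Finset.prod_le_prod (fun _ _ => by positivity) fun i _ => (h i n).2.2.1
  · exact (h i n).1.trans (pow_le_pow_left₀ (zero_le_one.trans (hC i)) (hle i) _)
  · have hd := Finset.mul_prod_erase Finset.univ (fun j => d j n) (Finset.mem_univ i)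
    have := (isIntegral_natCast (K := K) (∏ j ∈ Finset.univ.erase i, d j n)).mul
      ((h i n).2.2.2 m hm)
    rw [← mul_assoc, ← Nat.cast_mul, mul_comm, mul_comm _ (d i n), hd, mul_comm] at this
    exact this

end EType

section ScalarODE

variable {F : Type*} [Field F] {ι : Type*} [Fintype ι]

/-- A linear form in the components of a solution of a system satisfies a scalar equation that
depends only on the system. -/
theorem exists_scalar_ode (t : F[X]) (ht : t ≠ 0) (A : ι → ι → F[X]) (P : ι → F[X]) :
    ∃ q : Fin (Fintype.card ι + 1) → F[X], q ≠ 0 ∧ ∀ c y, IsSol c t A y →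
      ∑ j, sh c (q j) * (PowerSeries.derivative F)^[j] (app c P y) = 0 := by
  let Q : ℕ → ι → F[X] := fun j => Nat.rec P (fun j Qj i =>
    opD t A Qj i - (j : F[X]) * Polynomial.derivative t * Qj i) j
  have hQ : ∀ c y, IsSol c t A y → ∀ j,
      app c (Q j) y = sh c (t ^ j) * (PowerSeries.derivative F)^[j] (app c P y) := by
    intro c y hy j
    induction j with
    | zero => simp [Q]
    | succ j ih =>
      have h1 : app c (Q (j + 1)) y = app c (opD t A (Q j)) y -
          sh c ((j : F[X]) * Polynomial.derivative t) * app c (Q j) y := by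
        simp only [app, Finset.mul_sum, ← Finset.sum_sub_distrib]
        refine Finset.sum_congr rfl fun i _ => ?_
        simp only [Q, map_sub, map_mul]; ring
      rw [h1, app_opD hy, ih, Derivation.leibniz, Function.iterate_succ_apply', derivative_sh,
        Polynomial.derivative_pow]
      rcases j with _ | j
      · simp
      · simp only [map_mul, map_pow, map_natCast, smul_eq_mul, Nat.add_sub_cancel]
        ring
  have hdep : ¬ LinearIndependent F[X] fun j : Fin (Fintype.card ι + 1) => Q j := by
    intro h
    have := h.fintype_card_le_finrank
    simp at this
  obtain ⟨g, hg, j, hj⟩ := Fintype.not_linearIndependent_iff.mp hdep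
  refine ⟨fun j => g j * t ^ (j : ℕ), fun h0 => ?_, fun c y hy => ?_⟩
  · have := congrFun h0 j
    simp only [Pi.zero_apply, mul_eq_zero] at this
    exact this.elim hj (pow_ne_zero _ ht)
  · have h1 : ∑ j, sh c (g j) * app c (Q j) y = 0 := by
      simp only [app, Finset.mul_sum]
      rw [Finset.sum_comm]
      refine Finset.sum_eq_zero fun i _ => ?_
      have := congrArg (sh c) (congrFun hg i)
      simp only [Finset.sum_apply, Pi.smul_apply, smul_eq_mul, map_sum, map_mul, Pi.zero_apply,
        map_zero] at this
      simp only [← mul_assoc, ← Finset.sum_mul, this, zero_mul]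
    rw [← h1]
    refine Finset.sum_congr rfl fun j _ => ?_
    rw [hQ c y hy, map_mul, mul_assoc]

end ScalarODE

section Recurrence

variable {K : Type*} [Field K]

theorem coeff_iterate_derivative (y : PowerSeries K) (j n : ℕ) :
    PowerSeries.coeff n ((PowerSeries.derivative K)^[j] y) =
      ((n + j).descFactorial j : K) * PowerSeries.coeff (n + j) y := by
  induction j generalizing n with
  | zero => simp
  | succ j ih =>
    rw [Function.iterate_succ_apply', PowerSeries.coeff_derivative, ih]
    rw [show n + 1 + j = n + (j + 1) by omega, Nat.descFactorial_succ,
      show n + (j + 1) - j = n + 1 by omega]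
    push_cast; ring

theorem coeff_X_pow_mul_iterate_derivative (y : PowerSeries K) (j n : ℕ) :
    PowerSeries.coeff n (PowerSeries.X ^ j * (PowerSeries.derivative K)^[j] y) =
      (n.descFactorial j : K) * PowerSeries.coeff n y := by
  rw [PowerSeries.coeff_X_pow_mul']
  split_ifs with h
  · rw [coeff_iterate_derivative, Nat.sub_add_cancel h]
  · rw [Nat.descFactorial_eq_zero_iff_lt.mpr (not_le.mp h)]; simp

variable [CharZero K]

/-- The coefficients of a power series solution of a linear differential equation with polynomial
coefficients satisfy a linear recurrence with polynomial coefficients. -/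
theorem exists_recurrence {r : ℕ} (p : Fin (r + 1) → K[X]) (hp : p ≠ 0) :
    ∃ (B : ℕ) (L : ℕ → K[X]), L 0 ≠ 0 ∧ ∀ y : PowerSeries K,
      ∑ j, (p j : PowerSeries K) * (PowerSeries.derivative K)^[j] y = 0 →
      ∀ v : ℕ, ∑ b ∈ Finset.range (B + 1), (if b ≤ v then
        (L b).eval ((v - b : ℕ) : K) * PowerSeries.coeff (v - b) y else 0) = 0 := by
  classical
  let Q : Fin (r + 1) → K[X] := fun j => Polynomial.X ^ (r - j) * p j
  let Lp : ℕ → K[X] := fun b => ∑ j, Polynomial.C ((Q j).coeff b) * descPochhammer K j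
  have hLp : ∀ b v : ℕ, (Lp b).eval (v : K) =
      ∑ j, (Q j).coeff b * (v.descFactorial j : K) := fun b v => by
    simp only [Lp, Polynomial.eval_finsetSum, Polynomial.eval_mul, Polynomial.eval_C,
      descPochhammer_eval_eq_descFactorial]
  have hLp0 : ∀ b, Lp b = 0 → ∀ j, (Q j).coeff b = 0 := by
    intro b hb j
    obtain ⟨j, hj⟩ := j
    induction j using Nat.strong_induction_on with
    | _ j ih =>
      have h1 := hLp b j
      rw [hb, Polynomial.eval_zero, Finset.sum_eq_single (⟨j, hj⟩ : Fin (r + 1))] at h1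
      · have h2 : ((j.descFactorial j : ℕ) : K) ≠ 0 := by
          rw [Nat.descFactorial_self]; exact_mod_cast j.factorial_ne_zero
        exact (mul_eq_zero.mp h1.symm).resolve_right h2
      · intro i _ hij
        rcases lt_or_gt_of_ne (fun h : (i : ℕ) = j => hij (Fin.ext h)) with h | h
        · rw [ih i h i.2, zero_mul]
        · rw [Nat.descFactorial_eq_zero_iff_lt.mpr h]; simp
      · simp
  have hex : ∃ b, Lp b ≠ 0 := by
    by_contra! hall
    refine hp (funext fun j => ?_)
    have : Q j = 0 := Polynomial.ext fun b => by rw [hLp0 b (hall b) j, Polynomial.coeff_zero]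
    exact (mul_eq_zero.mp this).resolve_left (pow_ne_zero _ Polynomial.X_ne_zero)
  let b₀ := Nat.find hex
  have hb₀ : Lp b₀ ≠ 0 := Nat.find_spec hex
  have hlt : ∀ b < b₀, Lp b = 0 := fun b hb => not_not.mp (Nat.find_min hex hb)
  obtain ⟨B, hB⟩ : ∃ B, ∀ b, B < b → Lp b = 0 := by
    refine ⟨∑ j, (Q j).natDegree, fun b hb => Finset.sum_eq_zero fun j _ => ?_⟩
    rw [Polynomial.coeff_eq_zero_of_natDegree_lt
      ((Finset.single_le_sum (f := fun j => (Q j).natDegree) (fun _ _ => Nat.zero_le _)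
        (Finset.mem_univ j)).trans_lt hb), Polynomial.C_0, zero_mul]
  refine ⟨B, fun b => Lp (b₀ + b), hb₀, fun y hy v => ?_⟩
  have h1 : ∑ j, (Q j : PowerSeries K) *
      (PowerSeries.X ^ (j : ℕ) * (PowerSeries.derivative K)^[j] y) = 0 := by
    rw [← mul_zero (PowerSeries.X ^ r : PowerSeries K), ← hy, Finset.mul_sum]
    refine Finset.sum_congr rfl fun j _ => ?_
    have hj : (PowerSeries.X : PowerSeries K) ^ (r - j : ℕ) * PowerSeries.X ^ (j : ℕ) =
        PowerSeries.X ^ r := by rw [← pow_add]; congr 1; have := j.2; omega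
    simp only [Q, Polynomial.coe_mul, Polynomial.coe_pow, Polynomial.coe_X]
    rw [← hj]
    ring
  have h2 := congrArg (PowerSeries.coeff (b₀ + v)) h1
  rw [map_sum, map_zero, Finset.sum_congr rfl fun j _ => PowerSeries.coeff_mul _ _ _] at h2
  simp only [Polynomial.coeff_coe, coeff_X_pow_mul_iterate_derivative] at h2
  rw [Finset.sum_comm, Finset.Nat.sum_antidiagonal_eq_sum_range_succ_mk] at h2
  simp only [← mul_assoc, ← Finset.sum_mul, ← hLp] at h2
  rw [Nat.succ_eq_add_one, add_assoc, Finset.sum_range_add, Finset.sum_eq_zero, zero_add] at h2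
  · have h3 : ∀ x, b₀ + v - (b₀ + x) = v - x := fun x => by omega
    simp only [h3] at h2
    rw [← Finset.sum_filter]
    rw [← h2]
    refine Finset.sum_subset_zero_on_sdiff (fun b hb => ?_) (fun b hb => ?_) fun _ _ => rfl
    · simp only [Finset.mem_filter, Finset.mem_range] at hb ⊢; omega
    · simp only [Finset.mem_sdiff, Finset.mem_filter, Finset.mem_range, not_and] at hb
      rw [hB _ (by omega), Polynomial.eval_zero, zero_mul]
  · intro b hb
    rw [hlt b (Finset.mem_range.mp hb), Polynomial.eval_zero, zero_mul]

end Recurrence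

section Growth

open NumberField

variable {K : Type*} [Field K] [NumberField K]

/-- The coefficients of `y` have denominators and houses of at most factorial growth. -/
def Grow (y : PowerSeries K) : Prop := ∃ (E : ℝ) (D : ℕ), 1 ≤ E ∧ ∀ k : ℕ, ∃ π : K, π ≠ 0 ∧
  IsIntegral ℤ π ∧ house π ≤ E ^ (k + 1) * ((k + 1).factorial : ℝ) ^ D ∧ ∀ s ≤ k,
    IsIntegral ℤ (π * PowerSeries.coeff s y) ∧
      house (π * PowerSeries.coeff s y) ≤ E ^ (k + 1) * ((k + 1).factorial : ℝ) ^ D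

theorem house_eval_natCast_le (L : K[X]) {D : ℕ} (hD : L.natDegree ≤ D) (v : ℕ) :
    house (L.eval (v : K)) ≤
      (∑ i ∈ Finset.range (D + 1), house (L.coeff i)) * ((v : ℝ) + 1) ^ D := by
  rw [Polynomial.eval_eq_sum_range' (Nat.lt_succ_of_le hD), Finset.sum_mul]
  refine (house_sum_le_sum_house _ _).trans (Finset.sum_le_sum fun i hi => ?_)
  refine (house_mul_le _ _).trans (mul_le_mul_of_nonneg_left ?_ (house_nonneg _))
  rw [← Nat.cast_pow, house_natCast, Nat.cast_pow]
  have hi' : i ≤ D := Nat.lt_succ_iff.mp (Finset.mem_range.mp hi)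
  calc (v : ℝ) ^ i ≤ ((v : ℝ) + 1) ^ i := by gcongr; linarith
    _ ≤ _ := pow_le_pow_right₀ (by linarith [(Nat.cast_nonneg v : (0 : ℝ) ≤ v)]) hi'

theorem isIntegral_eval_natCast {L : K[X]} (h : ∀ i, IsIntegral ℤ (L.coeff i)) (v : ℕ) :
    IsIntegral ℤ (L.eval (v : K)) := by
  rw [Polynomial.eval_eq_sum_range]
  exact IsIntegral.sum _ fun i _ => (h i).mul ((isIntegral_natCast v).pow i)

/-- Finitely many algebraic numbers have a common denominator. -/
theorem exists_natCast_mul_isIntegral_of_finset {σ : Type*} (s : Finset σ) (a : σ → K) :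
    ∃ d : ℕ, d ≠ 0 ∧ ∀ i ∈ s, IsIntegral ℤ ((d : K) * a i) := by
  classical
  choose d hd h using fun i => exists_natCast_mul_isIntegral (a i)
  refine ⟨∏ i ∈ s, d i, Finset.prod_ne_zero_iff.mpr fun i _ => hd i, fun i hi => ?_⟩
  have h1 := Finset.mul_prod_erase s d hi
  have := (isIntegral_natCast (K := K) (∏ j ∈ s.erase i, d j)).mul (h i)
  rw [← mul_assoc, ← Nat.cast_mul, mul_comm (∏ j ∈ s.erase i, d j), h1] at this
  exact this

theorem exists_forall_eval_natCast_ne_zero {L : K[X]} (hL : L ≠ 0) :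
    ∃ v₀ : ℕ, ∀ v, v₀ ≤ v → L.eval (v : K) ≠ 0 := by
  have h1 : {x | L.IsRoot x}.Finite := Polynomial.finite_setOfPred_isRoot hL
  obtain ⟨M, hM⟩ := (h1.preimage (Nat.cast_injective (R := K)).injOn).bddAbove
  exact ⟨M + 1, fun v hv h0 => by have := hM (a := v) h0; omega⟩

theorem house_one : house (1 : K) = 1 := by simpa using house_natCast (K := K) 1

theorem house_zero : house (0 : K) = 0 := by simpa using house_natCast (K := K) 0

/-- Growth of the solutions of a linear recurrence whose coefficients `ℓ b v` are integral and
polynomially bounded. -/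
theorem grow_of_bounded_recurrence {y : PowerSeries K} {B v₀ D : ℕ} {M : ℝ} {ℓ : ℕ → ℕ → K}
    (hM0 : 0 ≤ M) (hInt : ∀ b ≤ B, ∀ v, IsIntegral ℤ (ℓ b v))
    (hM : ∀ b ≤ B, ∀ v : ℕ, house (ℓ b v) ≤ M * ((v : ℝ) + 1) ^ D)
    (hv₀ : ∀ v, v₀ ≤ v → ℓ 0 v ≠ 0)
    (hstep : ∀ v : ℕ, ℓ 0 v * PowerSeries.coeff v y =
      -∑ b ∈ Finset.range B, (if b + 1 ≤ v then
        ℓ (b + 1) (v - (b + 1)) * PowerSeries.coeff (v - (b + 1)) y else 0)) : Grow y := by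
  classical
  obtain ⟨N₀, hN₀, hN₀int⟩ := exists_natCast_mul_isIntegral_of_finset (Finset.range v₀)
    fun s => PowerSeries.coeff s y
  obtain ⟨S, hS0, hS⟩ : ∃ S : ℝ, 0 ≤ S ∧ ∀ s < v₀, house ((N₀ : K) * PowerSeries.coeff s y) ≤ S :=
    ⟨∑ s ∈ Finset.range v₀, house ((N₀ : K) * PowerSeries.coeff s y),
      Finset.sum_nonneg fun _ _ => house_nonneg _, fun s hs => Finset.single_le_sum
        (f := fun s => house ((N₀ : K) * PowerSeries.coeff s y)) (fun _ _ => house_nonneg _)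
        (Finset.mem_range.mpr hs)⟩
  obtain ⟨E, hE1, hME, hBME, hSE, hNE⟩ : ∃ E : ℝ, 1 ≤ E ∧ M ≤ E ∧ B * M ≤ E ∧ S ≤ E ∧
      (N₀ : ℝ) ≤ E := by
    have : 0 ≤ (B : ℝ) * M := by positivity
    have : (0 : ℝ) ≤ N₀ := by positivity
    exact ⟨1 + M + B * M + S + N₀, by linarith, by linarith, by linarith, by linarith,
      by linarith⟩
  have hX0 : ∀ k : ℕ, E ≤ E ^ (k + 1) * ((k + 1).factorial : ℝ) ^ D := fun k => by
    calc E = E ^ 1 * 1 := by ring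
      _ ≤ _ := mul_le_mul (pow_le_pow_right₀ hE1 (by omega))
          (one_le_pow₀ (by exact_mod_cast (k + 1).factorial_pos)) zero_le_one (by positivity)
  have hXs : ∀ k : ℕ, E * ((k : ℝ) + 1 + 1) ^ D * (E ^ (k + 1) * ((k + 1).factorial : ℝ) ^ D) =
      E ^ (k + 1 + 1) * ((k + 1 + 1).factorial : ℝ) ^ D := fun k => by
    rw [Nat.factorial_succ (k + 1)]; push_cast; rw [mul_pow]; ring
  have hbase : ∀ k < v₀, ∃ π : K, π ≠ 0 ∧
      IsIntegral ℤ π ∧ house π ≤ E ^ (k + 1) * ((k + 1).factorial : ℝ) ^ D ∧ ∀ s ≤ k,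
      IsIntegral ℤ (π * PowerSeries.coeff s y) ∧
      house (π * PowerSeries.coeff s y) ≤ E ^ (k + 1) * ((k + 1).factorial : ℝ) ^ D := by
    intro k hk
    refine ⟨N₀, by exact_mod_cast hN₀, isIntegral_natCast _, ?_, fun s hs =>
      ⟨hN₀int s (Finset.mem_range.mpr (by omega)), ?_⟩⟩
    · rw [house_natCast]
      exact hNE.trans (hX0 k)
    · exact (hS s (by omega)).trans (hSE.trans (hX0 k))
  refine ⟨E, D, hE1, fun k => ?_⟩
  induction k with
  | zero =>
    rcases Nat.lt_or_ge 0 v₀ with h | h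
    · exact hbase 0 h
    · have h2 := hstep 0
      rw [Finset.sum_eq_zero fun b _ => if_neg (by omega), neg_zero] at h2
      have h3 := (mul_eq_zero.mp h2).resolve_left (hv₀ 0 h)
      refine ⟨1, one_ne_zero, isIntegral_one, ?_, fun s hs => ?_⟩
      · rw [house_one]; exact hE1.trans (hX0 0)
      · rw [Nat.le_zero.mp hs, h3, mul_zero, house_zero]
        exact ⟨isIntegral_zero, by positivity⟩
  | succ k ih =>
    rcases Nat.lt_or_ge (k + 1) v₀ with h | h
    · exact hbase _ h
    obtain ⟨π, hπ, hπi, hπh, hy⟩ := ih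
    have hmul : ∀ x : K, house x ≤ E ^ (k + 1) * ((k + 1).factorial : ℝ) ^ D →
        house (ℓ 0 (k + 1) * x) ≤ E ^ (k + 1 + 1) * ((k + 1 + 1).factorial : ℝ) ^ D := by
      intro x hx
      refine (house_mul_le _ _).trans ?_
      rw [← hXs]
      refine mul_le_mul ?_ hx (house_nonneg _) (by positivity)
      refine (hM 0 (Nat.zero_le _) _).trans ?_
      push_cast
      gcongr
    refine ⟨ℓ 0 (k + 1) * π, mul_ne_zero (hv₀ _ h) hπ,
      (hInt 0 (Nat.zero_le _) _).mul hπi, hmul π hπh, fun s hs => ?_⟩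
    rcases Nat.lt_or_ge s (k + 1) with hs' | hs'
    · rw [mul_assoc]
      exact ⟨(hInt 0 (Nat.zero_le _) _).mul (hy s (by omega)).1, hmul _ (hy s (by omega)).2⟩
    · obtain rfl : s = k + 1 := by omega
      have h5 : ℓ 0 (k + 1) * π * PowerSeries.coeff (k + 1) y =
          -∑ b ∈ Finset.range B, (if b + 1 ≤ k + 1 then
            ℓ (b + 1) (k + 1 - (b + 1)) *
              (π * PowerSeries.coeff (k + 1 - (b + 1)) y) else 0) := by
        rw [mul_right_comm, hstep, neg_mul, Finset.sum_mul]
        congr 1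
        refine Finset.sum_congr rfl fun b _ => ?_
        split_ifs
        · ring
        · rw [zero_mul]
      rw [h5, house_neg]
      have hmem : ∀ b ∈ Finset.range B, b + 1 ≤ B := fun b hb => by
        simp only [Finset.mem_range] at hb; omega
      refine ⟨(IsIntegral.sum _ fun b hb => ?_).neg, ?_⟩
      · split_ifs
        · exact (hInt _ (hmem b hb) _).mul (hy _ (by omega)).1
        · exact isIntegral_zero
      · refine (house_sum_le_sum_house _ _).trans ?_
        calc _ ≤ ∑ _b ∈ Finset.range B, M * ((k : ℝ) + 1 + 1) ^ D *
              (E ^ (k + 1) * ((k + 1).factorial : ℝ) ^ D) := by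
              refine Finset.sum_le_sum fun b hb => ?_
              split_ifs
              · refine (house_mul_le _ _).trans
                  (mul_le_mul ?_ (hy _ (by omega)).2 (house_nonneg _) (by positivity))
                refine (hM _ (hmem b hb) _).trans ?_
                have : ((k + 1 - (b + 1) : ℕ) : ℝ) ≤ k + 1 := by
                  exact_mod_cast (Nat.sub_le (k + 1) (b + 1))
                gcongr
              · rw [house_zero]; positivity
          _ = B * M * ((k : ℝ) + 1 + 1) ^ D * (E ^ (k + 1) * ((k + 1).factorial : ℝ) ^ D) := by
              rw [Finset.sum_const, Finset.card_range, nsmul_eq_mul]; ring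
          _ ≤ E * ((k : ℝ) + 1 + 1) ^ D * (E ^ (k + 1) * ((k + 1).factorial : ℝ) ^ D) := by
              gcongr
          _ = _ := hXs k

theorem grow_of_recurrence {y : PowerSeries K} {B : ℕ} {L : ℕ → K[X]} (hL0 : L 0 ≠ 0)
    (hrec : ∀ v : ℕ, ∑ b ∈ Finset.range (B + 1), (if b ≤ v then
        (L b).eval ((v - b : ℕ) : K) * PowerSeries.coeff (v - b) y else 0) = 0) : Grow y := by
  classical
  obtain ⟨D, hdeg⟩ : ∃ D, ∀ b ∈ Finset.range (B + 1), (L b).natDegree ≤ D :=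
    ⟨∑ b ∈ Finset.range (B + 1), (L b).natDegree, fun b hb =>
      Finset.single_le_sum (f := fun b => (L b).natDegree) (fun _ _ => Nat.zero_le _) hb⟩
  obtain ⟨N, hN, hNint⟩ := exists_natCast_mul_isIntegral_of_finset
    (Finset.range (B + 1) ×ˢ Finset.range (D + 1)) fun x : ℕ × ℕ => (L x.1).coeff x.2
  obtain ⟨v₀, hv₀⟩ := exists_forall_eval_natCast_ne_zero hL0
  have hmem : ∀ b ≤ B, b ∈ Finset.range (B + 1) := fun b hb =>
    Finset.mem_range.mpr (Nat.lt_succ_of_le hb)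
  have hN' : (N : K) ≠ 0 := by exact_mod_cast hN
  refine grow_of_bounded_recurrence (ℓ := fun b v => (N : K) * (L b).eval (v : K)) (B := B)
    (v₀ := v₀) (D := D) (M := N * ∑ b ∈ Finset.range (B + 1),
      ∑ i ∈ Finset.range (D + 1), house ((L b).coeff i)) ?_ ?_ ?_
    (fun v hv => mul_ne_zero hN' (hv₀ v hv)) fun v => ?_
  · exact mul_nonneg (by positivity) (Finset.sum_nonneg fun _ _ => Finset.sum_nonneg fun _ _ =>
      house_nonneg _)
  · intro b hb v
    have : (N : K) * (L b).eval (v : K) = (Polynomial.C (N : K) * L b).eval (v : K) := by simp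
    rw [this]
    refine isIntegral_eval_natCast (fun i => ?_) v
    rw [Polynomial.coeff_C_mul]
    by_cases hi : i ∈ Finset.range (D + 1)
    · exact hNint (b, i) (Finset.mem_product.mpr ⟨hmem b hb, hi⟩)
    · rw [Polynomial.coeff_eq_zero_of_natDegree_lt, mul_zero]
      · exact isIntegral_zero
      · have := hdeg b (hmem b hb)
        simp only [Finset.mem_range] at hi; omega
  · intro b hb v
    rw [house_nat_mul, mul_assoc]
    refine mul_le_mul_of_nonneg_left ((house_eval_natCast_le _ (hdeg b (hmem b hb)) v).trans
      (mul_le_mul_of_nonneg_right ?_ (by positivity))) (by positivity)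
    exact Finset.single_le_sum (f := fun b => ∑ i ∈ Finset.range (D + 1), house ((L b).coeff i))
      (fun _ _ => Finset.sum_nonneg fun _ _ => house_nonneg _) (hmem b hb)
  · have := hrec v
    rw [Finset.sum_range_succ'] at this
    simp only [Nat.zero_le, if_true, Nat.sub_zero] at this
    have h2 : ∀ b, (if b + 1 ≤ v then (N : K) * (L (b + 1)).eval ((v - (b + 1) : ℕ) : K) *
        PowerSeries.coeff (v - (b + 1)) y else 0) = (N : K) * (if b + 1 ≤ v then
        (L (b + 1)).eval ((v - (b + 1) : ℕ) : K) * PowerSeries.coeff (v - (b + 1)) y else 0) := by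
      intro b
      split_ifs
      · ring
      · rw [mul_zero]
    simp only [h2, ← Finset.mul_sum]
    linear_combination (N : K) * this

/-- The components of a power series solution of a differential system over a number field have
at most factorial growth. -/
theorem IsSol.grow {ι : Type*} [Fintype ι] {c : K} {t : K[X]} (ht : t ≠ 0) {A : ι → ι → K[X]}
    {y : ι → PowerSeries K} (hy : IsSol c t A y) (i : ι) : Grow (y i) := by
  classical
  obtain ⟨q, hq, h⟩ := exists_scalar_ode t ht A (Pi.single i 1)
  have h1 : app c (Pi.single i 1) y = y i := by
    rw [app, Finset.sum_eq_single i]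
    · simp
    · intro j _ hj; simp [hj]
    · simp
  have h2 := h c y hy
  rw [h1] at h2
  obtain ⟨B, L, hL, h3⟩ := exists_recurrence (fun j => Polynomial.taylor c (q j)) (fun h0 => hq <|
    funext fun j => Polynomial.taylor_injective c (by simpa using congrFun h0 j))
  exact grow_of_recurrence hL (h3 _ (by simpa only [sh_apply] using h2))

theorem Grow.exists_uniform {σ : Type*} [Fintype σ] {y : σ → PowerSeries K}
    (hy : ∀ i, Grow (y i)) : ∃ (E : ℝ) (D : ℕ), 1 ≤ E ∧ ∀ k : ℕ, ∃ π : K, π ≠ 0 ∧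
      IsIntegral ℤ π ∧ house π ≤ E ^ (k + 1) * ((k + 1).factorial : ℝ) ^ D ∧
      ∀ i, ∀ s ≤ k, IsIntegral ℤ (π * PowerSeries.coeff s (y i)) ∧
        house (π * PowerSeries.coeff s (y i)) ≤ E ^ (k + 1) * ((k + 1).factorial : ℝ) ^ D := by
  classical
  choose E D hE h using hy
  choose π hπ hπi hπh hy using h
  have hX : ∀ i (k : ℕ), 1 ≤ E i ^ (k + 1) * ((k + 1).factorial : ℝ) ^ D i := fun i k =>
    one_le_mul_of_one_le_of_one_le (one_le_pow₀ (hE i))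
      (one_le_pow₀ (by exact_mod_cast (k + 1).factorial_pos))
  have hprod : ∀ (k : ℕ) (s : Finset σ), house (∏ j ∈ s, π j k) ≤
      ∏ j ∈ s, (E j ^ (k + 1) * ((k + 1).factorial : ℝ) ^ D j) := by
    intro k s
    induction s using Finset.induction_on with
    | empty => simpa using (house_natCast (K := K) 1).le
    | insert a s ha ih =>
      rw [Finset.prod_insert ha, Finset.prod_insert ha]
      exact (house_mul_le _ _).trans (mul_le_mul (hπh a k) ih (house_nonneg _)
        (zero_le_one.trans (hX a k)))
  have heq : ∀ k : ℕ, ∏ j, (E j ^ (k + 1) * ((k + 1).factorial : ℝ) ^ D j) =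
      (∏ i, E i) ^ (k + 1) * ((k + 1).factorial : ℝ) ^ ∑ i, D i := fun k => by
    rw [Finset.prod_mul_distrib, Finset.prod_pow, Finset.prod_pow_eq_pow_sum]
  refine ⟨∏ i, E i, ∑ i, D i, Finset.one_le_prod fun i _ => hE i, fun k => ⟨∏ i, π i k,
    Finset.prod_ne_zero_iff.mpr fun i _ => hπ i k, IsIntegral.prod _ fun i _ => hπi i k,
    (hprod k Finset.univ).trans_eq (heq k), fun i s hs => ?_⟩⟩
  rw [← Finset.mul_prod_erase _ _ (Finset.mem_univ i), mul_right_comm]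
  refine ⟨(hy i k s hs).1.mul (IsIntegral.prod _ fun j _ => hπi j k), ?_⟩
  calc _ ≤ (E i ^ (k + 1) * ((k + 1).factorial : ℝ) ^ D i) *
        ∏ j ∈ Finset.univ.erase i, (E j ^ (k + 1) * ((k + 1).factorial : ℝ) ^ D j) :=
        (house_mul_le _ _).trans (mul_le_mul (hy i k s hs).2 (hprod _ _) (house_nonneg _)
          (zero_le_one.trans (hX i k)))
    _ = _ := by
        rw [Finset.mul_prod_erase Finset.univ
          (fun j => E j ^ (k + 1) * ((k + 1).factorial : ℝ) ^ D j) (Finset.mem_univ i), heq]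

end Growth

section Decomposition

variable {K : Type*} [Field K] [CharZero K] [Algebra K ℂ]

/-- Apply a linear functional to every coefficient. -/
def mapFunctional (l : ℂ →ₗ[K] K) (g : PowerSeries ℂ) : PowerSeries K :=
  PowerSeries.mk fun n => l (PowerSeries.coeff n g)

theorem coeff_mapFunctional (l : ℂ →ₗ[K] K) (g : PowerSeries ℂ) (n : ℕ) :
    PowerSeries.coeff n (mapFunctional l g) = l (PowerSeries.coeff n g) :=
  PowerSeries.coeff_mk _ _

theorem mapFunctional_map_mul (l : ℂ →ₗ[K] K) (p : PowerSeries K) (g : PowerSeries ℂ) :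
    mapFunctional l (PowerSeries.map (algebraMap K ℂ) p * g) = p * mapFunctional l g := by
  ext n
  rw [coeff_mapFunctional, PowerSeries.coeff_mul, PowerSeries.coeff_mul, map_sum]
  refine Finset.sum_congr rfl fun x _ => ?_
  rw [PowerSeries.coeff_map, ← Algebra.smul_def, map_smul, coeff_mapFunctional, smul_eq_mul]

theorem mapFunctional_sum {σ : Type*} (l : ℂ →ₗ[K] K) (s : Finset σ) (g : σ → PowerSeries ℂ) :
    mapFunctional l (∑ i ∈ s, g i) = ∑ i ∈ s, mapFunctional l (g i) := by
  ext n
  simp only [coeff_mapFunctional, map_sum]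

theorem mapFunctional_derivative (l : ℂ →ₗ[K] K) (g : PowerSeries ℂ) :
    mapFunctional l (PowerSeries.derivative ℂ g) =
      PowerSeries.derivative K (mapFunctional l g) := by
  ext n
  rw [coeff_mapFunctional, PowerSeries.coeff_derivative, PowerSeries.coeff_derivative,
    coeff_mapFunctional, mul_comm, mul_comm (l _)]
  have : ((n : ℂ) + 1) = algebraMap K ℂ ((n : K) + 1) := by simp
  rw [this, ← Algebra.smul_def, map_smul, smul_eq_mul]

theorem IsSol.mapFunctional {ι : Type*} [Fintype ι] {c : K} {t : K[X]} {A : ι → ι → K[X]}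
    {g : ι → PowerSeries ℂ} (hg : IsSol (algebraMap K ℂ c) (t.map (algebraMap K ℂ))
      (fun i k => (A i k).map (algebraMap K ℂ)) g) (l : ℂ →ₗ[K] K) :
    IsSol c t A (fun i => mapFunctional l (g i)) := by
  intro i
  have := congrArg (EFun.mapFunctional l) (hg i)
  simpa only [← map_sh, mapFunctional_map_mul, mapFunctional_sum, mapFunctional_derivative]
    using this

/-- A complex solution of a system defined over `K` is a combination of finitely many solutions
over `K`, the coefficients being linearly independent over `K`. -/
theorem exists_decomposition {ι : Type*} [Fintype ι] {c : K} {t : K[X]} (ht : t ≠ 0)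
    {A : ι → ι → K[X]} {g : ι → PowerSeries ℂ}
    (hg : IsSol (algebraMap K ℂ c) (t.map (algebraMap K ℂ))
      (fun i k => (A i k).map (algebraMap K ℂ)) g) :
    ∃ (ρ : ℕ) (γ : Fin ρ → ℂ) (y : Fin ρ → ι → PowerSeries K), LinearIndependent K γ ∧
      LinearIndependent K y ∧ (∀ h, IsSol c t A (y h)) ∧
      ∀ i, g i = ∑ h, PowerSeries.C (γ h) * PowerSeries.map (algebraMap K ℂ) (y h i) := by
  classical
  let v : ι × ℕ → ℂ := fun x => PowerSeries.coeff x.2 (g x.1)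
  let S : Submodule K ℂ := Submodule.span K (Set.range v)
  let b := Module.Basis.ofVectorSpace K S
  have hext : ∀ i, ∃ l : ℂ →ₗ[K] K, l ∘ₗ S.subtype = b.coord i := fun i =>
    LinearMap.exists_extend _
  choose l hl using hext
  have hlS : ∀ i (x : S), l i x = b.coord i x := fun i x => by rw [← hl i]; rfl
  have hsol := fun i => hg.mapFunctional (l i)
  have hLI : LinearIndependent K (fun i => fun k => mapFunctional (l i) (g k)) := by
    rw [linearIndependent_iff']
    intro s a ha i hi
    have hzero : ∀ x : S, ∑ j ∈ s, a j * l j x = 0 := by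
      let L : ℂ →ₗ[K] K := ∑ j ∈ s, a j • l j
      have hL : ∀ x, L x = ∑ j ∈ s, a j * l j x := fun x => by simp [L, LinearMap.sum_apply]
      have hle : S ≤ LinearMap.ker L := by
        rw [Submodule.span_le]
        rintro _ ⟨x, rfl⟩
        rw [SetLike.mem_coe, LinearMap.mem_ker, hL]
        have := congrArg (PowerSeries.coeff x.2) (congrFun ha x.1)
        simpa [coeff_mapFunctional, Finset.sum_apply] using this
      intro x
      rw [← hL]
      exact hle x.2
    have := hzero (b i)
    simp only [hlS, Module.Basis.coord_apply, Module.Basis.repr_self, Finsupp.single_apply] at this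
    simpa [hi] using this
  have hfin : Finite (Module.Basis.ofVectorSpaceIndex K S) := by
    by_contra hinf
    rw [not_finite_iff_infinite] at hinf
    obtain ⟨s, hs⟩ := Infinite.exists_subset_card_eq (Module.Basis.ofVectorSpaceIndex K S)
      (Fintype.card ι + 1)
    have := IsSol.card_le ht (fun i : s => hsol i) (hLI.comp _ Subtype.val_injective)
    rw [Fintype.card_coe, hs] at this
    omega
  have := Fintype.ofFinite (Module.Basis.ofVectorSpaceIndex K S)
  let E := (Fintype.equivFin (Module.Basis.ofVectorSpaceIndex K S)).symm
  refine ⟨_, fun h => (b (E h) : ℂ), fun h k => mapFunctional (l (E h)) (g k),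
    ?_, hLI.comp _ E.injective, fun h => hsol _, fun i => ?_⟩
  · exact (b.linearIndependent.map' S.subtype (Submodule.ker_subtype S)).comp _ E.injective
  · ext n
    have hmem : v (i, n) ∈ S := Submodule.subset_span ⟨_, rfl⟩
    have h1 := congrArg (Subtype.val) (b.sum_repr ⟨_, hmem⟩)
    rw [map_sum, E.sum_comp (fun h => PowerSeries.coeff n (PowerSeries.C (b h : ℂ) *
      PowerSeries.map (algebraMap K ℂ) (mapFunctional (l h) (g i))))]
    change v (i, n) = _
    have h2 : v (i, n) = ∑ h, b.repr ⟨_, hmem⟩ h • (b h : ℂ) := by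
      refine h1.symm.trans ?_
      rw [AddSubmonoidClass.coe_finsetSum]
      rfl
    rw [h2]
    refine Finset.sum_congr rfl fun h _ => ?_
    rw [PowerSeries.coeff_C_mul, PowerSeries.coeff_map, coeff_mapFunctional, mul_comm,
      ← Algebra.smul_def]
    congr 1
    exact (hlS h ⟨_, hmem⟩).symm

end Decomposition

section Siegel

open NumberField

variable {K : Type*} [Field K] [NumberField K]

theorem exists_siegel_const (K : Type*) [Field K] [NumberField K] : ∃ c : ℝ, 1 ≤ c ∧
    ∀ (β : Type) [Fintype β] (p q : ℕ) (a : Matrix (Fin p) β (𝓞 K)) (A : ℝ), 0 < p → p < q →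
    Fintype.card β = q → 1 ≤ A → (∀ k l, house (algebraMap (𝓞 K) K (a k l)) ≤ A) →
    ∃ ξ : β → 𝓞 K, ξ ≠ 0 ∧ a.mulVec ξ = 0 ∧
      ∀ l, house (algebraMap (𝓞 K) K (ξ l)) ≤ c * (c * q * A) ^ ((p : ℝ) / (q - p)) := by
  classical
  obtain ⟨c₁, h⟩ : ∃ c₁ : ℝ, ∀ (β : Type) [Fintype β] (p q : ℕ)
      (a : Matrix (Fin p) β (𝓞 K)) (A : ℝ), a ≠ 0 → 0 < p → p < q → Fintype.card β = q →
      (∀ k l, house (algebraMap (𝓞 K) K (a k l)) ≤ A) → ∃ ξ : β → 𝓞 K, ξ ≠ 0 ∧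
      a.mulVec ξ = 0 ∧
      ∀ l, house (algebraMap (𝓞 K) K (ξ l)) ≤ c₁ * (c₁ * q * A) ^ ((p : ℝ) / (q - p)) :=
    ⟨_, fun β _ p q a A ha h0 hpq hq hA =>
      house.exists_ne_zero_int_vec_house_le K a ha h0 hpq hq hA (Fintype.card_fin p)⟩
  refine ⟨max 1 |c₁|, le_max_left _ _, fun β _ p q a A h0 hpq hq hA hb => ?_⟩
  have hq1 : (1 : ℝ) ≤ q := by exact_mod_cast (by omega : 1 ≤ q)
  have hpos : (0 : ℝ) ≤ (p : ℝ) / (q - p) :=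
    div_nonneg (Nat.cast_nonneg _) (sub_nonneg.mpr (by exact_mod_cast hpq.le))
  rcases eq_or_ne a 0 with rfl | ha
  · have : Nonempty β := Fintype.card_pos_iff.mp (by omega)
    refine ⟨fun _ => 1, fun h => one_ne_zero (congrFun h (Classical.arbitrary β)), by simp,
      fun l => ?_⟩
    rw [map_one]
    have h1 := house_natCast (K := K) 1
    simp only [Nat.cast_one] at h1
    rw [h1]
    refine one_le_mul_of_one_le_of_one_le (le_max_left _ _) (Real.one_le_rpow ?_ hpos)
    exact one_le_mul_of_one_le_of_one_le
      (one_le_mul_of_one_le_of_one_le (le_max_left _ _) hq1) hA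
  · obtain ⟨ξ, h1, h2, h3⟩ := h β p q a A ha h0 hpq hq hb
    refine ⟨ξ, h1, h2, fun l => (h3 l).trans ((le_abs_self _).trans ?_)⟩
    rw [abs_mul]
    refine mul_le_mul (le_max_right _ _) ((Real.abs_rpow_le_abs_rpow _ _).trans ?_)
      (abs_nonneg _) (zero_le_one.trans (le_max_left _ _))
    refine Real.rpow_le_rpow (abs_nonneg _) ?_ hpos
    rw [abs_mul, abs_mul, abs_of_nonneg (zero_le_one.trans hq1),
      abs_of_nonneg (zero_le_one.trans hA)]
    gcongr
    exact le_max_right _ _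

/-- Polynomials with prescribed coefficients. -/
def ofCoeffs (N : ℕ) (a : ℕ → K) : K[X] := ∑ l ∈ Finset.range (N + 1), Polynomial.monomial l (a l)

theorem coeff_ofCoeffs (N : ℕ) (a : ℕ → K) (l : ℕ) :
    (ofCoeffs N a).coeff l = if l ≤ N then a l else 0 := by
  simp [ofCoeffs, Polynomial.finsetSum_coeff, Polynomial.coeff_monomial]

theorem natDegree_ofCoeffs_le (N : ℕ) (a : ℕ → K) : (ofCoeffs N a).natDegree ≤ N := by
  rw [Polynomial.natDegree_le_iff_coeff_eq_zero]
  intro l hl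
  rw [coeff_ofCoeffs, if_neg (by omega)]

variable {ι : Type} [Fintype ι]

theorem coeff_app_zero (P : ι → K[X]) (u : ι → PowerSeries K) {N : ℕ}
    (hP : ∀ i, (P i).natDegree ≤ N) (m : ℕ) :
    PowerSeries.coeff m (app 0 P u) = ∑ x : ι × Fin (N + 1),
      if (x.2 : ℕ) ≤ m then (P x.1).coeff x.2 * PowerSeries.coeff (m - x.2) (u x.1) else 0 := by
  rw [app, map_sum, Fintype.sum_prod_type]
  refine Finset.sum_congr rfl fun i _ => ?_
  rw [sh_zero, PowerSeries.coeff_mul, Finset.Nat.sum_antidiagonal_eq_sum_range_succ_mk,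
    Fin.sum_univ_eq_sum_range (fun l => if l ≤ m then (P i).coeff l *
      PowerSeries.coeff (m - l) (u i) else 0) (N + 1)]
  simp only [Polynomial.coeff_coe]
  rw [← Finset.sum_filter]
  symm
  apply Finset.sum_subset
  · intro l hl
    simp only [Finset.mem_filter, Finset.mem_range] at hl ⊢
    omega
  · intro l hl hl'
    simp only [Finset.mem_filter, Finset.mem_range, not_and] at hl hl'
    rw [Polynomial.coeff_eq_zero_of_natDegree_lt, zero_mul]
    have := hP i
    by_contra! h
    exact hl' (by omega) (by omega)

theorem siegel_bound_aux (n H : ℕ) (hn : 1 ≤ n) (hH : 2 ≤ H) {c C : ℝ} (hc : 1 ≤ c)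
    (hC : 1 ≤ C) : ∃ C' : ℝ, 1 ≤ C' ∧ ∀ T : ℕ, 1 ≤ T →
      c * (c * (n * (H * T + 1) : ℕ) * (2 * C ^ 2) ^ ((n * H - 1) * T + 1)) ^
        ((((n * H - 1) * T : ℕ) : ℝ) / ((n * (H * T + 1) : ℕ) - ((n * H - 1) * T : ℕ))) ≤
      C' ^ T := by
  have hn' : (1 : ℝ) ≤ n := by exact_mod_cast hn
  have hH' : (1 : ℝ) ≤ H := by exact_mod_cast (by omega : 1 ≤ H)
  have h2C : (1 : ℝ) ≤ 2 * C ^ 2 := by nlinarith [one_le_pow₀ hC (n := 2)]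
  let B : ℝ := c * n * (H + 1) * 2 * (2 * C ^ 2) ^ (n * H)
  have hB : 1 ≤ B := by
    refine one_le_mul_of_one_le_of_one_le (one_le_mul_of_one_le_of_one_le
      (one_le_mul_of_one_le_of_one_le (one_le_mul_of_one_le_of_one_le hc hn') (by linarith))
      one_le_two) (one_le_pow₀ h2C)
  refine ⟨c * B ^ (n * H), one_le_mul_of_one_le_of_one_le hc (one_le_pow₀ hB), fun T hT => ?_⟩
  have hnH : 2 ≤ n * H := by nlinarith
  have hsub : (n * H - 1) * T + T = n * H * T := by
    rw [← Nat.succ_mul]; congr 1; omega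
  have hT' : (1 : ℝ) ≤ T := by exact_mod_cast hT
  have hbase : c * (n * (H * T + 1) : ℕ) * (2 * C ^ 2) ^ ((n * H - 1) * T + 1) ≤ B ^ T := by
    have h1 : (2 * C ^ 2) ^ ((n * H - 1) * T + 1) ≤ ((2 * C ^ 2) ^ (n * H)) ^ T := by
      rw [← pow_mul]; exact pow_le_pow_right₀ h2C (by omega)
    have h2 : ((n * (H * T + 1) : ℕ) : ℝ) ≤ n * (H + 1) * 2 ^ T := by
      have : (T : ℝ) ≤ 2 ^ T := by exact_mod_cast Nat.lt_two_pow_self.le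
      push_cast
      rw [mul_assoc]
      refine mul_le_mul_of_nonneg_left ?_ (by linarith)
      nlinarith
    have h3 : c * n * (H + 1) ≤ (c * n * (H + 1)) ^ T := le_self_pow₀
      (one_le_mul_of_one_le_of_one_le (one_le_mul_of_one_le_of_one_le hc hn') (by linarith))
      (by omega)
    calc _ ≤ c * (n * (H + 1) * 2 ^ T) * ((2 * C ^ 2) ^ (n * H)) ^ T := by gcongr
      _ = (c * n * (H + 1)) * 2 ^ T * ((2 * C ^ 2) ^ (n * H)) ^ T := by ring
      _ ≤ (c * n * (H + 1)) ^ T * 2 ^ T * ((2 * C ^ 2) ^ (n * H)) ^ T := by gcongr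
      _ = B ^ T := by simp only [B, mul_pow]
  have hone : 1 ≤ c * (n * (H * T + 1) : ℕ) * (2 * C ^ 2) ^ ((n * H - 1) * T + 1) := by
    refine one_le_mul_of_one_le_of_one_le (one_le_mul_of_one_le_of_one_le hc ?_)
      (one_le_pow₀ h2C)
    exact_mod_cast (by nlinarith : 1 ≤ n * (H * T + 1))
  have hexp : (((n * H - 1) * T : ℕ) : ℝ) / ((n * (H * T + 1) : ℕ) - ((n * H - 1) * T : ℕ)) ≤
      (n * H : ℕ) := by
    have h1 : ((n * (H * T + 1) : ℕ) : ℝ) - ((n * H - 1) * T : ℕ) = n + T := by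
      have : n * (H * T + 1) = (n * H - 1) * T + (n + T) := by
        rw [mul_add, ← mul_assoc, ← hsub]; ring
      rw [this]; push_cast; ring
    rw [h1, div_le_iff₀ (by positivity)]
    have h2 : (n * H - 1) * T ≤ n * H * (n + T) := by
      refine (Nat.mul_le_mul_right _ (Nat.sub_le _ _)).trans ?_
      gcongr; omega
    exact_mod_cast h2
  calc _ ≤ c * (c * (n * (H * T + 1) : ℕ) * (2 * C ^ 2) ^ ((n * H - 1) * T + 1)) ^
        ((n * H : ℕ) : ℝ) := by
        refine mul_le_mul_of_nonneg_left (Real.rpow_le_rpow_of_exponent_le hone hexp) (by linarith)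
    _ ≤ c * (B ^ T) ^ (n * H) := by
        rw [Real.rpow_natCast]; gcongr
    _ ≤ c ^ T * (B ^ T) ^ (n * H) := by
        gcongr; exact le_self_pow₀ hc (by omega)
    _ = _ := by rw [mul_pow c (B ^ (n * H)), ← pow_mul B, ← pow_mul B, mul_comm T]

theorem exists_siegel_form [Nonempty ι] {u : ι → PowerSeries K} (hu : ∀ i, EType (u i)) (H : ℕ)
    (hH : 2 ≤ H) : ∃ C : ℝ, 1 ≤ C ∧ ∀ T : ℕ, 1 ≤ T → ∃ P : ι → K[X], P ≠ 0 ∧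
      (∀ i, (P i).natDegree ≤ H * T) ∧ (∀ i l, IsIntegral ℤ ((P i).coeff l)) ∧
      (∀ i l, (l.factorial : ℝ) * house ((P i).coeff l) ≤ ((H * T).factorial : ℝ) * C ^ T) ∧
      PowerSeries.X ^ ((Fintype.card ι * H - 1) * T) ∣ app 0 P u := by
  obtain ⟨c, hc, hS⟩ := exists_siegel_const K
  obtain ⟨C, d, hC, hd⟩ := EType.exists_uniform hu
  obtain ⟨C', hC', hb⟩ := siegel_bound_aux (Fintype.card ι) H Fintype.card_pos hH hc hC
  refine ⟨C', hC', fun T hT => ?_⟩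
  have hnH : 2 ≤ Fintype.card ι * H := by nlinarith [Fintype.card_pos (α := ι)]
  have hsub : (Fintype.card ι * H - 1) * T + T = Fintype.card ι * H * T := by
    rw [← Nat.succ_mul]; congr 1; omega
  obtain ⟨N, hN⟩ : ∃ N, N = H * T := ⟨_, rfl⟩
  obtain ⟨M, hM⟩ : ∃ M, M = (Fintype.card ι * H - 1) * T := ⟨_, rfl⟩
  have hb := hb T hT
  have hM0 : 0 < M := by rw [hM]; exact Nat.mul_pos (by omega) (by omega)
  rw [← hN, ← hM] at hb
  rw [← hN, ← hM]
  let w : ℕ → ι × Fin (N + 1) → K := fun m x => if (x.2 : ℕ) ≤ m then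
    ((m.choose x.2 : ℕ) : K) * ((d M : K) * (((m - x.2).factorial : K) *
      PowerSeries.coeff (m - x.2) (u x.1))) else 0
  have hw : ∀ m ≤ M, ∀ x, IsIntegral ℤ (w m x) := fun m hm x => by
    simp only [w]
    split_ifs
    · exact (isIntegral_natCast _).mul (((hd M).2.2 _).2 _ (by omega))
    · exact isIntegral_zero
  have hwh : ∀ m ≤ M, ∀ x, house (w m x) ≤ (2 * C ^ 2) ^ (M + 1) := fun m hm x => by
    simp only [w]
    split_ifs with h
    · refine (house_mul_le _ _).trans ?_
      rw [house_natCast]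
      have h1 : house ((d M : K) * (((m - x.2).factorial : K) *
          PowerSeries.coeff (m - x.2) (u x.1))) ≤ C ^ (M + 1) * C ^ (M + 1) := by
        refine (house_mul_le _ _).trans (mul_le_mul ?_ ?_ (house_nonneg _) (by positivity))
        · rw [house_natCast]; exact (hd M).2.1
        · exact (((hd _).2.2 _).1).trans (pow_le_pow_right₀ hC (by omega))
      have h2 : ((m.choose x.2 : ℕ) : ℝ) ≤ 2 ^ (M + 1) := by
        exact_mod_cast (Nat.choose_le_two_pow _ _).trans
          (Nat.pow_le_pow_right two_pos (by omega))
      calc _ ≤ 2 ^ (M + 1) * (C ^ (M + 1) * C ^ (M + 1)) :=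
            mul_le_mul h2 h1 (house_nonneg _) (by positivity)
        _ = _ := by rw [mul_pow, ← mul_pow, sq]
    · rw [house_zero]; positivity
  obtain ⟨B, hB⟩ : ∃ B : Matrix (Fin M) (ι × Fin (N + 1)) (𝓞 K),
      ∀ m x, algebraMap (𝓞 K) K (B m x) = w m x :=
    ⟨fun m x => ⟨w m x, hw m m.2.le x⟩, fun _ _ => rfl⟩
  obtain ⟨ξ, hξ, h0, hξh⟩ := hS (ι × Fin (N + 1)) M (Fintype.card ι * (N + 1)) B
    ((2 * C ^ 2) ^ (M + 1)) hM0
    (by rw [mul_add, hN, ← mul_assoc, ← hsub, hM]; omega) (by simp)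
    (one_le_pow₀ (by nlinarith [one_le_pow₀ hC (n := 2)]))
    (fun m x => (hB m x).symm ▸ hwh m m.2.le x)
  let a : ι → ℕ → K := fun i l => if h : l < N + 1 then
    algebraMap (𝓞 K) K (ξ (i, ⟨l, h⟩)) * ((N.factorial / l.factorial : ℕ) : K) else 0
  have ha : ∀ i (l : Fin (N + 1)), a i l =
      algebraMap (𝓞 K) K (ξ (i, l)) * ((N.factorial / (l : ℕ).factorial : ℕ) : K) := fun i l => by
    simp only [a]
    rw [dif_pos l.2]
  have hdiv : ∀ l : ℕ, l < N + 1 → l.factorial * (N.factorial / l.factorial) = N.factorial :=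
    fun l hl => Nat.mul_div_cancel' (Nat.factorial_dvd_factorial (by omega))
  refine ⟨fun i => ofCoeffs N (a i), fun h => hξ ?_, fun i => natDegree_ofCoeffs_le _ _,
    fun i l => ?_, fun i l => ?_, ?_⟩
  · funext x
    have h1 := congrArg (fun p => Polynomial.coeff p x.2) (congrFun h x.1)
    simp only [coeff_ofCoeffs, Pi.zero_apply, Polynomial.coeff_zero] at h1
    rw [if_pos (by omega), ha, mul_eq_zero] at h1
    rcases h1 with h1 | h1
    · exact (map_eq_zero_iff _ RingOfIntegers.coe_injective).mp h1
    · have := hdiv x.2 x.2.2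
      rw [Nat.cast_eq_zero] at h1
      rw [h1, mul_zero] at this
      exact absurd this.symm (Nat.factorial_ne_zero _)
  · rw [coeff_ofCoeffs]
    split_ifs with h
    · rw [show l = ((⟨l, by omega⟩ : Fin (N + 1)) : ℕ) from rfl, ha]
      exact (RingOfIntegers.isIntegral_coe _).mul (isIntegral_natCast _)
    · exact isIntegral_zero
  · rw [coeff_ofCoeffs]
    split_ifs with h
    · have h1 := ha i ⟨l, by omega⟩
      simp only at h1
      rw [h1]
      have h2 : house (algebraMap (𝓞 K) K (ξ (i, ⟨l, by omega⟩)) *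
          ((N.factorial / l.factorial : ℕ) : K)) ≤ C' ^ T * ((N.factorial / l.factorial : ℕ) : ℝ) := by
        refine (house_mul_le _ _).trans ?_
        rw [house_natCast]
        gcongr
        exact (hξh _).trans hb
      calc _ ≤ (l.factorial : ℝ) * (C' ^ T * ((N.factorial / l.factorial : ℕ) : ℝ)) := by gcongr
        _ = ((l.factorial * (N.factorial / l.factorial) : ℕ) : ℝ) * C' ^ T := by push_cast; ring
        _ = _ := by rw [hdiv l (by omega)]
    · rw [house_zero, mul_zero]; positivity
  · rw [PowerSeries.X_pow_dvd_iff]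
    intro m hm
    rw [coeff_app_zero _ u (fun i => natDegree_ofCoeffs_le N (a i))]
    have h1 := congrArg (algebraMap (𝓞 K) K) (congrFun h0 ⟨m, hm⟩)
    rw [Matrix.mulVec, dotProduct, map_sum, Pi.zero_apply, map_zero] at h1
    have h2 : ((d M * m.factorial : ℕ) : K) ≠ 0 := by
      exact_mod_cast mul_ne_zero (hd M).1 (Nat.factorial_ne_zero _)
    have h3 : (N.factorial : K) ≠ 0 := by exact_mod_cast Nat.factorial_ne_zero _
    refine (mul_eq_zero.mp (?_ : ((d M * m.factorial : ℕ) : K) * _ = 0)).resolve_left h2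
    refine Eq.trans ?_ ((congrArg ((N.factorial : K) * ·) h1).trans (mul_zero _))
    rw [Finset.mul_sum, Finset.mul_sum]
    refine Finset.sum_congr rfl fun x _ => ?_
    rw [map_mul, hB]
    simp only [w]
    split_ifs with h
    · rw [coeff_ofCoeffs, if_pos (by omega), ha]
      have h4 : (N.factorial : K) =
          ((x.2 : ℕ).factorial : K) * ((N.factorial / (x.2 : ℕ).factorial : ℕ) : K) := by
        rw [← hdiv x.2 x.2.2]; push_cast; rw [Nat.mul_div_cancel_left _ (Nat.factorial_pos _)]
      have h5 : (m.factorial : K) = ((m.choose x.2 : ℕ) : K) * ((x.2 : ℕ).factorial : K) *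
          ((m - x.2).factorial : K) := by
        rw [← Nat.choose_mul_factorial_mul_factorial h]; push_cast; rfl
      rw [h4]
      push_cast
      rw [h5]
      ring
    · ring

end Siegel

section Estimates

open NumberField

theorem norm_mul_det_le {ρ : ℕ} (L : Matrix (Fin ρ) (Fin ρ) ℂ) (γ : Fin ρ → ℂ) {b δ : ℝ}
    (hδ : 0 < δ) (hL : ∀ h j, ‖L h j‖ ≤ b) (hr : ∀ j, δ * ‖∑ h, γ h * L h j‖ ≤ b)
    (h0 : Fin ρ) : δ * ‖γ h0‖ * ‖L.det‖ ≤ ρ.factorial * b ^ ρ := by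
  let r : Fin ρ → ℂ := ∑ k, ((δ : ℂ) * γ k) • L k
  have h1 : (L.updateRow h0 r).det = ((δ : ℂ) * γ h0) * L.det :=
    L.det_updateRow_sum h0 fun k => (δ : ℂ) * γ k
  have h2 := Matrix.det_le (A := L.updateRow h0 r) (abv := IsAbsoluteValue.toAbsoluteValue
    (norm : ℂ → ℝ)) (x := b) fun i j => by
      change ‖L.updateRow h0 r i j‖ ≤ b
      rcases eq_or_ne i h0 with rfl | hi
      · rw [Matrix.updateRow_self]
        have : r j = δ * ∑ h, γ h * L h j := by
          simp [r, Finset.mul_sum, mul_assoc]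
        rw [this, norm_mul, Complex.norm_real, Real.norm_of_nonneg hδ.le]
        exact hr j
      · rw [Matrix.updateRow_ne hi]; exact hL i j
  change ‖(L.updateRow h0 r).det‖ ≤ _ at h2
  rw [h1, norm_mul, norm_mul, Complex.norm_real, Real.norm_of_nonneg hδ.le, nsmul_eq_mul,
    Fintype.card_fin] at h2
  exact h2

variable {ι : Type} [Fintype ι]

theorem norm_coeff_app_zero_le {Q : ι → ℂ[X]} {g : ι → PowerSeries ℂ} {B C : ℝ} (hC : 1 ≤ C)
    (hB : 0 ≤ B) (hQ : ∀ i l, (l.factorial : ℝ) * ‖(Q i).coeff l‖ ≤ B)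
    (hg : ∀ i n, ‖PowerSeries.coeff n (g i)‖ ≤ C ^ (n + 1) / n.factorial) (m : ℕ) :
    ‖PowerSeries.coeff m (app 0 Q g)‖ ≤
      Fintype.card ι * B * C * ((2 * C) ^ m / m.factorial) := by
  have h1 : ∀ i, ‖PowerSeries.coeff m (sh 0 (Q i) * g i)‖ ≤
      B * C * ((2 * C) ^ m / m.factorial) := by
    intro i
    rw [sh_zero, PowerSeries.coeff_mul, Finset.Nat.sum_antidiagonal_eq_sum_range_succ_mk]
    have h2 : ∀ l ∈ Finset.range (m + 1), ‖PowerSeries.coeff l (Q i : PowerSeries ℂ) *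
        PowerSeries.coeff (m - l) (g i)‖ ≤ B * C ^ (m + 1) / m.factorial * (m.choose l) := by
      intro l hl
      rw [Polynomial.coeff_coe, norm_mul]
      have h3 := hQ i l
      have hl' : l ≤ m := by simpa [Nat.lt_succ_iff] using hl
      have h4 : (m.factorial : ℝ) = m.choose l * l.factorial * (m - l).factorial := by
        exact_mod_cast (Nat.choose_mul_factorial_mul_factorial hl').symm
      have p1 : (0 : ℝ) < l.factorial := by exact_mod_cast l.factorial_pos
      have p2 : (0 : ℝ) < (m - l).factorial := by exact_mod_cast (m - l).factorial_pos
      have p3 : (0 : ℝ) < m.choose l := by exact_mod_cast Nat.choose_pos hl'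
      have h5 : ‖(Q i).coeff l‖ ≤ B / l.factorial := by
        rw [le_div_iff₀ p1, mul_comm]; exact h3
      have h6 : ‖PowerSeries.coeff (m - l) (g i)‖ ≤ C ^ (m + 1) / (m - l).factorial := by
        refine (hg i _).trans ?_
        gcongr
        omega
      calc _ ≤ B / l.factorial * (C ^ (m + 1) / (m - l).factorial) :=
            mul_le_mul h5 h6 (norm_nonneg _) (by positivity)
        _ = _ := by rw [h4]; field_simp
    refine (norm_sum_le_of_le _ h2).trans_eq ?_
    rw [← Finset.mul_sum, ← Nat.cast_sum, Nat.sum_range_choose, mul_pow]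
    push_cast
    ring
  rw [app, map_sum]
  refine (norm_sum_le_of_le _ fun i _ => h1 i).trans_eq ?_
  rw [Finset.sum_const, Finset.card_univ, nsmul_eq_mul]; ring

/-- Size of the expansion at `1` of a linear form with high order of vanishing at `0`. -/
theorem norm_coeff_app_one_le {Q : ι → ℂ[X]} {G : ι → ℂ → ℂ} {B C : ℝ} (hC : 1 ≤ C)
    (hB : 0 ≤ B) (hG : ∀ i, Differentiable ℂ (G i))
    (hQ : ∀ i l, (l.factorial : ℝ) * ‖(Q i).coeff l‖ ≤ B)
    (hg : ∀ i n, ‖PowerSeries.coeff n (tay 0 (G i))‖ ≤ C ^ (n + 1) / n.factorial) {M : ℕ}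
    (hM : PowerSeries.X ^ M ∣ app 0 Q fun i => tay 0 (G i)) (k : ℕ) :
    ‖PowerSeries.coeff k (app 1 Q fun i => tay 1 (G i))‖ ≤
      Fintype.card ι * B * C * ((4 * C) ^ M / M.factorial) * Real.exp (4 * C) := by
  obtain ⟨R, hR⟩ : ∃ R : ℂ → ℂ, R = fun z => ∑ i, (Q i).eval z * G i z := ⟨_, rfl⟩
  have hRd : Differentiable ℂ R := hR ▸ differentiable_sum_eval_mul hG Q
  have hR0 : tay 0 R = app 0 Q fun i => tay 0 (G i) := hR ▸ tay_sum_eval_mul hG Q 0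
  have hR1 : tay 1 R = app 1 Q fun i => tay 1 (G i) := hR ▸ tay_sum_eval_mul hG Q 1
  have hbound : ∀ z ∈ Metric.sphere (1 : ℂ) 1, ‖R z‖ ≤
      Fintype.card ι * B * C * ((4 * C) ^ M / M.factorial) * Real.exp (4 * C) := by
    intro z hz
    have hz2 : ‖z‖ ≤ 2 := by
      have h1 : ‖z - 1‖ = 1 := by simpa [dist_eq_norm] using hz
      calc ‖z‖ = ‖(z - 1) + 1‖ := by rw [sub_add_cancel]
        _ ≤ ‖z - 1‖ + ‖(1 : ℂ)‖ := norm_add_le _ _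
        _ = 2 := by rw [h1, norm_one]; norm_num
    have hs := hasSum_tay hRd 0 z
    rw [hR0] at hs
    simp only [sub_zero] at hs
    rw [PowerSeries.X_pow_dvd_iff] at hM
    have hs' := (hasSum_nat_add_iff' M).mpr hs
    rw [Finset.sum_eq_zero (fun i hi => by rw [hM i (Finset.mem_range.mp hi), zero_mul]),
      sub_zero] at hs'
    have hexp : HasSum (fun m : ℕ => Fintype.card ι * B * C * ((4 * C) ^ M / M.factorial) *
        ((4 * C) ^ m / m.factorial))
        (Fintype.card ι * B * C * ((4 * C) ^ M / M.factorial) * Real.exp (4 * C)) := by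
      have := NormedSpace.expSeries_div_hasSum_exp (𝔸 := ℝ) (4 * C)
      rw [← Real.exp_eq_exp_ℝ] at this
      exact this.mul_left _
    refine hs'.norm_le_of_bounded hexp fun m => ?_
    rw [norm_mul, norm_pow]
    have h1 := norm_coeff_app_zero_le hC hB hQ hg (m + M)
    have h2 : ((m.factorial : ℝ)) * M.factorial ≤ (m + M).factorial := by
      exact_mod_cast Nat.le_of_dvd (Nat.factorial_pos _) (Nat.factorial_mul_factorial_dvd_factorial_add m M)
    have p1 : (0 : ℝ) < m.factorial := by exact_mod_cast m.factorial_pos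
    have p2 : (0 : ℝ) < M.factorial := by exact_mod_cast M.factorial_pos
    calc _ ≤ Fintype.card ι * B * C * ((2 * C) ^ (m + M) / (m + M).factorial) * 2 ^ (m + M) := by
          gcongr
      _ ≤ Fintype.card ι * B * C * ((2 * C) ^ (m + M) / (m.factorial * M.factorial)) *
          2 ^ (m + M) := by gcongr
      _ = _ := by
          rw [show (4 : ℝ) * C = (2 * C) * 2 by ring, mul_pow _ (2 : ℝ), mul_pow _ (2 : ℝ)]
          field_simp
          ring
  rw [← hR1, coeff_tay, norm_div, Complex.norm_natCast]
  have := Complex.norm_iteratedDeriv_le_of_forall_mem_sphere_norm_le k one_pos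
    hRd.diffContOnCl hbound
  rw [one_pow, div_one] at this
  rw [div_le_iff₀' (by exact_mod_cast k.factorial_pos)]
  exact this

variable {K : Type*} [Field K] [NumberField K]

theorem coeff_sh (c : K) (p : K[X]) {N : ℕ} (hp : p.natDegree ≤ N) (a : ℕ) :
    PowerSeries.coeff a (sh c p) =
      ∑ l ∈ Finset.range (N + 1), p.coeff l * c ^ (l - a) * (l.choose a : ℕ) := by
  rw [sh_apply, Polynomial.coeff_coe, Polynomial.taylor_coeff, Polynomial.hasseDeriv_apply,
    Polynomial.sum_over_range' _ _ (N + 1) (by omega)]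
  · rw [Polynomial.eval_finsetSum]
    refine Finset.sum_congr rfl fun l _ => ?_
    rw [Polynomial.eval_monomial]; ring
  · simp

theorem isIntegral_coeff_app_one {P : ι → K[X]} {y : ι → PowerSeries K} {N k : ℕ} {π : K}
    {B E : ℝ} (hN : ∀ i, (P i).natDegree ≤ N) (hP : ∀ i l, IsIntegral ℤ ((P i).coeff l))
    (hB : ∀ i l, house ((P i).coeff l) ≤ B)
    (hy : ∀ i, ∀ s ≤ k, IsIntegral ℤ (π * PowerSeries.coeff s (y i)) ∧
      house (π * PowerSeries.coeff s (y i)) ≤ E) :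
    IsIntegral ℤ (π * PowerSeries.coeff k (app 1 P y)) ∧
      house (π * PowerSeries.coeff k (app 1 P y)) ≤
        Fintype.card ι * ((k + 1) * ((N + 1) * (B * 2 ^ N) * E)) := by
  have hsh : ∀ i a, IsIntegral ℤ (PowerSeries.coeff a (sh 1 (P i))) ∧
      house (PowerSeries.coeff a (sh 1 (P i))) ≤ (N + 1) * (B * 2 ^ N) := by
    intro i a
    rw [coeff_sh 1 (P i) (hN i)]
    constructor
    · refine IsIntegral.sum _ fun l _ => ?_
      rw [one_pow, mul_one]
      exact (hP i l).mul (isIntegral_natCast _)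
    · refine (house_sum_le_sum_house _ _).trans ?_
      have : ∀ l ∈ Finset.range (N + 1),
          house ((P i).coeff l * 1 ^ (l - a) * ((l.choose a : ℕ) : K)) ≤ B * 2 ^ N := by
        intro l hl
        rw [one_pow, mul_one]
        refine (house_mul_le _ _).trans (mul_le_mul (hB i l) ?_ (house_nonneg _)
          ((house_nonneg _).trans (hB i l)))
        rw [house_natCast]
        exact_mod_cast (Nat.choose_le_two_pow _ _).trans (Nat.pow_le_pow_right two_pos
          (by simpa [Nat.lt_succ_iff] using hl))
      refine (Finset.sum_le_sum this).trans_eq ?_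
      rw [Finset.sum_const, Finset.card_range, nsmul_eq_mul]; push_cast; ring
  have hterm : ∀ i, ∀ a ≤ k, IsIntegral ℤ (PowerSeries.coeff a (sh 1 (P i)) *
      (π * PowerSeries.coeff (k - a) (y i))) ∧ house (PowerSeries.coeff a (sh 1 (P i)) *
      (π * PowerSeries.coeff (k - a) (y i))) ≤ (N + 1) * (B * 2 ^ N) * E := fun i a _ =>
    ⟨(hsh i a).1.mul (hy i _ (Nat.sub_le _ _)).1, (house_mul_le _ _).trans
      (mul_le_mul (hsh i a).2 (hy i _ (Nat.sub_le _ _)).2 (house_nonneg _)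
        ((house_nonneg _).trans (hsh i a).2))⟩
  have hexp : π * PowerSeries.coeff k (app 1 P y) = ∑ i, ∑ a ∈ Finset.range (k + 1),
      PowerSeries.coeff a (sh 1 (P i)) * (π * PowerSeries.coeff (k - a) (y i)) := by
    rw [app, map_sum, Finset.mul_sum]
    refine Finset.sum_congr rfl fun i _ => ?_
    rw [PowerSeries.coeff_mul, Finset.Nat.sum_antidiagonal_eq_sum_range_succ_mk, Finset.mul_sum]
    exact Finset.sum_congr rfl fun a _ => by ring
  rw [hexp]
  constructor
  · exact IsIntegral.sum _ fun i _ => IsIntegral.sum _ fun a ha =>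
      (hterm i a (by simpa [Nat.lt_succ_iff] using ha)).1
  · refine (house_sum_le_sum_house _ _).trans ?_
    refine (Finset.sum_le_sum (fun i _ => (house_sum_le_sum_house _ _).trans
      (Finset.sum_le_sum fun a ha =>
        (hterm i a (by simpa [Nat.lt_succ_iff] using ha)).2))).trans_eq ?_
    rw [Finset.sum_const, Finset.sum_const, Finset.card_range, Finset.card_univ, nsmul_eq_mul,
      nsmul_eq_mul]
    push_cast; ring

end Estimates

section Geometric

/-- Nonnegative functions of at most geometric growth. -/
def Geo (f : ℕ → ℝ) : Prop := ∃ C : ℝ, 1 ≤ C ∧ ∀ T : ℕ, 1 ≤ T → 0 ≤ f T ∧ f T ≤ C ^ T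

theorem Geo.mul {f g : ℕ → ℝ} (hf : Geo f) (hg : Geo g) : Geo fun T => f T * g T := by
  obtain ⟨C, hC, h⟩ := hf
  obtain ⟨C', hC', h'⟩ := hg
  refine ⟨C * C', one_le_mul_of_one_le_of_one_le hC hC', fun T hT =>
    ⟨mul_nonneg (h T hT).1 (h' T hT).1, ?_⟩⟩
  rw [mul_pow]
  exact mul_le_mul (h T hT).2 (h' T hT).2 (h' T hT).1 (by positivity)

theorem Geo.pow {f : ℕ → ℝ} (hf : Geo f) (k : ℕ) : Geo fun T => f T ^ k := by
  obtain ⟨C, hC, h⟩ := hf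
  refine ⟨C ^ k, one_le_pow₀ hC, fun T hT => ⟨pow_nonneg (h T hT).1 _, ?_⟩⟩
  rw [← pow_mul, mul_comm, pow_mul]
  exact pow_le_pow_left₀ (h T hT).1 (h T hT).2 k

theorem Geo.const {a : ℝ} (ha : 0 ≤ a) : Geo fun _ => a := by
  refine ⟨max 1 a, le_max_left _ _, fun T hT => ⟨ha, ?_⟩⟩
  exact (le_max_right 1 a).trans (le_self_pow₀ (le_max_left 1 a) (by omega))

theorem Geo.linear (a b : ℕ) : Geo fun T => ((a * T + b : ℕ) : ℝ) := by
  have h2 : Geo fun T => 2 ^ T := ⟨2, one_le_two, fun T _ => ⟨by positivity, le_rfl⟩⟩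
  obtain ⟨C, hC, h⟩ := (Geo.const (a := (a + b : ℕ)) (Nat.cast_nonneg _)).mul h2
  refine ⟨C, hC, fun T hT => ⟨Nat.cast_nonneg _, le_trans ?_ (h T hT).2⟩⟩
  have : a * T + b ≤ (a + b) * 2 ^ T := by
    have := (Nat.lt_two_pow_self (n := T)).le
    nlinarith [Nat.mul_le_mul_left a this, Nat.mul_le_mul_left b (hT.trans this)]
  change ((a * T + b : ℕ) : ℝ) ≤ ((a + b : ℕ) : ℝ) * 2 ^ T
  exact_mod_cast this

theorem Geo.exp {a : ℝ} (ha : 1 ≤ a) (k l : ℕ) : Geo fun T => a ^ (k * T + l) := by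
  obtain ⟨C, hC, h⟩ := (Geo.const (a := a ^ l) (by positivity)).mul
    (⟨a ^ k, one_le_pow₀ ha, fun T _ => ⟨by positivity, le_rfl⟩⟩ : Geo fun T => (a ^ k) ^ T)
  refine ⟨C, hC, fun T hT => ⟨by positivity, (h T hT).2.trans_eq' ?_⟩⟩
  change a ^ l * (a ^ k) ^ T = a ^ (k * T + l)
  rw [pow_add, pow_mul, mul_comm]

theorem factorial_add_le (T l : ℕ) : (T + l).factorial ≤ T.factorial * (T + l) ^ l := by
  rw [← Nat.factorial_mul_ascFactorial]
  exact Nat.mul_le_mul_left _ (Nat.ascFactorial_le_pow_add _ _)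

theorem exists_pow_lt_factorial (a C : ℝ) (T₀ : ℕ) : ∃ T ≥ T₀, a * C ^ T < T.factorial := by
  have h := (FloorSemiring.tendsto_pow_div_factorial_atTop C).const_mul a
  rw [mul_zero] at h
  obtain ⟨T, h1, h2⟩ := ((h.eventually_lt_const one_pos).and
    (Filter.eventually_ge_atTop T₀)).exists
  refine ⟨T, h2, ?_⟩
  rw [← mul_div_assoc, div_lt_one (by exact_mod_cast T.factorial_pos)] at h1
  exact h1

end Geometric

section Rank

variable {F : Type*} [Field F] [CharZero F] {ι : Type} [Fintype ι]

theorem exists_linearIndependent_coeff [Nonempty ι] {t : F[X]} (ht : t ≠ 0)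
    {A : ι → ι → F[X]} {u : ι → PowerSeries F} (hu : IsSol 0 t A u)
    (hli : ∀ P : ι → F[X], app 0 P u = 0 → P = 0) {κ : Type*} [Fintype κ]
    {y : κ → ι → PowerSeries F} (hy : ∀ h, IsSol 1 t A (y h)) (hLI : LinearIndependent F y) :
    ∃ c : ℕ, ∀ (N M : ℕ) (P : ι → F[X]), P ≠ 0 → (∀ i, (P i).natDegree ≤ N) →
      PowerSeries.X ^ M ∣ app 0 P u → (Fintype.card ι - 1) * N + c ≤ M →
      LinearIndependent F (fun h (k : Fin (Fintype.card ι * N + c + 1 - M)) =>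
        PowerSeries.coeff k (app 1 P (y h))) := by
  classical
  have hu0 : ∀ i, u i ≠ 0 := by
    intro i hi
    have h1 := hli (Pi.single i 1) (by
      rw [app, Finset.sum_eq_single i]
      · simp [hi]
      · intro j _ hj; simp [hj]
      · simp)
    have := congrFun h1 i
    simp at this
  obtain ⟨c₁, h₁⟩ := shidlovskii ht hu hli
  choose c₂ h₂ using fun i => order_le_of_linearIndependent hu (hu0 i)
  let φ : (κ → F) →ₗ[F] (ι → PowerSeries F) := Fintype.linearCombination F y
  have hφ : ∀ a, φ a = ∑ h, a h • y h := fun a => Fintype.linearCombination_apply F y a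
  obtain ⟨c₃, h₃⟩ := exists_order_bound φ (by
    rw [← LinearMap.ker_eq_bot, LinearMap.ker_eq_bot']
    intro a ha
    rw [hφ] at ha
    funext h
    exact Fintype.linearIndependent_iff.mp hLI a ha h)
  have hc₂ : ∀ i, c₂ i ≤ ∑ i, c₂ i := fun i =>
    Finset.single_le_sum (fun _ _ => Nat.zero_le _) (Finset.mem_univ i)
  refine ⟨c₁ + ∑ i, c₂ i + c₃, fun N M P hP hN hX hM => ?_⟩
  rw [Fintype.linearIndependent_iff]
  intro a ha
  have ha0 : a = 0 := by
    apply h₃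
    by_contra! hcon
    obtain ⟨i, hi⟩ := hcon
    have hsol : IsSol 1 t A (φ a) := by
      rw [hφ]
      exact (solSpace 1 t A).sum_mem fun h _ => (hy h).smul (a h)
    have hdvd : PowerSeries.X ^ (Fintype.card ι * N + (c₁ + ∑ i, c₂ i + c₃) + 1 - M) ∣
        app 1 P (φ a) := by
      rw [PowerSeries.X_pow_dvd_iff]
      intro k hk
      have h4 := congrFun ha ⟨k, hk⟩
      rw [hφ]
      have : app 1 P (∑ h, a h • y h) = ∑ h, a h • app 1 P (y h) := by
        change appHom 1 P _ = _
        rw [map_sum]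
        exact Finset.sum_congr rfl fun h _ => app_smul_right _ _ _ _
      rw [this, map_sum]
      simpa [Finset.sum_apply] using h4
    have := h₂ i (φ a) hsol c₃ hi N M P hN hX
      (h₁ N P hP hN ((pow_dvd_pow _ (by omega)).trans hX)) _ hdvd
    have := hc₂ i
    omega
  exact fun h => congrFun ha0 h

end Rank

section Matrix

open NumberField

variable {K : Type*} [Field K] [NumberField K] [Algebra K ℂ] {ι : Type} [Fintype ι]

theorem exists_matrix_estimate [Nonempty ι] {t : K[X]} (ht : t ≠ 0)
    {A : ι → ι → K[X]} {u : ι → PowerSeries K} (hE : ∀ i, EType (u i)) (hu : IsSol 0 t A u)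
    (hli : ∀ P : ι → K[X], app 0 P u = 0 → P = 0) {G : ι → ℂ → ℂ}
    (hG : ∀ i, Differentiable ℂ (G i))
    (hGu : ∀ i, tay 0 (G i) = PowerSeries.map (algebraMap K ℂ) (u i))
    {ρ : ℕ} {γ : Fin ρ → ℂ} {y : Fin ρ → ι → PowerSeries K} (hy : ∀ h, IsSol 1 t A (y h))
    (hLI : LinearIndependent K y) (hdec : ∀ i, tay 1 (G i) =
      ∑ h, PowerSeries.C (γ h) * PowerSeries.map (algebraMap K ℂ) (y h i)) :
    ∃ D : ℕ, ∀ H : ℕ, 2 ≤ H → ∃ C : ℝ, 1 ≤ C ∧ ∃ T₀ : ℕ, ∀ T ≥ T₀,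
      ∃ L : Matrix (Fin ρ) (Fin ρ) K, L.det ≠ 0 ∧ (∀ h j, IsIntegral ℤ (L h j) ∧
        house (L h j) ≤ (H * T).factorial * C ^ T * (T.factorial : ℝ) ^ D) ∧
        ∀ j, (((Fintype.card ι * H - 1) * T).factorial : ℝ) *
          ‖∑ h, γ h * algebraMap K ℂ (L h j)‖ ≤
            (H * T).factorial * C ^ T * (T.factorial : ℝ) ^ D := by
  obtain ⟨c, hc⟩ := exists_linearIndependent_coeff ht hu hli hy hLI
  obtain ⟨E, D, hE1, hgrow⟩ := Grow.exists_uniform (σ := Fin ρ × ι) (y := fun x => y x.1 x.2)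
    fun x => (hy x.1).grow ht x.2
  choose C₀ hC₀ hnorm using fun i => (hE i).norm_le (algebraMap K ℂ)
  obtain ⟨C₁, hC₁, hC₀₁⟩ : ∃ C₁ : ℝ, 1 ≤ C₁ ∧ ∀ i, C₀ i ≤ C₁ := by
    classical
    refine ⟨∏ i, C₀ i, Finset.one_le_prod fun i _ => hC₀ i, fun i => ?_⟩
    rw [← Finset.mul_prod_erase _ _ (Finset.mem_univ i)]
    exact le_mul_of_one_le_right (zero_le_one.trans (hC₀ i))
      (Finset.one_le_prod fun i _ => hC₀ i)
  have hnorm' : ∀ i n, ‖PowerSeries.coeff n (tay 0 (G i))‖ ≤ C₁ ^ (n + 1) / n.factorial := by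
    intro i n
    rw [hGu, PowerSeries.coeff_map]
    refine (hnorm i n).trans ?_
    have := hC₀ i
    have := hC₀₁ i
    gcongr
  refine ⟨D, fun H hH => ?_⟩
  obtain ⟨C, hC, hS⟩ := exists_siegel_form hE H hH
  have hnH : 2 ≤ Fintype.card ι * H := by nlinarith [Fintype.card_pos (α := ι)]
  -- common factor of both bounds
  have hE' : Geo fun T => E ^ (1 * T + (c + 1)) * (((1 * T + (c + 1) : ℕ) : ℝ) ^ (c + 1)) ^ D :=
    (Geo.exp hE1 _ _).mul (((Geo.linear 1 (c + 1)).pow _).pow _)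
  have hCT : Geo fun T => C ^ T := ⟨C, hC, fun T _ => ⟨by positivity, le_rfl⟩⟩
  obtain ⟨B₁, hB₁, h₁⟩ := ((((Geo.const (a := Fintype.card ι) (Nat.cast_nonneg _)).mul
    (Geo.linear 1 (c + 1))).mul (Geo.linear H 1)).mul (Geo.exp one_le_two H 0)).mul (hCT.mul hE')
  obtain ⟨B₂, hB₂, h₂⟩ := ((Geo.const (a := Fintype.card ι * C₁ * Real.exp (4 * C₁))
    (by positivity)).mul
    (Geo.exp (a := 4 * C₁) (by linarith) (Fintype.card ι * H - 1) 0)).mul (hCT.mul hE')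
  refine ⟨max B₁ B₂, hB₁.trans (le_max_left _ _), max c 1, fun T hT => ?_⟩
  have hT1 : 1 ≤ T := (le_max_right _ _).trans hT
  have hTc : c ≤ T := (le_max_left _ _).trans hT
  have h₁ := (h₁ T hT1).2
  have h₂ := (h₂ T hT1).2
  simp only [one_mul, add_zero] at h₁ h₂
  obtain ⟨P, hP0, hPN, hPi, hPh, hPX⟩ := hS T hT1
  obtain ⟨π, hπ0, hπi, hπh, hπy⟩ := hgrow (T + c)
  have hLIc := hc (H * T) _ P hP0 hPN hPX (by
    have h1 : (Fintype.card ι * H - 1) * T + T = Fintype.card ι * H * T := by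
      rw [← Nat.succ_mul]; congr 1; omega
    have h2 : (Fintype.card ι - 1) * (H * T) + H * T = Fintype.card ι * H * T := by
      rw [← Nat.succ_mul, ← mul_assoc]; congr 2
      have := Fintype.card_pos (α := ι); omega
    have h3 : 2 * T ≤ H * T := Nat.mul_le_mul_right _ hH
    omega)
  have hk : Fintype.card ι * (H * T) + c + 1 - (Fintype.card ι * H - 1) * T = T + c + 1 := by
    have h1 : (Fintype.card ι * H - 1) * T + T = Fintype.card ι * H * T := by
      rw [← Nat.succ_mul]; congr 1; omega
    rw [← mul_assoc]; omega
  rw [hk] at hLIc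
  obtain ⟨e, he⟩ := exists_minor_ne_zero hLIc
  have hfac : E ^ (T + c + 1) * ((T + c + 1).factorial : ℝ) ^ D ≤
      E ^ (T + (c + 1)) * (((T + (c + 1) : ℕ) : ℝ) ^ (c + 1)) ^ D * (T.factorial : ℝ) ^ D := by
    rw [add_assoc, mul_assoc, ← mul_pow]
    gcongr
    rw [mul_comm]
    exact_mod_cast factorial_add_le T (c + 1)
  have hPh' : ∀ i l, house ((P i).coeff l) ≤ (H * T).factorial * C ^ T := fun i l =>
    (le_mul_of_one_le_left (house_nonneg _) (by exact_mod_cast l.factorial_pos)).trans (hPh i l)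
  refine ⟨Matrix.of fun h j => π * PowerSeries.coeff (e j) (app 1 P (y h)), ?_, fun h j => ?_,
    fun j => ?_⟩
  · have : (Matrix.of fun h j => π * PowerSeries.coeff (e j) (app 1 P (y h))) =
        π • Matrix.of fun h j => PowerSeries.coeff (e j) (app 1 P (y h)) := by
      ext; simp
    rw [this, Matrix.det_smul]
    exact mul_ne_zero (pow_ne_zero _ hπ0) he
  · have hej := (e j).2
    have := isIntegral_coeff_app_one (k := e j) (π := π) (y := y h) hPN hPi hPh'
      (E := E ^ (T + c + 1) * ((T + c + 1).factorial : ℝ) ^ D)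
      (fun i s hs => hπy (h, i) s (by omega))
    refine ⟨this.1, this.2.trans ?_⟩
    calc _ ≤ (Fintype.card ι : ℝ) * (((T + (c + 1) : ℕ) : ℝ) * (((H * T : ℕ) + 1) *
          ((H * T).factorial * C ^ T * 2 ^ (H * T)) *
          (E ^ (T + (c + 1)) * (((T + (c + 1) : ℕ) : ℝ) ^ (c + 1)) ^ D *
            (T.factorial : ℝ) ^ D))) := by
          gcongr
          exact_mod_cast (by omega : (e j : ℕ) + 1 ≤ T + (c + 1))
      _ = (H * T).factorial * ((Fintype.card ι : ℝ) * ((T + (c + 1) : ℕ) : ℝ) *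
          ((H * T + 1 : ℕ) : ℝ) * 2 ^ (H * T) *
          (C ^ T * (E ^ (T + (c + 1)) * (((T + (c + 1) : ℕ) : ℝ) ^ (c + 1)) ^ D))) *
            (T.factorial : ℝ) ^ D := by push_cast; ring
      _ ≤ _ := by
          gcongr
          exact h₁.trans (by gcongr; exact le_max_left _ _)
  · have happ : ∀ h, algebraMap K ℂ (PowerSeries.coeff (e j) (app 1 P (y h))) =
        PowerSeries.coeff (e j) (app 1 (fun i => (P i).map (algebraMap K ℂ))
          fun i => PowerSeries.map (algebraMap K ℂ) (y h i)) := fun h => by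
      rw [← PowerSeries.coeff_map, map_app, map_one]
    have hsum : ∑ h, γ h * algebraMap K ℂ (π * PowerSeries.coeff (e j) (app 1 P (y h))) =
        algebraMap K ℂ π * PowerSeries.coeff (e j)
          (app 1 (fun i => (P i).map (algebraMap K ℂ)) fun i => tay 1 (G i)) := by
      simp only [map_mul, happ]
      simp only [app, hdec, map_sum, Finset.mul_sum]
      rw [Finset.sum_comm]
      refine Finset.sum_congr rfl fun i _ => Finset.sum_congr rfl fun h _ => ?_
      rw [mul_left_comm (sh 1 _), PowerSeries.coeff_C_mul]
      ring
    have hX : PowerSeries.X ^ ((Fintype.card ι * H - 1) * T) ∣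
        app 0 (fun i => (P i).map (algebraMap K ℂ)) fun i => tay 0 (G i) := by
      obtain ⟨q, hq⟩ := hPX
      refine ⟨PowerSeries.map (algebraMap K ℂ) q, ?_⟩
      simp only [hGu]
      rw [← map_zero (algebraMap K ℂ), ← map_app, hq, map_mul, map_pow, PowerSeries.map_X]
    have hrem := norm_coeff_app_one_le hC₁ (B := (H * T).factorial * C ^ T) (by positivity) hG
      (fun i l => by
        rw [Polynomial.coeff_map]
        exact (mul_le_mul_of_nonneg_left (norm_embedding_le_house _ _)
          (Nat.cast_nonneg _)).trans (hPh i l)) hnorm' hX (e j)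
    simp only [Matrix.of_apply]
    rw [hsum, norm_mul]
    have hπn := ((norm_embedding_le_house π (algebraMap K ℂ)).trans hπh).trans hfac
    have pM : (0 : ℝ) < ((Fintype.card ι * H - 1) * T).factorial := by
      exact_mod_cast Nat.factorial_pos _
    calc _ ≤ (((Fintype.card ι * H - 1) * T).factorial : ℝ) *
          ((E ^ (T + (c + 1)) * (((T + (c + 1) : ℕ) : ℝ) ^ (c + 1)) ^ D * (T.factorial : ℝ) ^ D) *
          (Fintype.card ι * ((H * T).factorial * C ^ T) * C₁ *
            ((4 * C₁) ^ ((Fintype.card ι * H - 1) * T) /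
              ((Fintype.card ι * H - 1) * T).factorial) * Real.exp (4 * C₁))) := by
          gcongr
      _ = (H * T).factorial * (Fintype.card ι * C₁ * Real.exp (4 * C₁) *
          (4 * C₁) ^ ((Fintype.card ι * H - 1) * T) *
          (C ^ T * (E ^ (T + (c + 1)) * (((T + (c + 1) : ℕ) : ℝ) ^ (c + 1)) ^ D))) *
            (T.factorial : ℝ) ^ D := by field_simp
      _ ≤ _ := by
          gcongr
          exact h₂.trans (by gcongr; exact le_max_right _ _)

end Matrix

section Rank

open NumberField

variable {K : Type*} [Field K] [NumberField K]

theorem house_det_le {ρ : ℕ} (L : Matrix (Fin ρ) (Fin ρ) K) {b : ℝ}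
    (hL : ∀ h j, house (L h j) ≤ b) : house L.det ≤ ρ.factorial * b ^ ρ := by
  refine house_le_of_forall fun σ => ?_
  have := Matrix.det_le (A := L.map σ)
    (abv := IsAbsoluteValue.toAbsoluteValue (norm : ℂ → ℝ)) (x := b)
    fun h j => (norm_embedding_le_house (L h j) σ).trans (hL h j)
  rw [Fintype.card_fin, nsmul_eq_mul] at this
  rw [RingHom.map_det]
  exact this

theorem one_le_norm_mul_house_pow {α : K} (hα : IsIntegral ℤ α) (h0 : α ≠ 0) (σ : K →+* ℂ) :
    1 ≤ ‖σ α‖ * house α ^ (Module.finrank ℚ K - 1) := by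
  refine le_trans ?_ (norm_norm_le_norm_mul_house_pow α σ)
  obtain ⟨m, hm⟩ := IsIntegrallyClosed.isIntegral_iff.mp (Algebra.isIntegral_norm ℚ hα)
  have hm0 : m ≠ 0 := by
    rintro rfl
    rw [map_zero] at hm
    exact h0 (Algebra.norm_eq_zero_iff.mp hm.symm)
  rw [← hm, eq_intCast, Int.norm_cast_rat, Int.norm_eq_abs]
  exact_mod_cast Int.one_le_abs hm0

variable [Algebra K ℂ] {ι : Type} [Fintype ι]

theorem card_le_finrank_mul {t : K[X]} (ht : t ≠ 0)
    {A : ι → ι → K[X]} {u : ι → PowerSeries K} (hE : ∀ i, EType (u i)) (hu : IsSol 0 t A u)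
    (hli : ∀ P : ι → K[X], app 0 P u = 0 → P = 0) {G : ι → ℂ → ℂ}
    (hG : ∀ i, Differentiable ℂ (G i))
    (hGu : ∀ i, tay 0 (G i) = PowerSeries.map (algebraMap K ℂ) (u i))
    {ρ : ℕ} {γ : Fin ρ → ℂ} {y : Fin ρ → ι → PowerSeries K} (hy : ∀ h, IsSol 1 t A (y h))
    (hγ : LinearIndependent K γ) (hLI : LinearIndependent K y) (hdec : ∀ i, tay 1 (G i) =
      ∑ h, PowerSeries.C (γ h) * PowerSeries.map (algebraMap K ℂ) (y h i)) :
    Fintype.card ι ≤ Module.finrank ℚ K * ρ := by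
  classical
  rcases isEmpty_or_nonempty ι with hι | hι
  · simp
  by_contra! hcon
  have hρ : 0 < ρ := by
    rw [Nat.pos_iff_ne_zero]
    rintro rfl
    obtain ⟨i⟩ := hι
    have h0 : G i = fun _ => 0 := by
      refine eq_of_tay_eq (hG i) (differentiable_const 0) (c := 1) ?_
      rw [hdec, tay_const]
      simp
    have hu0 : u i = 0 := by
      apply PowerSeries.map_injective _ (algebraMap K ℂ).injective
      rw [← hGu, h0, tay_const]
      simp
    have := congrFun (hli (Pi.single i 1) (by
      rw [app, Finset.sum_eq_single i]
      · simp [hu0]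
      · intro j _ hj; simp [hj]
      · simp)) i
    simp at this
  obtain ⟨n', hn'⟩ : ∃ n', Fintype.card ι = n' + 1 := ⟨_, (Nat.succ_pred_eq_of_pos
    Fintype.card_pos).symm⟩
  obtain ⟨D, hD⟩ := exists_matrix_estimate ht hE hu hli hG hGu hy hLI hdec
  obtain ⟨C, hC, T₀, hT₀⟩ := hD (D * n' + 2) (by omega)
  obtain ⟨h0⟩ : Nonempty (Fin ρ) := ⟨⟨0, hρ⟩⟩
  have hγ0 : 0 < ‖γ h0‖ := norm_pos_iff.mpr (hγ.ne_zero h0)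
  obtain ⟨T, hT, hlt⟩ := exists_pow_lt_factorial
    ((ρ.factorial : ℝ) ^ Module.finrank ℚ K / ‖γ h0‖) (C ^ n') T₀
  obtain ⟨L, hdet, hL, hrem⟩ := hT₀ T hT
  obtain ⟨M, hM⟩ : ∃ M, M = (Fintype.card ι * (D * n' + 2) - 1) * T := ⟨_, rfl⟩
  obtain ⟨N, hN⟩ : ∃ N, N = (D * n' + 2) * T := ⟨_, rfl⟩
  obtain ⟨b, hb⟩ : ∃ b, b = (N.factorial : ℝ) * C ^ T * (T.factorial : ℝ) ^ D := ⟨_, rfl⟩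
  rw [← hN, ← hb] at hL
  rw [← hM, ← hN, ← hb] at hrem
  have hMN : N * n' + T * (D * n' + 1) = M := by
    rw [hM, hN, hn']
    have : (n' + 1) * (D * n' + 2) - 1 = (D * n' + 2) * n' + (D * n' + 1) := 
      Nat.sub_eq_of_eq_add (by ring)
    rw [this]; ring
  have pf : ∀ k : ℕ, (1 : ℝ) ≤ k.factorial := fun k => by exact_mod_cast k.factorial_pos
  have hb1 : 1 ≤ b := by
    rw [hb]
    exact one_le_mul_of_one_le_of_one_le (one_le_mul_of_one_le_of_one_le (pf _)
      (one_le_pow₀ hC)) (one_le_pow₀ (pf _))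
  have hMf : (N.factorial : ℝ) ^ n' * (T.factorial : ℝ) ^ (D * n' + 1) ≤ M.factorial := by
    have h1 : ∀ a k : ℕ, a.factorial ^ k ∣ (a * k).factorial := fun a k => by
      simpa [mul_comm] using Nat.prod_factorial_dvd_factorial_sum (Finset.range k) fun _ => a
    have := Nat.le_of_dvd (Nat.factorial_pos _) ((mul_dvd_mul (h1 N n') (h1 T (D * n' + 1))).trans
      (Nat.factorial_mul_factorial_dvd_factorial_add _ _))
    rw [hMN] at this
    exact_mod_cast this
  have hInt : IsIntegral ℤ L.det := IsIntegral.det fun i j => (hL i j).1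
  have hhouse : house L.det ≤ ρ.factorial * b ^ ρ := house_det_le L fun h j => (hL h j).2
  have hsmall := norm_mul_det_le (L.map (algebraMap K ℂ)) γ (b := b) (δ := M.factorial)
    (by have := pf M; linarith)
    (fun h j => (norm_embedding_le_house (L h j) (algebraMap K ℂ)).trans (hL h j).2)
    hrem h0
  rw [← RingHom.mapMatrix_apply, ← RingHom.map_det] at hsmall
  have hone := one_le_norm_mul_house_pow hInt hdet (algebraMap K ℂ)
  have hd : 1 ≤ Module.finrank ℚ K := Module.finrank_pos
  have hfin : (M.factorial : ℝ) * ‖γ h0‖ ≤ (ρ.factorial * b ^ ρ) ^ Module.finrank ℚ K := by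
    calc (M.factorial : ℝ) * ‖γ h0‖ ≤ M.factorial * ‖γ h0‖ *
          (‖algebraMap K ℂ L.det‖ * house L.det ^ (Module.finrank ℚ K - 1)) :=
          le_mul_of_one_le_right (by positivity) hone
      _ = (M.factorial * ‖γ h0‖ * ‖algebraMap K ℂ L.det‖) *
          house L.det ^ (Module.finrank ℚ K - 1) := by ring
      _ ≤ (ρ.factorial * b ^ ρ) * (ρ.factorial * b ^ ρ) ^ (Module.finrank ℚ K - 1) := by
          gcongr
          · exact pow_nonneg (house_nonneg _) _
          · exact house_nonneg _
      _ = _ := by rw [← pow_succ']; congr 1; omega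
  have hfin' : (M.factorial : ℝ) * ‖γ h0‖ ≤ (ρ.factorial : ℝ) ^ Module.finrank ℚ K *
      ((N.factorial : ℝ) ^ n' * (C ^ n') ^ T * (T.factorial : ℝ) ^ (D * n')) := by
    refine hfin.trans ?_
    rw [mul_pow, ← pow_mul]
    have : b ^ (ρ * Module.finrank ℚ K) ≤ b ^ n' := pow_le_pow_right₀ hb1 (by
      rw [mul_comm]; omega)
    have h2 : b ^ n' = (N.factorial : ℝ) ^ n' * (C ^ n') ^ T * (T.factorial : ℝ) ^ (D * n') := by
      rw [hb]; ring
    rw [← h2]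
    gcongr
  rw [div_mul_eq_mul_div, div_lt_iff₀ hγ0] at hlt
  have pN : (0 : ℝ) < (N.factorial : ℝ) ^ n' * (T.factorial : ℝ) ^ (D * n') := by positivity
  have := mul_lt_mul_of_pos_left hlt pN
  have h3 := mul_le_mul_of_nonneg_right hMf hγ0.le
  rw [pow_succ] at h3
  nlinarith
end Rank

section Decomposition

variable {K : Type*} [Field K] [Algebra K ℂ] {ι : Type*} [Fintype ι]

theorem sum_mul_eq_zero_of_decomposition {ρ : ℕ} {γ : Fin ρ → ℂ}
    {y : Fin ρ → ι → PowerSeries K} (hγ : LinearIndependent K γ) {g : ι → PowerSeries ℂ}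
    (hdec : ∀ i, g i = ∑ h, PowerSeries.C (γ h) * PowerSeries.map (algebraMap K ℂ) (y h i))
    {e : ι → PowerSeries K} (he : ∑ i, PowerSeries.map (algebraMap K ℂ) (e i) * g i = 0)
    (h : Fin ρ) : ∑ i, e i * y h i = 0 := by
  have key : ∑ h, PowerSeries.C (γ h) *
      PowerSeries.map (algebraMap K ℂ) (∑ i, e i * y h i) = 0 := by
    rw [← he]
    simp only [hdec, map_sum, map_mul, Finset.mul_sum]
    rw [Finset.sum_comm]
    exact Finset.sum_congr rfl fun i _ => Finset.sum_congr rfl fun h _ => by ring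
  ext k
  have := congrArg (PowerSeries.coeff k) key
  rw [map_sum] at this
  simp only [PowerSeries.coeff_C_mul, PowerSeries.coeff_map] at this
  rw [map_zero]
  refine Fintype.linearIndependent_iff.mp hγ (fun h => PowerSeries.coeff k (∑ i, e i * y h i)) ?_ h
  rw [map_zero] at this
  rw [← this]
  exact Finset.sum_congr rfl fun h _ => by rw [Algebra.smul_def, mul_comm]

end Decomposition

section Relations

open NumberField

variable {K : Type*} [Field K] [NumberField K] [Algebra K ℂ] {ι : Type} [Fintype ι]

/-- `G` is a family of entire functions with linearly independent Taylor series `u` of `E`-type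
over `K` satisfying the first-order system `t y' = A y`. -/
structure System (t : K[X]) (A : ι → ι → K[X]) (u : ι → PowerSeries K) (G : ι → ℂ → ℂ) :
    Prop where
  ne_zero : t ≠ 0
  eType : ∀ i, EType (u i)
  isSol : IsSol 0 t A u
  indep : ∀ P : ι → K[X], app 0 P u = 0 → P = 0
  differentiable : ∀ i, Differentiable ℂ (G i)
  tay_zero : ∀ i, tay 0 (G i) = PowerSeries.map (algebraMap K ℂ) (u i)

variable {t : K[X]} {A : ι → ι → K[X]} {u : ι → PowerSeries K} {G : ι → ℂ → ℂ}

theorem System.isSol_tay (S : System t A u G) (c : ℂ) :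
    IsSol c (t.map (algebraMap K ℂ)) (fun i k => (A i k).map (algebraMap K ℂ))
      fun i => tay c (G i) := by
  refine EFun.isSol_tay S.differentiable (c := 0) ?_ c
  simp only [S.tay_zero]
  have := S.isSol.map (algebraMap K ℂ)
  rwa [map_zero] at this

theorem System.exists_decomposition (S : System t A u G) :
    ∃ (ρ : ℕ) (γ : Fin ρ → ℂ) (y : Fin ρ → ι → PowerSeries K), LinearIndependent K γ ∧
      LinearIndependent K y ∧ (∀ h, IsSol 1 t A (y h)) ∧
      (∀ i, tay 1 (G i) =
        ∑ h, PowerSeries.C (γ h) * PowerSeries.map (algebraMap K ℂ) (y h i)) ∧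
      Fintype.card ι ≤ Module.finrank ℚ K * ρ := by
  obtain ⟨ρ, γ, y, h1, h2, h3, h4⟩ := EFun.exists_decomposition (c := 1) S.ne_zero
    (A := A) (g := fun i => tay 1 (G i)) (by rw [map_one]; exact S.isSol_tay 1)
  exact ⟨ρ, γ, y, h1, h2, h3, h4, card_le_finrank_mul S.ne_zero S.eType S.isSol S.indep
    S.differentiable S.tay_zero h3 h1 h2 h4⟩

theorem System.card_relations_le (S : System t A u G) {κ : Type*} [Fintype κ]
    {e : κ → ι → PowerSeries K} (he : LinearIndependent (PowerSeries K) e)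
    (hrel : ∀ x, ∑ i, PowerSeries.map (algebraMap K ℂ) (e x i) * tay 1 (G i) = 0) :
    Module.finrank ℚ K * Fintype.card κ + Fintype.card ι ≤
      Module.finrank ℚ K * Fintype.card ι := by
  obtain ⟨ρ, γ, y, h1, h2, h3, h4, h5⟩ := S.exists_decomposition
  have := card_add_card_le_of_orthogonal he (IsSol.linearIndependent S.ne_zero h3 h2)
    fun x h => sum_mul_eq_zero_of_decomposition h1 h4 (hrel x) h
  rw [Fintype.card_fin] at this
  nlinarith [Nat.mul_le_mul_left (Module.finrank ℚ K) this]

end Relations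

section Reduce

variable {F : Type*} [Field F] {σ : Type} [Fintype σ]

/-- A finite family satisfying a first-order system contains a maximal linearly independent
subfamily, which again satisfies a first-order system. -/
theorem exists_independent_subsystem_of_subset {t : F[X]} {A : σ → σ → F[X]}
    {w : σ → PowerSeries F} (hw : IsSol 0 t A w) {s₀ : Finset σ}
    (h₀ : ∀ P : σ → F[X], ∑ i ∈ s₀, sh 0 (P i) * w i = 0 → ∀ i ∈ s₀, P i = 0) :
    ∃ (s : Finset σ) (q : F[X]) (B : σ → s → F[X]) (A' : s → s → F[X]), s₀ ⊆ s ∧ q ≠ 0 ∧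
      (∀ P : s → F[X], app 0 P (fun i : s => w i) = 0 → P = 0) ∧
      (∀ i, sh 0 q * w i = ∑ k, sh 0 (B i k) * w k) ∧
      IsSol 0 (q * t) A' (fun i : s => w i) := by
  classical
  obtain ⟨s, q, p, hs, hq, hli, hp⟩ := exists_relation_basis_of_subset (sh (0 : F)) w h₀
  have hp' : ∀ i, sh 0 q * w i = ∑ k : s, sh 0 (p i k) * w k := fun i => by
    rw [hp, ← Finset.sum_coe_sort]
  refine ⟨s, q, fun i k => p i k, fun i k => ∑ l, A i l * p l k, hs, hq, fun P hP => ?_, hp', ?_⟩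
  · funext i
    have := hli (fun j => if h : j ∈ s then P ⟨j, h⟩ else 0) (by
      rw [← Finset.sum_coe_sort, ← hP, app]
      exact Finset.sum_congr rfl fun i _ => by rw [dif_pos i.2]) i i.2
    rwa [dif_pos i.2] at this
  · intro i
    rw [map_mul, mul_assoc, hw i, Finset.mul_sum]
    simp only [mul_left_comm (sh 0 q), hp', map_sum, map_mul, Finset.mul_sum, Finset.sum_mul]
    rw [Finset.sum_comm]
    simp only [mul_assoc]

theorem exists_independent_subsystem {t : F[X]} {A : σ → σ → F[X]}
    {w : σ → PowerSeries F} (hw : IsSol 0 t A w) :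
    ∃ (s : Finset σ) (q : F[X]) (B : σ → s → F[X]) (A' : s → s → F[X]), q ≠ 0 ∧
      (∀ P : s → F[X], app 0 P (fun i : s => w i) = 0 → P = 0) ∧
      (∀ i, sh 0 q * w i = ∑ k, sh 0 (B i k) * w k) ∧
      IsSol 0 (q * t) A' (fun i : s => w i) := by
  obtain ⟨s, q, B, A', -, h⟩ := exists_independent_subsystem_of_subset hw (s₀ := ∅) (by simp)
  exact ⟨s, q, B, A', h⟩

end Reduce

section LinearDisjointness

variable {k E Ω : Type*} [Field k] [CharZero k] [Field E] [Field Ω] [Algebra k E] [Algebra k Ω]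
  [Algebra E Ω] [IsScalarTower k E Ω]

/-- If `k` is algebraically closed in `E`, then elements of `E` that are independent over `k`
remain independent over the algebraic elements of any extension of `E`. -/
theorem eq_zero_of_sum_algebraic_mul_eq_zero
    (hE : ∀ x : E, IsAlgebraic k x → x ∈ Set.range (algebraMap k E))
    {I : Type*} [Fintype I] {w : I → E} (hw : LinearIndependent k w) {a : I → Ω}
    (ha : ∀ i, IsAlgebraic k (a i)) (h : ∑ i, a i * algebraMap E Ω (w i) = 0) : a = 0 := by
  classical
  let F' := IntermediateField.adjoin k (Set.range a)
  have : FiniteDimensional k F' := IntermediateField.finiteDimensional_adjoin (by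
    rintro _ ⟨i, rfl⟩; exact (ha i).isIntegral)
  obtain ⟨pb⟩ : Nonempty (PowerBasis k F') := ⟨Field.powerBasisOfFiniteOfSeparable k F'⟩
  obtain ⟨θ, hθ⟩ : ∃ θ : Ω, θ = (pb.gen : Ω) := ⟨_, rfl⟩
  have hθi : IsIntegral k θ := by
    rw [hθ]
    exact (Algebra.IsIntegral.isIntegral pb.gen).map F'.val
  have hdim : (minpoly k θ).natDegree = pb.dim := by
    rw [hθ, ← pb.natDegree_minpoly]
    congr 1
    exact minpoly.algebraMap_eq (algebraMap F' Ω).injective pb.gen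
  have hf : ∀ i, ∃ f : k[X], f.natDegree < pb.dim ∧ a i = Polynomial.aeval θ f := by
    intro i
    obtain ⟨f, h1, h2⟩ := pb.exists_eq_aeval ⟨a i, IntermediateField.subset_adjoin k _ ⟨i, rfl⟩⟩
    refine ⟨f, h1, ?_⟩
    have := congrArg F'.val h2
    rw [← Polynomial.aeval_algHom_apply] at this
    rw [hθ]
    exact this
  choose f hf1 hf2 using hf
  have hmin : pb.dim ≤ (minpoly E θ).natDegree := by
    have hc : minpoly E θ ∈ Polynomial.lifts (algebraMap k E) := by
      rw [Polynomial.lifts_iff_coeff_lifts]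
      exact fun n => hE _ (Polynomial.isIntegral_coeff_of_dvd _ _ (minpoly.monic hθi)
        (minpoly.monic hθi.tower_top) (minpoly.dvd_map_of_isScalarTower k E θ) n).isAlgebraic
    obtain ⟨q, hq⟩ := hc
    have hq0 : q ≠ 0 := by
      rintro rfl
      exact minpoly.ne_zero (hθi.tower_top (A := E)) (by rw [← hq]; simp)
    have h1 : Polynomial.aeval θ q = 0 := by
      rw [← Polynomial.aeval_map_algebraMap E, ← Polynomial.coe_mapRingHom, hq, minpoly.aeval]
    rw [← hq, Polynomial.coe_mapRingHom, Polynomial.natDegree_map, ← hdim]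
    exact Polynomial.natDegree_le_of_dvd (minpoly.dvd k θ h1) hq0
  have hpow : LinearIndependent E fun j : Fin pb.dim => θ ^ (j : ℕ) :=
    (linearIndependent_pow (K := E) θ).comp (Fin.castLE hmin) (Fin.castLE_injective hmin)
  have hfs : ∀ i, a i = ∑ j : Fin pb.dim, algebraMap k Ω ((f i).coeff j) * θ ^ (j : ℕ) := by
    intro i
    rw [hf2, Polynomial.aeval_eq_sum_range' (hf1 i), ← Fin.sum_univ_eq_sum_range
      (fun j => (f i).coeff j • θ ^ j)]
    exact Finset.sum_congr rfl fun j _ => by rw [Algebra.smul_def]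
  have hj : ∀ j : Fin pb.dim, ∑ i, (f i).coeff j • w i = 0 := by
    refine Fintype.linearIndependent_iff.mp hpow _ ?_
    rw [← h]
    simp only [hfs, Finset.sum_mul, Finset.sum_smul]
    rw [Finset.sum_comm]
    refine Finset.sum_congr rfl fun i _ => Finset.sum_congr rfl fun j _ => ?_
    rw [Algebra.smul_def, Algebra.smul_def, map_mul, ← IsScalarTower.algebraMap_apply]
    ring
  funext i
  rw [hfs]
  refine Finset.sum_eq_zero fun j _ => ?_
  rw [Fintype.linearIndependent_iff.mp hw _ (hj j) i, map_zero, zero_mul]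

theorem exists_algHom_of_finite (k S Ω : Type*) [Field k] [Field S] [Algebra k S]
    [Module.Finite k S] [Field Ω] [IsAlgClosed Ω] [Algebra k Ω] :
    ∃ ψ : S →ₐ[k] Ω, ∀ x, IsAlgebraic k (ψ x) :=
  ⟨IsAlgClosed.lift, fun x => (Algebra.IsAlgebraic.isAlgebraic (R := k) x).algHom _⟩

theorem exists_algHom_of_finiteType (k A Ω : Type*) [Field k] [CommRing A] [Nontrivial A]
    [Algebra k A] [Algebra.FiniteType k A] [Field Ω] [IsAlgClosed Ω] [Algebra k Ω] :
    ∃ ψ : A →ₐ[k] Ω, ∀ x, IsAlgebraic k (ψ x) := by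
  obtain ⟨m, hm⟩ := Ideal.exists_maximal A
  let : Field (A ⧸ m) := Ideal.Quotient.field m
  have : Algebra.FiniteType k (A ⧸ m) :=
    Algebra.FiniteType.of_surjective (Ideal.Quotient.mkₐ k m) (Ideal.Quotient.mkₐ_surjective k m)
  have : Module.Finite k (A ⧸ m) := finite_of_finite_type_of_isJacobsonRing k (A ⧸ m)
  obtain ⟨ψ, hψ⟩ := exists_algHom_of_finite k (A ⧸ m) Ω
  exact ⟨ψ.comp (Ideal.Quotient.mkₐ k m), fun x => hψ _⟩

theorem eq_zero_or_eq_zero_of_structure_constants {L : Type*} [Field L] [Algebra k L]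
    (hE : ∀ x : E, IsAlgebraic k x → x ∈ Set.range (algebraMap k E))
    {I J N : Type*} [Fintype I] [Fintype J] [Fintype N] {w : I → E} (hw : LinearIndependent k w)
    {v : J → E} (hv : LinearIndependent k v) {p : N → E} {M : I → J → N → k}
    (hM : ∀ i j, w i * v j = ∑ l, algebraMap k E (M i j l) * p l) {c : I → L} {e : J → L}
    (h : ∀ l, ∑ i, ∑ j, c i * e j * algebraMap k L (M i j l) = 0) : c = 0 ∨ e = 0 := by
  by_contra! hcon
  obtain ⟨i₀, hi₀⟩ := Function.ne_iff.mp hcon.1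
  obtain ⟨j₀, hj₀⟩ := Function.ne_iff.mp hcon.2
  let s : Set L := Set.range c ∪ Set.range e ∪ {(c i₀)⁻¹, (e j₀)⁻¹}
  have hs : s.Finite := ((Set.finite_range c).union (Set.finite_range e)).union (by simp)
  let A := Algebra.adjoin k s
  have hfin : Algebra.FiniteType k A := by
    rw [← Subalgebra.fg_iff_finiteType]
    exact ⟨hs.toFinset, by rw [hs.coe_toFinset]⟩
  let Ω := AlgebraicClosure E
  obtain ⟨ψ, hψ⟩ := exists_algHom_of_finiteType k A Ω
  have hsub : ∀ x ∈ s, x ∈ A := fun x hx => Algebra.subset_adjoin hx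
  let c' : I → A := fun i => ⟨c i, hsub _ (Or.inl (Or.inl ⟨i, rfl⟩))⟩
  let e' : J → A := fun j => ⟨e j, hsub _ (Or.inl (Or.inr ⟨j, rfl⟩))⟩
  have hunit : ∀ x y : A, x * y = 1 → ψ x ≠ 0 := by
    intro x y hxy h0
    have := congrArg ψ hxy
    rw [map_mul, h0, zero_mul, map_one] at this
    exact zero_ne_one this
  have hc0 : ψ (c' i₀) ≠ 0 := hunit _ ⟨(c i₀)⁻¹, hsub _ (Or.inr (by simp))⟩
    (Subtype.ext (mul_inv_cancel₀ hi₀))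
  have he0 : ψ (e' j₀) ≠ 0 := hunit _ ⟨(e j₀)⁻¹, hsub _ (Or.inr (by simp))⟩
    (Subtype.ext (mul_inv_cancel₀ hj₀))
  have h' : ∀ l, ∑ i, ∑ j, ψ (c' i) * ψ (e' j) * algebraMap k Ω (M i j l) = 0 := by
    intro l
    have h1 : ∑ i, ∑ j, c' i * e' j * algebraMap k A (M i j l) = 0 := by
      apply Subtype.ext
      push_cast
      exact h l
    have := congrArg ψ h1
    simpa only [map_sum, map_mul, AlgHom.commutes, map_zero] using this
  have hprod : (∑ i, ψ (c' i) * algebraMap E Ω (w i)) *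
      ∑ j, ψ (e' j) * algebraMap E Ω (v j) = 0 := by
    calc _ = ∑ l, (∑ i, ∑ j, ψ (c' i) * ψ (e' j) * algebraMap k Ω (M i j l)) *
          algebraMap E Ω (p l) := by
          rw [Finset.sum_mul_sum]
          have h2 : ∀ i j, ψ (c' i) * algebraMap E Ω (w i) * (ψ (e' j) * algebraMap E Ω (v j)) =
              ∑ l, ψ (c' i) * ψ (e' j) * algebraMap k Ω (M i j l) * algebraMap E Ω (p l) := by
            intro i j
            rw [mul_mul_mul_comm, ← map_mul (algebraMap E Ω), hM, map_sum, Finset.mul_sum]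
            exact Finset.sum_congr rfl fun l _ => by
              rw [map_mul, ← IsScalarTower.algebraMap_apply, ← mul_assoc, ← map_mul]
          simp only [h2, Finset.sum_mul]
          exact (Finset.sum_congr rfl fun i _ => Finset.sum_comm).trans Finset.sum_comm
      _ = 0 := by simp [h']
  rcases mul_eq_zero.mp hprod with h0 | h0
  · exact hc0 (congrFun (eq_zero_of_sum_algebraic_mul_eq_zero hE hw (fun i => hψ _) h0) i₀)
  · exact he0 (congrFun (eq_zero_of_sum_algebraic_mul_eq_zero hE hv (fun i => hψ _) h0) j₀)

end LinearDisjointness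

section EntireQuotient

open Filter Topology

/-- An entire function of polynomial growth is a polynomial. -/
theorem exists_polynomial_of_norm_le {g : ℂ → ℂ} (hg : Differentiable ℂ g) {C : ℝ} {N : ℕ}
    (h : ∀ z, ‖g z‖ ≤ C * (1 + ‖z‖) ^ N) : ∃ P : ℂ[X], ∀ z, g z = P.eval z := by
  have hC : 0 ≤ C := by
    have := (norm_nonneg _).trans (h 0)
    simpa using this
  have hcoeff : ∀ n, N < n → PowerSeries.coeff n (tay 0 g) = 0 := by
    intro n hn
    rw [coeff_tay, div_eq_zero_iff]
    left
    rw [← norm_le_zero_iff]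
    have hlim : Tendsto (fun R : ℝ => n.factorial * (C * 2 ^ N) / R) atTop (𝓝 0) :=
      tendsto_const_nhds.div_atTop tendsto_id
    refine ge_of_tendsto hlim ?_
    filter_upwards [eventually_ge_atTop 1] with R hR
    have hR0 : 0 < R := one_pos.trans_le hR
    refine (Complex.norm_iteratedDeriv_le_of_forall_mem_sphere_norm_le (C := C * (2 * R) ^ N) n hR0
      hg.diffContOnCl fun z hz => (h z).trans ?_).trans ?_
    · rw [mem_sphere_zero_iff_norm] at hz
      rw [hz]
      gcongr
      linarith
    · rw [mul_pow, ← mul_assoc, ← mul_assoc, div_le_div_iff₀ (by positivity) hR0,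
        mul_assoc (_ * _), ← pow_succ]
      rw [← mul_assoc]
      exact mul_le_mul_of_nonneg_left (pow_le_pow_right₀ hR hn) (by positivity)
  refine ⟨PowerSeries.trunc (N + 1) (tay 0 g), fun z => ?_⟩
  refine congrFun (eq_of_tay_eq hg (Polynomial.differentiable _) (c := 0) ?_) z
  rw [tay_eval, sh_zero]
  ext n
  rw [Polynomial.coeff_coe, PowerSeries.coeff_trunc]
  split_ifs with hn
  · rfl
  · exact hcoeff n (by omega)

theorem exists_polynomial_mul_eq {h b : ℂ → ℂ} (hh : Differentiable ℂ h) (hb : Differentiable ℂ b)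
    (hb0 : ∃ z, b z ≠ 0) {C : ℝ} {N : ℕ} (hC : 0 ≤ C)
    (hle : ∀ z, ‖h z‖ ≤ C * (1 + ‖z‖) ^ N * ‖b z‖) : ∃ P : ℂ[X], ∀ z, h z = P.eval z * b z := by
  have hbn : ∀ x, ∀ᶠ z in 𝓝[≠] x, b z ≠ 0 := by
    intro x
    by_contra hcon
    obtain ⟨z, hz⟩ := hb0
    exact hz (AnalyticOnNhd.eqOn_zero_of_preconnected_of_frequently_eq_zero
      (fun y _ => hb.analyticAt y) isPreconnected_univ (Set.mem_univ x)
      hcon (Set.mem_univ z))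
  have hle' : ∀ z, ‖(h / b) z‖ ≤ C * (1 + ‖z‖) ^ N := by
    intro z
    rw [Pi.div_apply, norm_div]
    exact div_le_of_le_mul₀ (norm_nonneg _) (by positivity) (hle z)
  have hmer : MeromorphicOn (h / b) Set.univ := fun x _ =>
    (hh.analyticAt x).meromorphicAt.div (hb.analyticAt x).meromorphicAt
  obtain ⟨g, hg⟩ : ∃ g, g = toMeromorphicNFOn (h / b) Set.univ := ⟨_, rfl⟩
  have hgf : ∀ x, g =ᶠ[𝓝[≠] x] h / b := fun x => by
    rw [hg]; exact hmer.toMeromorphicNFOn_eq_self_on_nhdsNE (Set.mem_univ x)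
  have hgA : ∀ x, AnalyticAt ℂ g x := by
    intro x
    have := meromorphicNFOn_toMeromorphicNFOn (h / b) Set.univ (Set.mem_univ x)
    rw [hg, ← this.meromorphicOrderAt_nonneg_iff_analyticAt,
      meromorphicOrderAt_toMeromorphicNFOn hmer (Set.mem_univ x)]
    by_contra! hneg
    have h1 := tendsto_norm_cobounded_atTop.comp (tendsto_cobounded_of_meromorphicOrderAt_neg hneg)
    have h2 : Tendsto (fun z : ℂ => C * (1 + ‖z‖) ^ N) (𝓝[≠] x) (𝓝 (C * (1 + ‖x‖) ^ N)) :=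
      ((Continuous.tendsto (by fun_prop) x)).mono_left nhdsWithin_le_nhds
    obtain ⟨z, hz1, hz2⟩ := ((h1.eventually_gt_atTop (C * (1 + ‖x‖) ^ N + 1)).and
      (h2.eventually_lt_const (lt_add_one _))).exists
    exact absurd (hle' z) (not_le.mpr (hz2.trans hz1))
  have hgd : Differentiable ℂ g := fun x => (hgA x).differentiableAt
  have hgle : ∀ x, ‖g x‖ ≤ C * (1 + ‖x‖) ^ N := by
    intro x
    have h1 : Tendsto (fun z => ‖g z‖) (𝓝[≠] x) (𝓝 ‖g x‖) :=
      (hgd.continuous.norm.tendsto x).mono_left nhdsWithin_le_nhds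
    have h2 : Tendsto (fun z : ℂ => C * (1 + ‖z‖) ^ N) (𝓝[≠] x) (𝓝 (C * (1 + ‖x‖) ^ N)) :=
      ((Continuous.tendsto (by fun_prop) x)).mono_left nhdsWithin_le_nhds
    refine le_of_tendsto_of_tendsto h1 h2 ?_
    filter_upwards [hgf x] with z hz
    rw [hz]
    exact hle' z
  obtain ⟨P, hP⟩ := exists_polynomial_of_norm_le hgd hgle
  refine ⟨P, fun x => ?_⟩
  rw [← hP]
  have h1 : Tendsto h (𝓝[≠] x) (𝓝 (h x)) := (hh.continuous.tendsto x).mono_left nhdsWithin_le_nhds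
  have h2 : Tendsto (fun z => g z * b z) (𝓝[≠] x) (𝓝 (g x * b x)) :=
    ((hgd.continuous.mul hb.continuous).tendsto x).mono_left nhdsWithin_le_nhds
  refine tendsto_nhds_unique h1 (h2.congr' ?_)
  filter_upwards [hgf x, hbn x] with z hz hz'
  rw [hz, Pi.div_apply, div_mul_cancel₀ _ hz']

theorem exists_norm_eval_le {ι : Type*} (s : Finset ι) (p : ι → ℂ[X]) :
    ∃ (C : ℝ) (N : ℕ), 0 ≤ C ∧ ∀ z, ∑ i ∈ s, ‖(p i).eval z‖ ≤ C * (1 + ‖z‖) ^ N := by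
  classical
  induction s using Finset.induction_on with
  | empty => exact ⟨0, 0, le_rfl, fun z => by simp⟩
  | insert i s hi ih =>
    obtain ⟨C, N, hC, h⟩ := ih
    refine ⟨∑ k ∈ (p i).support, ‖(p i).coeff k‖ + C, (p i).natDegree + N,
      by positivity, fun z => ?_⟩
    rw [Finset.sum_insert hi, add_mul]
    have h1 : 1 ≤ 1 + ‖z‖ := by linarith [norm_nonneg z]
    refine add_le_add ?_ ((h z).trans ?_)
    · rw [Polynomial.eval_eq_sum, Polynomial.sum, Finset.sum_mul]
      refine (norm_sum_le _ _).trans (Finset.sum_le_sum fun k hk => ?_)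
      rw [norm_mul, norm_pow]
      refine mul_le_mul_of_nonneg_left ?_ (norm_nonneg _)
      exact (pow_le_pow_left₀ (norm_nonneg _) (by linarith) k).trans (pow_le_pow_right₀ h1
        ((Polynomial.le_natDegree_of_mem_supp k hk).trans (Nat.le_add_right _ _)))
    · exact mul_le_mul_of_nonneg_left (pow_le_pow_right₀ h1 (Nat.le_add_left _ _)) hC

theorem norm_le_of_homogeneous_relation {m : ℕ} (hm : 0 < m) {a : ℕ → ℂ} {x y : ℂ}
    (h : x ^ m + ∑ j ∈ Finset.range m, a j * x ^ j * y ^ (m - j) = 0) :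
    ‖x‖ ≤ (1 + ∑ j ∈ Finset.range m, ‖a j‖) * ‖y‖ := by
  by_contra! hcon
  have hS : 0 ≤ ∑ j ∈ Finset.range m, ‖a j‖ := Finset.sum_nonneg fun _ _ => norm_nonneg _
  have hyx : ‖y‖ ≤ ‖x‖ := le_trans (le_mul_of_one_le_left (norm_nonneg _) (by linarith)) hcon.le
  have hx : 0 < ‖x‖ := (mul_nonneg (by linarith) (norm_nonneg y)).trans_lt hcon
  have h1 : ‖x‖ ^ m ≤ (∑ j ∈ Finset.range m, ‖a j‖) * ‖y‖ * ‖x‖ ^ (m - 1) := by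
    rw [← norm_pow, eq_neg_of_add_eq_zero_left h, norm_neg, Finset.sum_mul, Finset.sum_mul]
    refine (norm_sum_le _ _).trans (Finset.sum_le_sum fun j hj => ?_)
    have hj := Finset.mem_range.mp hj
    rw [norm_mul, norm_mul, norm_pow, norm_pow, mul_assoc, mul_assoc]
    refine mul_le_mul_of_nonneg_left ?_ (norm_nonneg _)
    calc ‖x‖ ^ j * ‖y‖ ^ (m - j) = ‖y‖ * (‖x‖ ^ j * ‖y‖ ^ (m - j - 1)) := by
          rw [mul_left_comm, ← pow_succ']; congr 2; omega
      _ ≤ ‖y‖ * (‖x‖ ^ j * ‖x‖ ^ (m - j - 1)) := by gcongr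
      _ = _ := by rw [← pow_add]; congr 2; omega
  obtain ⟨m, rfl⟩ : ∃ m', m = m' + 1 := ⟨m - 1, by omega⟩
  rw [Nat.add_sub_cancel, pow_succ', mul_le_mul_iff_left₀ (pow_pos hx m)] at h1
  nlinarith [norm_nonneg y]

end EntireQuotient

section EntireSeries

theorem tay_pow {G : ℂ → ℂ} (hG : Differentiable ℂ G) (c : ℂ) (n : ℕ) :
    tay c (G ^ n) = tay c G ^ n := by
  induction n with
  | zero => rw [pow_zero, pow_zero]; exact (tay_const c 1).trans (map_one _)
  | succ n ih => rw [pow_succ, tay_mul (hG.pow n) hG, ih, pow_succ]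

variable (K : Type*) [Field K] [Algebra K ℂ]

/-- The power series over `K` which are Taylor expansions of entire functions. -/
def entireSubring : Subring (PowerSeries K) where
  carrier := {φ | ∃ G : ℂ → ℂ, Differentiable ℂ G ∧ tay 0 G = PowerSeries.map (algebraMap K ℂ) φ}
  mul_mem' := by
    rintro φ ψ ⟨G, hG, h⟩ ⟨H, hH, h'⟩
    exact ⟨G * H, hG.mul hH, by rw [tay_mul hG hH, map_mul, h, h']⟩
  one_mem' := ⟨fun _ => 1, differentiable_const _, by rw [tay_const, map_one, map_one]⟩
  add_mem' := by
    rintro φ ψ ⟨G, hG, h⟩ ⟨H, hH, h'⟩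
    exact ⟨G + H, hG.add hH, by rw [tay_add hG hH, map_add, h, h']⟩
  zero_mem' := ⟨fun _ => 0, differentiable_const _, by rw [tay_const, map_zero, map_zero]⟩
  neg_mem' := by
    rintro φ ⟨G, hG, h⟩
    refine ⟨(fun _ => -1) * G, (differentiable_const _).mul hG, ?_⟩
    rw [tay_mul (differentiable_const _) hG, tay_const, h]
    simp

theorem sh_mem_entireSubring (p : K[X]) : sh 0 p ∈ entireSubring K :=
  ⟨_, Polynomial.differentiable (p.map (algebraMap K ℂ)), by rw [tay_eval, map_sh, map_zero]⟩

variable {K}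

theorem exists_sh_mul_eq [CharZero K] {h b : PowerSeries K} (hh : h ∈ entireSubring K)
    (hb : b ∈ entireSubring K) (hb0 : b ≠ 0) {m : ℕ} (hm : 0 < m) {a : ℕ → K[X]}
    (hrel : h ^ m + ∑ j ∈ Finset.range m, sh 0 (a j) * h ^ j * b ^ (m - j) = 0) :
    ∃ P : K[X], h = sh 0 P * b := by
  obtain ⟨H, hH, hH'⟩ := hh
  obtain ⟨B, hB, hB'⟩ := hb
  have hinj : Function.Injective (PowerSeries.map (algebraMap K ℂ)) :=
    PowerSeries.map_injective _ (algebraMap K ℂ).injective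
  let a' : ℕ → ℂ[X] := fun j => (a j).map (algebraMap K ℂ)
  let T : ℕ → ℂ → ℂ := fun j => (fun z => (a' j).eval z) * H ^ j * B ^ (m - j)
  have hT : ∀ j, Differentiable ℂ (T j) := fun j =>
    ((a' j).differentiable.mul (hH.pow j)).mul (hB.pow _)
  have hT' : ∀ j, tay 0 (T j) =
      PowerSeries.map (algebraMap K ℂ) (sh 0 (a j) * h ^ j * b ^ (m - j)) := by
    intro j
    rw [tay_mul ((a' j).differentiable.mul (hH.pow j)) (hB.pow _),
      tay_mul (a' j).differentiable (hH.pow j), tay_pow hH, tay_pow hB, hH', hB', tay_eval,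
      map_mul, map_mul, map_sh, map_pow, map_pow, map_zero]
  have hzero : H ^ m + ∑ j ∈ Finset.range m, T j = fun _ => 0 := by
    refine eq_of_tay_eq ((hH.pow m).add (Differentiable.sum fun j _ => hT j))
      (differentiable_const _) (c := 0) ?_
    rw [tay_add (hH.pow m) (Differentiable.sum fun j _ => hT j), tay_sum _ hT, tay_pow hH, hH',
      tay_const, map_zero, Finset.sum_congr rfl fun j _ => hT' j, ← map_pow, ← map_sum, ← map_add,
      hrel, map_zero]
  obtain ⟨C, N, hC, hCN⟩ := exists_norm_eval_le (Finset.range m) a'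
  have hB0 : ∃ z, B z ≠ 0 := by
    by_contra! hcon
    refine hb0 (hinj ?_)
    rw [map_zero, ← hB', show B = fun _ => 0 from funext hcon, tay_const, map_zero]
  obtain ⟨P, hP⟩ := exists_polynomial_mul_eq hH hB hB0 (C := 1 + C) (N := N) (by positivity) (by
    intro z
    have h1 := congrFun hzero z
    simp only [Pi.add_apply, Pi.pow_apply, Finset.sum_apply, Pi.mul_apply, T] at h1
    refine (norm_le_of_homogeneous_relation hm h1).trans ?_
    refine mul_le_mul_of_nonneg_right ?_ (norm_nonneg _)
    rw [add_mul, one_mul]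
    exact add_le_add (one_le_pow₀ (by linarith [norm_nonneg z])) (hCN z))
  have hser : PowerSeries.map (algebraMap K ℂ) h =
      PowerSeries.map (algebraMap K ℂ) b * sh 0 P := by
    rw [← hH', ← hB', ← tay_eval, ← tay_mul hB P.differentiable]
    congr 1
    funext z
    rw [hP z, Pi.mul_apply, mul_comm]
  obtain ⟨l, hl⟩ := LinearMap.exists_leftInverse_of_injective (Algebra.linearMap K ℂ)
    (LinearMap.ker_eq_bot.mpr (algebraMap K ℂ).injective)
  have hl1 : ∀ x, l (algebraMap K ℂ x) = x := fun x => LinearMap.congr_fun hl x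
  refine ⟨∑ n ∈ P.support, Polynomial.monomial n (l (P.coeff n)), ?_⟩
  have h2 := congrArg (mapFunctional l) hser
  rw [mapFunctional_map_mul, mul_comm] at h2
  convert h2 using 1
  · ext n
    rw [coeff_mapFunctional, PowerSeries.coeff_map, hl1]
  · congr 1
    ext n
    rw [coeff_mapFunctional, sh_zero, sh_zero, Polynomial.coeff_coe, Polynomial.coeff_coe,
      Polynomial.finsetSum_coeff]
    simp only [Polynomial.coeff_monomial]
    rw [Finset.sum_ite_eq']
    split_ifs with hn
    · rfl
    · rw [Polynomial.notMem_support_iff.mp hn, map_zero]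

end EntireSeries

section FractionField

theorem mem_range_of_isAlgebraic {R S k E : Type*} [CommRing R] [IsDomain R] [CommRing S]
    [IsDomain S] [Field k] [Field E] [Algebra R S] [Algebra R k] [IsFractionRing R k] [Algebra S E]
    [IsFractionRing S E] [Algebra k E] [Algebra R E] [IsScalarTower R S E] [IsScalarTower R k E]
    (H : ∀ (h b : S), b ≠ 0 → ∀ m : ℕ, 0 < m → ∀ a : ℕ → R,
      h ^ m + ∑ j ∈ Finset.range m, algebraMap R S (a j) * h ^ j * b ^ (m - j) = 0 →
        ∃ P : R, h = algebraMap R S P * b) (x : E) (hx : IsAlgebraic k x) :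
    x ∈ Set.range (algebraMap k E) := by
  have hinjk : Function.Injective (algebraMap R k) := IsFractionRing.injective R k
  have hinj : Function.Injective (algebraMap R E) := by
    rw [IsScalarTower.algebraMap_eq R k E]
    exact (algebraMap k E).injective.comp hinjk
  have hinjS : Function.Injective (algebraMap S E) := IsFractionRing.injective S E
  obtain ⟨y, hy0, q, hq, hq0⟩ :=
    ((IsFractionRing.isAlgebraic_iff R k E).mpr hx).exists_integral_multiple
  obtain ⟨h, b, hb, hhb⟩ := IsFractionRing.div_surjective S (y • x)
  have hb0 : b ≠ 0 := nonZeroDivisors.ne_zero hb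
  have hbE : algebraMap S E b ≠ 0 := (map_ne_zero_iff _ hinjS).mpr hb0
  have hyE : algebraMap R E y ≠ 0 := (map_ne_zero_iff _ hinj).mpr hy0
  have hm : 0 < q.natDegree := by
    rcases Nat.eq_zero_or_pos q.natDegree with h0 | h0
    · rw [Polynomial.Monic.degree_le_zero_iff_eq_one hq |>.mp
        (Polynomial.natDegree_eq_zero_iff_degree_le_zero.mp h0)] at hq0
      simp at hq0
    · exact h0
  obtain ⟨P, hP⟩ := H h b hb0 q.natDegree hm q.coeff (by
    apply hinjS
    rw [← hhb, Polynomial.eval₂_eq_sum_range, Finset.sum_range_succ, hq.coeff_natDegree, map_one,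
      one_mul] at hq0
    have := congrArg (fun z => algebraMap S E b ^ q.natDegree * z) hq0
    simp only [mul_zero] at this
    rw [map_zero, ← this, map_add, map_sum, add_comm, mul_add, Finset.mul_sum]
    refine congrArg₂ _ (Finset.sum_congr rfl fun j hj => ?_) ?_
    · have hj := Finset.mem_range.mp hj
      obtain ⟨i, hi⟩ := Nat.exists_eq_add_of_le hj.le
      rw [map_mul, map_mul, map_pow, map_pow, hi, Nat.add_sub_cancel_left,
        ← IsScalarTower.algebraMap_apply, div_pow, pow_add]
      field_simp
    · rw [map_pow, div_pow, mul_div_cancel₀ _ (pow_ne_zero _ hbE)])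
  refine ⟨algebraMap R k P / algebraMap R k y, ?_⟩
  rw [map_div₀, ← IsScalarTower.algebraMap_apply, ← IsScalarTower.algebraMap_apply,
    div_eq_iff hyE, mul_comm x, ← Algebra.smul_def, ← hhb, hP, map_mul,
    mul_div_cancel_right₀ _ hbE, ← IsScalarTower.algebraMap_apply]

end FractionField

section Products

variable {K : Type*} [Field K] [CharZero K] [Algebra K ℂ]

theorem eq_zero_or_eq_zero_of_entire {I J N : Type} [Fintype I] [Fintype J] [Fintype N]
    {w : I → PowerSeries K} {v : J → PowerSeries K} {p : N → PowerSeries K}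
    (hwE : ∀ i, w i ∈ entireSubring K) (hvE : ∀ i, v i ∈ entireSubring K)
    (hpE : ∀ i, p i ∈ entireSubring K) (hw : ∀ P, app 0 P w = 0 → P = 0)
    (hv : ∀ P, app 0 P v = 0 → P = 0) {q : K[X]} (hq : q ≠ 0) {B : I → J → N → K[X]}
    (hB : ∀ i j, sh 0 q * (w i * v j) = ∑ l, sh 0 (B i j l) * p l) {c : I → PowerSeries K}
    {e : J → PowerSeries K} (h : ∀ l, ∑ i, ∑ j, c i * e j * sh 1 (B i j l) = 0) :
    c = 0 ∨ e = 0 := by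
  let k := FractionRing K[X]
  let E := FractionRing (entireSubring K)
  let L := FractionRing (PowerSeries K)
  let f : K[X] →+* entireSubring K := (sh 0).codRestrict _ (sh_mem_entireSubring K)
  have hf : Function.Injective f := fun a b hab => sh_injective 0 (congrArg Subtype.val hab)
  let : Algebra K[X] (entireSubring K) := f.toAlgebra
  have hfE : Function.Injective (algebraMap K[X] E) :=
    (IsFractionRing.injective (entireSubring K) E).comp hf
  let : Algebra k E := (IsFractionRing.lift hfE).toAlgebra
  have : IsScalarTower K[X] k E := IsScalarTower.of_algebraMap_eq fun x =>
    (IsFractionRing.lift_algebraMap hfE x).symm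
  have hgL : Function.Injective ((algebraMap (PowerSeries K) L).comp (sh 1)) :=
    (IsFractionRing.injective _ _).comp (sh_injective 1)
  let : Algebra k L := (IsFractionRing.lift hgL).toAlgebra
  have hkL : ∀ x : K[X], algebraMap k L (algebraMap K[X] k x) = algebraMap _ L (sh 1 x) :=
    IsFractionRing.lift_algebraMap hgL
  have hkE : ∀ x : K[X], algebraMap k E (algebraMap K[X] k x) = algebraMap _ E (f x) :=
    IsFractionRing.lift_algebraMap hfE
  have hLI : ∀ {I : Type} [Fintype I] {w : I → PowerSeries K} (hwE : ∀ i, w i ∈ entireSubring K),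
      (∀ P, app 0 P w = 0 → P = 0) →
        LinearIndependent k fun i => algebraMap (entireSubring K) E ⟨w i, hwE i⟩ := by
    intro I _ w hwE hw
    rw [← LinearIndependent.iff_fractionRing K[X] k, Fintype.linearIndependent_iff]
    intro P hP
    refine congrFun (hw P ?_)
    have : ∑ i, f (P i) * ⟨w i, hwE i⟩ = 0 := by
      apply IsFractionRing.injective (entireSubring K) E
      rw [map_zero, ← hP, map_sum]
      refine Finset.sum_congr rfl fun i _ => ?_
      rw [Algebra.smul_def, map_mul]
      rfl
    have := congrArg Subtype.val this
    simpa [app, f] using this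
  have hq' : algebraMap (entireSubring K) E (f q) ≠ 0 := (map_ne_zero_iff _ hfE).mpr hq
  have hE : ∀ x : E, IsAlgebraic k x → x ∈ Set.range (algebraMap k E) := by
    refine mem_range_of_isAlgebraic (R := K[X]) (S := entireSubring K) ?_
    intro h b hb m hm a hrel
    obtain ⟨P, hP⟩ := exists_sh_mul_eq h.2 b.2 (fun h0 => hb (Subtype.ext h0)) hm (a := a) (by
      simpa [f, RingHom.algebraMap_toAlgebra] using congrArg Subtype.val hrel)
    exact ⟨P, Subtype.ext hP⟩
  have hM : ∀ i j, algebraMap (entireSubring K) E ⟨w i, hwE i⟩ *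
      algebraMap (entireSubring K) E ⟨v j, hvE j⟩ =
      ∑ l, algebraMap k E (algebraMap K[X] k (B i j l)) *
        (algebraMap (entireSubring K) E ⟨p l, hpE l⟩ / algebraMap (entireSubring K) E (f q)) := by
    intro i j
    simp_rw [hkE, ← mul_div_assoc]
    rw [← Finset.sum_div, eq_div_iff hq', mul_comm]
    simp_rw [← map_mul (algebraMap (entireSubring K) E)]
    rw [← map_sum]
    congr 1
    apply Subtype.ext
    simpa [f] using hB i j
  have hinjL : Function.Injective (algebraMap (PowerSeries K) L) := IsFractionRing.injective _ _
  refine (eq_zero_or_eq_zero_of_structure_constants (k := k) (E := E) (L := L) hE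
    (hLI hwE hw) (hLI hvE hv) hM (c := fun i => algebraMap _ L (c i))
    (e := fun i => algebraMap _ L (e i)) fun l => ?_).imp
      (fun h0 => funext fun i => hinjL ?_) fun h0 => funext fun i => hinjL ?_
  · simp_rw [hkL, ← map_mul (algebraMap (PowerSeries K) L), ← map_sum]
    rw [h l, map_zero]
  · exact (congrFun h0 i).trans (map_zero _).symm
  · exact (congrFun h0 i).trans (map_zero _).symm

end Products

section Products

theorem tay_relation {N : Type*} [Fintype N] {H : ℂ → ℂ} {G : N → ℂ → ℂ}
    (hH : Differentiable ℂ H) (hG : ∀ i, Differentiable ℂ (G i)) {q : ℂ[X]} {B : N → ℂ[X]} {c : ℂ}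
    (h : sh c q * tay c H = ∑ l, sh c (B l) * tay c (G l)) (c' : ℂ) :
    sh c' q * tay c' H = ∑ l, sh c' (B l) * tay c' (G l) := by
  have := app_tay_eq_zero (G := fun o : Option N => o.elim H G) (c := c)
    (P := fun o => o.elim q fun l => -B l) (by rintro (_ | i); exacts [hH, hG i])
    (by simp [app, Fintype.sum_option, h]) c'
  simp only [app, Fintype.sum_option, Option.elim, map_neg, neg_mul, Finset.sum_neg_distrib] at this
  exact add_neg_eq_zero.mp this

variable {K : Type*} [Field K]

theorem IsSol.tensor {σ ι : Type*} [Fintype σ] [Fintype ι] [DecidableEq σ] [DecidableEq ι] {c : K}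
    {t t' : K[X]} {A : σ → σ → K[X]} {A' : ι → ι → K[X]} {w : σ → PowerSeries K}
    {u : ι → PowerSeries K} (hw : IsSol c t A w) (hu : IsSol c t' A' u) :
    IsSol c (t * t') (fun x y : σ × ι => (if y.2 = x.2 then t' * A x.1 y.1 else 0) +
      (if y.1 = x.1 then t * A' x.2 y.2 else 0)) fun x => w x.1 * u x.2 := by
  rintro ⟨i, j⟩
  have h1 := hw i
  have h2 := hu j
  simp only [map_add, add_mul, Finset.sum_add_distrib, Fintype.sum_prod_type, apply_ite (sh c),
    map_zero, ite_mul, zero_mul, Finset.sum_ite_eq', Finset.mem_univ, if_true,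
    Derivation.leibniz, smul_eq_mul, map_mul]
  have h3 : ∀ g : σ → ι → PowerSeries K, ∑ x, ∑ y, (if x = i then g x y else 0) = ∑ y, g i y :=
    fun g => (Finset.sum_eq_single i (fun b _ hb => by simp [hb])
      fun h => absurd (Finset.mem_univ i) h).trans (by simp)
  rw [h3]
  calc _ = sh c t' * u j * (sh c t * PowerSeries.derivative K (w i)) +
        sh c t * w i * (sh c t' * PowerSeries.derivative K (u j)) := by ring
    _ = _ := by
      rw [h1, h2, Finset.mul_sum, Finset.mul_sum]
      exact congrArg₂ _ (Finset.sum_congr rfl fun _ _ => by ring)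
        (Finset.sum_congr rfl fun _ _ => by ring)

variable [NumberField K] [Algebra K ℂ] {ι : Type} [Fintype ι] {t : K[X]} {A : ι → ι → K[X]}
  {u : ι → PowerSeries K} {G : ι → ℂ → ℂ}

theorem System.mem_entireSubring (S : System t A u G) (i : ι) : u i ∈ entireSubring K :=
  ⟨G i, S.differentiable i, S.tay_zero i⟩

/-- A nontrivial relation over `K⟦x⟧` between the expansions at `1` of a system forces the products
with another system to be numerous. -/
theorem System.exists_product (S : System t A u G) {e : ι → PowerSeries K} (he : e ≠ 0)
    (hrel : ∑ i, PowerSeries.map (algebraMap K ℂ) (e i) * tay 1 (G i) = 0) {σ : Type} [Fintype σ]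
    {t' : K[X]} {A' : σ → σ → K[X]} {w : σ → PowerSeries K} {G' : σ → ℂ → ℂ}
    (S' : System t' A' w G') :
    ∃ (s : Finset (σ × ι)) (T : K[X]) (M : s → s → K[X]),
      System T M (fun x : s => w x.1.1 * u x.1.2) (fun x : s => G' x.1.1 * G x.1.2) ∧
      Module.finrank ℚ K * Fintype.card σ + s.card ≤ Module.finrank ℚ K * s.card := by
  classical
  obtain ⟨s, q, B, M, hq, hind, hB, hsol⟩ := exists_independent_subsystem
    (S'.isSol.tensor S.isSol)
  have hdiff : ∀ x : σ × ι, Differentiable ℂ (G' x.1 * G x.2) := fun x =>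
    (S'.differentiable x.1).mul (S.differentiable x.2)
  have htay0 : ∀ x : σ × ι, tay 0 (G' x.1 * G x.2) =
      PowerSeries.map (algebraMap K ℂ) (w x.1 * u x.2) := fun x => by
    rw [tay_mul (S'.differentiable x.1) (S.differentiable x.2), S'.tay_zero, S.tay_zero, map_mul]
  have SS : System (q * (t' * t)) M (fun x : s => w x.1.1 * u x.1.2)
      (fun x : s => G' x.1.1 * G x.1.2) :=
    ⟨mul_ne_zero hq (mul_ne_zero S'.ne_zero S.ne_zero),
      fun x => (S'.eType x.1.1).mul (S.eType x.1.2), hsol, hind, fun x => hdiff x.1,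
      fun x => htay0 x.1⟩
  refine ⟨s, _, M, SS, ?_⟩
  have hB1 : ∀ x : σ × ι, PowerSeries.map (algebraMap K ℂ) (sh 1 q) * tay 1 (G' x.1 * G x.2) =
      ∑ l : s, PowerSeries.map (algebraMap K ℂ) (sh 1 (B x l)) *
        tay 1 (G' l.1.1 * G l.1.2) := by
    intro x
    simp only [map_sh, map_one]
    refine tay_relation (hdiff x) (fun l : s => hdiff l.1) (c := 0) ?_ 1
    have := congrArg (PowerSeries.map (algebraMap K ℂ)) (hB x)
    simpa only [htay0, map_mul, map_sum, map_sh, map_zero] using this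
  have := SS.card_relations_le (κ := σ)
    (e := fun x l => ∑ j, e j * sh 1 (B (x, j) l)) ?_ ?_
  · rwa [Fintype.card_coe] at this
  · rw [Fintype.linearIndependent_iff]
    intro c hc
    refine congrFun ((eq_zero_or_eq_zero_of_entire S'.mem_entireSubring S.mem_entireSubring
      SS.mem_entireSubring S'.indep S.indep hq (B := fun i j l => B (i, j) l)
      (fun i j => hB (i, j)) (c := c) (e := e) fun l => ?_).resolve_right he)
    have := congrFun hc l
    simpa [Finset.sum_apply, Finset.mul_sum, mul_assoc] using this
  · intro x
    have h0 : ∑ l : s, PowerSeries.map (algebraMap K ℂ) (∑ j, e j * sh 1 (B (x, j) l)) *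
        tay 1 (G' l.1.1 * G l.1.2) = ∑ j, PowerSeries.map (algebraMap K ℂ) (e j) *
          (PowerSeries.map (algebraMap K ℂ) (sh 1 q) * tay 1 (G' x * G j)) := by
      simp only [hB1 (x, _), map_sum, map_mul, Finset.sum_mul, Finset.mul_sum]
      rw [Finset.sum_comm]
      simp only [mul_assoc]
    rw [h0]
    have h1 : ∀ j, tay 1 (G' x * G j) = tay 1 (G' x) * tay 1 (G j) := fun j =>
      tay_mul (S'.differentiable x) (S.differentiable j) 1
    simp only [h1]
    calc _ = PowerSeries.map (algebraMap K ℂ) (sh 1 q) * tay 1 (G' x) *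
          ∑ i, PowerSeries.map (algebraMap K ℂ) (e i) * tay 1 (G i) := by
          rw [Finset.mul_sum]; exact Finset.sum_congr rfl fun j _ => by ring
      _ = 0 := by rw [hrel, mul_zero]

theorem System.exists_monomials (S : System t A u G) {e : ι → PowerSeries K} (he : e ≠ 0)
    (hrel : ∑ i, PowerSeries.map (algebraMap K ℂ) (e i) * tay 1 (G i) = 0) (D : ℕ) :
    ∃ (σ : Type) (_ : Fintype σ) (t' : K[X]) (A' : σ → σ → K[X]) (w : σ → PowerSeries K)
      (G' : σ → ℂ → ℂ), System t' A' w G' ∧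
      (∀ x, ∃ a : ι → Fin (D + 1), w x = ∏ i, u i ^ (a i : ℕ)) ∧
      Module.finrank ℚ K ^ D ≤ (Module.finrank ℚ K - 1) ^ D * Fintype.card σ := by
  classical
  induction D with
  | zero =>
    refine ⟨Unit, inferInstance, 1, fun _ _ => 0, fun _ => 1, fun _ _ => 1,
      ⟨one_ne_zero, fun _ => EType.one, fun i => ?_, fun P hP => ?_, fun _ =>
        differentiable_const _, fun _ => ?_⟩, fun _ => ⟨0, by simp⟩, by simp⟩
    · simp
    · funext i
      exact sh_injective 0 (by simpa [app] using hP)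
    · rw [tay_const, map_one, map_one]
  | succ D ih =>
    obtain ⟨σ, _, t', A', w, G', S', hmon, hcard⟩ := ih
    obtain ⟨s, T, M, SS, hs⟩ := S.exists_product he hrel S'
    refine ⟨s, inferInstance, T, M, _, _, SS, fun x => ?_, ?_⟩
    · obtain ⟨a, ha⟩ := hmon x.1.1
      refine ⟨fun i => if i = x.1.2 then (a i).succ else (a i).castSucc, ?_⟩
      simp only [ha]
      have : ∀ i, u i ^ (((if i = x.1.2 then (a i).succ else (a i).castSucc : Fin (D + 1 + 1))) : ℕ)
          = u i ^ (a i : ℕ) * (if i = x.1.2 then u i else 1) := by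
        intro i
        split_ifs
        · rw [Fin.val_succ, pow_succ]
        · rw [Fin.val_castSucc, mul_one]
      rw [Finset.prod_congr rfl fun i _ => this i, Finset.prod_mul_distrib, Finset.prod_ite_eq']
      simp
    · rw [Fintype.card_coe]
      have hd : 1 ≤ Module.finrank ℚ K := Module.finrank_pos
      obtain ⟨d, hd⟩ : ∃ d, Module.finrank ℚ K = d + 1 := ⟨_, (Nat.sub_add_cancel hd).symm⟩
      rw [hd, Nat.add_sub_cancel] at hcard ⊢
      rw [hd] at hs
      calc (d + 1) ^ (D + 1) = (d + 1) ^ D * (d + 1) := pow_succ _ _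
        _ ≤ d ^ D * Fintype.card σ * (d + 1) := Nat.mul_le_mul_right _ hcard
        _ = d ^ D * ((d + 1) * Fintype.card σ) := by ring
        _ ≤ d ^ D * (d * s.card) := Nat.mul_le_mul_left _ (by linarith)
        _ = _ := by ring

theorem System.eq_zero_of_relation (S : System t A u G) {e : ι → PowerSeries K}
    (hrel : ∑ i, PowerSeries.map (algebraMap K ℂ) (e i) * tay 1 (G i) = 0) : e = 0 := by
  by_contra he
  have hbound : ∀ D, Module.finrank ℚ K ^ D ≤
      (Module.finrank ℚ K - 1) ^ D * (D + 1) ^ Fintype.card ι := by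
    classical
    intro D
    obtain ⟨σ, _, t', A', w, G', S', hmon, hcard⟩ := S.exists_monomials he hrel D
    choose a ha using hmon
    have hinj : Function.Injective a := by
      intro x y hxy
      by_contra hne
      have hsingle : ∀ z, app 0 (Pi.single z 1) w = w z := fun z => by
        rw [app, Finset.sum_eq_single z]
        · rw [Pi.single_eq_same, map_one, one_mul]
        · intro b _ hb
          rw [Pi.single_eq_of_ne hb, map_zero, zero_mul]
        · exact fun h => absurd (Finset.mem_univ z) h
      have := S'.indep (Pi.single x 1 - Pi.single y 1) (by
        have hsub : app 0 (Pi.single x 1 - Pi.single y 1) w =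
            app 0 (Pi.single x 1) w - app 0 (Pi.single y 1) w := by
          simp only [app, Pi.sub_apply, map_sub, sub_mul, Finset.sum_sub_distrib]
        rw [hsub, hsingle, hsingle, ha, ha, hxy, sub_self])
      have := congrFun this x
      simp [hne] at this
    have := Fintype.card_le_of_injective a hinj
    rw [Fintype.card_fun, Fintype.card_fin] at this
    exact hcard.trans (Nat.mul_le_mul_left _ this)
  have hd : 1 ≤ Module.finrank ℚ K := Module.finrank_pos
  obtain ⟨d, hd⟩ : ∃ d, Module.finrank ℚ K = d + 1 := ⟨_, (Nat.sub_add_cancel hd).symm⟩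
  rw [hd, Nat.add_sub_cancel] at hbound
  rcases Nat.eq_zero_or_pos d with rfl | hd0
  · simpa using hbound 1
  · have hr : (1 : ℝ) < (d + 1) / d := by
      rw [one_lt_div (by positivity)]; linarith
    have hlim := (tendsto_pow_const_div_const_pow_of_one_lt (Fintype.card ι) hr).const_mul
      (2 ^ Fintype.card ι : ℝ)
    rw [mul_zero] at hlim
    obtain ⟨D, hD1, hD2⟩ := ((hlim.eventually_lt_const one_pos).and
      (Filter.eventually_ge_atTop 1)).exists
    have h1 : ((d : ℝ) + 1) ^ D ≤ d ^ D * (D + 1) ^ Fintype.card ι := by exact_mod_cast hbound D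
    have hdD : (0 : ℝ) < d ^ D := by positivity
    rw [← mul_div_assoc, div_pow, div_lt_one (by positivity), lt_div_iff₀ hdD, ← mul_pow] at hD1
    have h2 : ((D : ℝ) + 1) ^ Fintype.card ι ≤ (2 * D) ^ Fintype.card ι := by
      have : (1 : ℝ) ≤ D := by exact_mod_cast hD2
      gcongr
      linarith
    nlinarith [mul_le_mul_of_nonneg_left h2 hdD.le]

end Products

section Specialization

variable {K : Type*} [Field K] [NumberField K] [Algebra K ℂ] {ι : Type} [Fintype ι] {t : K[X]}
  {A : ι → ι → K[X]} {u : ι → PowerSeries K} {G : ι → ℂ → ℂ}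

/-- The point `1` is not special: the system has a full set of solutions in power series there. -/
theorem System.exists_basis (S : System t A u G) :
    ∃ (ρ : ℕ) (γ : Fin ρ → ℂ) (y : Fin ρ → ι → PowerSeries K), LinearIndependent K γ ∧
      LinearIndependent K y ∧ (∀ h, IsSol 1 t A (y h)) ∧
      (∀ i, tay 1 (G i) =
        ∑ h, PowerSeries.C (γ h) * PowerSeries.map (algebraMap K ℂ) (y h i)) ∧
      Fintype.card ι ≤ ρ := by
  obtain ⟨ρ, γ, y, h1, h2, h3, h4, -⟩ := S.exists_decomposition
  refine ⟨ρ, γ, y, h1, h2, h3, h4, ?_⟩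
  let f : (ι → PowerSeries K) →ₗ[PowerSeries K] (Fin ρ → PowerSeries K) :=
    LinearMap.pi fun h => ∑ i, (y h i) • LinearMap.proj i
  have hf : ∀ e h, f e h = ∑ i, y h i * e i := fun e h => by simp [f, LinearMap.sum_apply]
  have := card_le_of_injective (PowerSeries K) f (by
    rw [injective_iff_map_eq_zero]
    intro e he
    refine S.eq_zero_of_relation ?_
    simp only [h4, Finset.mul_sum]
    rw [Finset.sum_comm]
    refine Finset.sum_eq_zero fun h _ => ?_
    calc _ = PowerSeries.C (γ h) * PowerSeries.map (algebraMap K ℂ) (f e h) := by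
          rw [hf, map_sum, Finset.mul_sum]
          exact Finset.sum_congr rfl fun i _ => by rw [map_mul]; ring
      _ = 0 := by rw [he, Pi.zero_apply, map_zero, mul_zero])
  rwa [Fintype.card_fin] at this

/-- Linear relations with coefficients in `K` between values at `1` are preserved by conjugation. -/
theorem System.conj_relation (S : System t A u G) {c : ι → K}
    (h : ∑ i, algebraMap K ℂ (c i) * G i 1 = 0) (σ : K →+* ℂ) {G' : ι → ℂ → ℂ}
    (hG' : ∀ i, Differentiable ℂ (G' i)) (htay : ∀ i, tay 0 (G' i) = PowerSeries.map σ (u i)) :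
    ∑ i, σ (c i) * G' i 1 = 0 := by
  obtain ⟨ρ, γ, y, h1, h2, h3, h4, h5⟩ := S.exists_basis
  have hy : ∀ l, ∑ i, c i * PowerSeries.constantCoeff (y l i) = 0 := by
    rw [Fintype.linearIndependent_iff] at h1
    refine h1 _ ?_
    rw [← h]
    have : ∀ i, G i 1 = ∑ l, γ l * algebraMap K ℂ (PowerSeries.constantCoeff (y l i)) := by
      intro i
      refine (constantCoeff_tay 1 (G i)).symm.trans ?_
      rw [h4, map_sum]
      refine Finset.sum_congr rfl fun l _ => ?_
      rw [map_mul, PowerSeries.constantCoeff_C, ← PowerSeries.coeff_zero_eq_constantCoeff_apply,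
        PowerSeries.coeff_map, PowerSeries.coeff_zero_eq_constantCoeff_apply]
    simp only [this, Algebra.smul_def, map_sum, map_mul, Finset.sum_mul, Finset.mul_sum]
    rw [Finset.sum_comm]
    exact Finset.sum_congr rfl fun i _ => Finset.sum_congr rfl fun l _ => by ring
  let Y : ι → PowerSeries ℂ := fun i => tay 1 (G' i)
  let v : Fin ρ → ι → PowerSeries ℂ := fun l i => PowerSeries.map σ (y l i)
  have hv : LinearIndependent ℂ v := by
    have := linearIndependent_map_of_injective (PowerSeries.map_injective σ σ.injective)
      (IsSol.linearIndependent S.ne_zero h3 h2)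
    exact this.restrict_scalars fun a b hab =>
      PowerSeries.C_injective (by simpa [Algebra.smul_def] using hab)
  have hvsol : ∀ l, IsSol 1 (t.map σ) (fun i k => (A i k).map σ) (v l) := fun l => by
    have := (h3 l).map σ
    rwa [map_one] at this
  have hYsol : IsSol 1 (t.map σ) (fun i k => (A i k).map σ) Y := by
    refine EFun.isSol_tay hG' (c := 0) ?_ 1
    simp only [htay]
    have := S.isSol.map σ
    rwa [map_zero] at this
  have hmem : Y ∈ Submodule.span ℂ (Set.range v) := by
    by_contra hcon
    have hLI := linearIndependent_option'.mpr ⟨hv, hcon⟩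
    have := IsSol.card_le ((Polynomial.map_ne_zero_iff σ.injective).mpr S.ne_zero)
      (by rintro (_ | l); exacts [hYsol, hvsol l]) hLI
    rw [Fintype.card_option, Fintype.card_fin] at this
    omega
  let L : (ι → PowerSeries ℂ) →ₗ[ℂ] ℂ :=
    ∑ i, σ (c i) • (PowerSeries.coeff (R := ℂ) 0 ∘ₗ LinearMap.proj i)
  have hL : ∀ z, L z = ∑ i, σ (c i) * PowerSeries.constantCoeff (z i) := fun z => by
    simp [L, LinearMap.sum_apply]
  have hLY : L Y = 0 := by
    have : Submodule.span ℂ (Set.range v) ≤ LinearMap.ker L := by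
      rw [Submodule.span_le]
      rintro _ ⟨l, rfl⟩
      rw [SetLike.mem_coe, LinearMap.mem_ker, hL, ← map_zero σ, ← hy l, map_sum]
      refine Finset.sum_congr rfl fun i _ => ?_
      rw [map_mul, ← PowerSeries.coeff_zero_eq_constantCoeff_apply,
        ← PowerSeries.coeff_zero_eq_constantCoeff_apply, PowerSeries.coeff_map]
    exact this hmem
  rw [hL] at hLY
  simpa only [Y, constantCoeff_tay] using hLY

end Specialization

section ESeries

open NumberField

variable {K : Type*} [Field K] [NumberField K]

/-- `φ` is a component of a vector of E-functions, one of them constant, that solves a linear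
differential system over `K(z)`. -/
def IsESeries (φ : PowerSeries K) : Prop :=
  ∃ (σ : Type) (_ : Fintype σ) (t : K[X]) (A : σ → σ → K[X]) (w : σ → PowerSeries K), t ≠ 0 ∧
    IsSol 0 t A w ∧ (∀ i, EType (w i)) ∧ (∃ i, w i = 1) ∧ ∃ i, w i = φ

theorem IsESeries.eType {φ : PowerSeries K} (h : IsESeries φ) : EType φ := by
  obtain ⟨σ, _, t, A, w, -, -, h, -, i, rfl⟩ := h
  exact h i

variable [Algebra K ℂ]

theorem IsESeries.exists_system {φ : PowerSeries K} (h : IsESeries φ)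
    (hφ : ∀ P Q : K[X], sh 0 P + sh 0 Q * φ = 0 → P = 0 ∧ Q = 0) :
    ∃ (ι : Type) (_ : Fintype ι) (t : K[X]) (A : ι → ι → K[X]) (u : ι → PowerSeries K)
      (G : ι → ℂ → ℂ) (i₀ i₁ : ι), System t A u G ∧ i₀ ≠ i₁ ∧ u i₀ = 1 ∧ u i₁ = φ := by
  classical
  obtain ⟨σ, _, t, A, w, ht, hw, hE, ⟨i₀, h0⟩, i₁, h1⟩ := h
  have hne : i₀ ≠ i₁ := by
    rintro rfl
    have := (hφ 1 (-1) (by rw [← h1, h0]; simp)).1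
    exact one_ne_zero this
  obtain ⟨s, q, B, A', hs, hq, hli, -, hsol⟩ :=
    exists_independent_subsystem_of_subset hw (s₀ := {i₀, i₁}) (by
      intro P hP
      rw [Finset.sum_pair hne, h0, h1, mul_one] at hP
      obtain ⟨ha, hb⟩ := hφ _ _ hP
      intro i hi
      rw [Finset.mem_insert, Finset.mem_singleton] at hi
      rcases hi with rfl | rfl <;> assumption)
  choose G hG htay using fun i : s => (hE i).exists_entire (algebraMap K ℂ)
  exact ⟨s, inferInstance, q * t, A', fun i => w i, G, ⟨i₀, hs (by simp)⟩, ⟨i₁, hs (by simp)⟩,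
    ⟨mul_ne_zero hq ht, fun i => hE i, hsol, hli, hG, htay⟩, by simpa using hne, h0, h1⟩

theorem IsESeries.conj_value {φ : PowerSeries K} (h : IsESeries φ)
    (hφ : ∀ P Q : K[X], sh 0 P + sh 0 Q * φ = 0 → P = 0 ∧ Q = 0) {f : ℂ → ℂ}
    (hf : Differentiable ℂ f) (hft : tay 0 f = PowerSeries.map (algebraMap K ℂ) φ) {β : K}
    (hβ : f 1 = algebraMap K ℂ β) (σ : K →+* ℂ) {F : ℂ → ℂ} (hF : Differentiable ℂ F)
    (hFt : tay 0 F = PowerSeries.map σ φ) : F 1 = σ β := by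
  classical
  obtain ⟨ι, _, t, A, u, G, i₀, i₁, S, hne, h0, h1⟩ := h.exists_system hφ
  choose G' hG' htay' using fun i : ι => (S.eType i).exists_entire σ
  have hsum : ∀ (τ : K →+* ℂ) (H : ι → ℂ → ℂ),
      ∑ i, τ (if i = i₀ then -β else if i = i₁ then 1 else 0) * H i 1 =
        -τ β * H i₀ 1 + H i₁ 1 := by
    intro τ H
    rw [← Finset.add_sum_erase _ _ (Finset.mem_univ i₀),
      ← Finset.add_sum_erase (Finset.univ.erase i₀) _
        (Finset.mem_erase.mpr ⟨hne.symm, Finset.mem_univ i₁⟩), Finset.sum_eq_zero]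
    · simp [hne.symm]
    · intro i hi
      simp only [Finset.mem_erase] at hi
      simp [hi.1, hi.2.1]
  have hone : ∀ (τ : K →+* ℂ) (H : ι → ℂ → ℂ), Differentiable ℂ (H i₀) →
      tay 0 (H i₀) = PowerSeries.map τ (u i₀) → H i₀ 1 = 1 := by
    intro τ H hH hH'
    rw [h0, map_one, ← map_one (PowerSeries.C (R := ℂ)), ← tay_const 0] at hH'
    rw [eq_of_tay_eq hH (differentiable_const _) hH']
  have e1 : G i₁ = f := eq_of_tay_eq (S.differentiable i₁) hf (c := 0) (by
    rw [S.tay_zero, hft, h1])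
  have e2 : G' i₁ = F := eq_of_tay_eq (hG' i₁) hF (c := 0) (by rw [htay', hFt, h1])
  have key := S.conj_relation (c := fun i => if i = i₀ then -β else if i = i₁ then 1 else 0) (by
    rw [hsum, hone _ _ (S.differentiable _) (S.tay_zero _), e1, hβ]; ring) σ hG' htay'
  rw [hsum, hone _ _ (hG' _) (htay' _), e2] at key
  linear_combination key

end ESeries

section Division

open NumberField

variable {K : Type*} [Field K] [NumberField K]

/-- The coefficients of `(φ - β) / (X - 1)`. -/
def divOne (φ : PowerSeries K) (β : K) : PowerSeries K :=
  PowerSeries.mk fun n => β - ∑ k ∈ Finset.range (n + 1), PowerSeries.coeff k φ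

theorem sh_mul_divOne (φ : PowerSeries K) (β : K) :
    sh 0 (Polynomial.X - 1) * divOne φ β = φ - PowerSeries.C β := by
  rw [map_sub, map_one, sh_X, map_zero, add_zero, sub_mul, one_mul]
  ext n
  rw [map_sub, map_sub]
  rcases n with _ | n
  · simp [divOne]
  · rw [PowerSeries.coeff_succ_X_mul, PowerSeries.coeff_C, if_neg (Nat.succ_ne_zero n), divOne,
      PowerSeries.coeff_mk, PowerSeries.coeff_mk, Finset.sum_range_succ _ (n + 1)]
    ring

theorem hasSum_coeff_divOne {φ : PowerSeries K} {β : K} {σ : K →+* ℂ} {F : ℂ → ℂ}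
    (hF : Differentiable ℂ F) (hFt : tay 0 F = PowerSeries.map σ φ) (h : F 1 = σ β) (n : ℕ) :
    HasSum (fun k => σ (PowerSeries.coeff (k + (n + 1)) φ))
      (σ (PowerSeries.coeff n (divOne φ β))) := by
  have h1 := hasSum_tay hF 0 1
  simp only [hFt, sub_zero, one_pow, mul_one, PowerSeries.coeff_map, h] at h1
  have h2 := (hasSum_nat_add_iff' (n + 1)).mpr h1
  rwa [divOne, PowerSeries.coeff_mk, map_sub, map_sum]

theorem norm_factorial_mul_coeff_divOne_le {φ : PowerSeries K} {β : K} {σ : K →+* ℂ} {F : ℂ → ℂ}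
    (hF : Differentiable ℂ F) (hFt : tay 0 F = PowerSeries.map σ φ) (h : F 1 = σ β) {C : ℝ}
    (hC : 1 ≤ C) (hφ : ∀ n, house ((n.factorial : K) * PowerSeries.coeff n φ) ≤ C ^ (n + 1))
    (n : ℕ) : ‖σ ((n.factorial : K) * PowerSeries.coeff n (divOne φ β))‖ ≤
      C ^ (n + 2) * Real.exp C := by
  have h1 := (hasSum_coeff_divOne hF hFt h n).mul_left (n.factorial : ℂ)
  have h2 : HasSum (fun k : ℕ => C ^ (n + 2) * (C ^ k / k.factorial)) (C ^ (n + 2) * Real.exp C) := by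
    rw [Real.exp_eq_exp_ℝ]
    exact (NormedSpace.expSeries_div_hasSum_exp C).mul_left _
  have h3 := h1.norm_le_of_bounded h2 fun k => by
    have hk := (norm_embedding_le_house _ σ).trans (hφ (k + (n + 1)))
    rw [map_mul, map_natCast, norm_mul, Complex.norm_natCast] at hk
    rw [norm_mul, Complex.norm_natCast]
    have hfac : ((n.factorial * k.factorial : ℕ) : ℝ) ≤ ((k + (n + 1)).factorial : ℕ) := by
      have h4 : n.factorial * k.factorial ≤ (n + k).factorial :=
        Nat.le_of_dvd (Nat.factorial_pos _) (Nat.factorial_mul_factorial_dvd_factorial_add n k)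
      exact_mod_cast h4.trans (Nat.factorial_le (by omega))
    rw [← mul_div_assoc, le_div_iff₀ (by exact_mod_cast k.factorial_pos)]
    calc _ = ((n.factorial * k.factorial : ℕ) : ℝ) *
          ‖σ (PowerSeries.coeff (k + (n + 1)) φ)‖ := by push_cast; ring
      _ ≤ _ := mul_le_mul_of_nonneg_right hfac (norm_nonneg _)
      _ ≤ _ := hk
      _ = _ := by rw [← pow_add]; congr 1; omega
  rwa [map_mul, map_natCast]

theorem EType.divOne {φ : PowerSeries K} (hE : EType φ) {β : K}
    (h : ∀ (σ : K →+* ℂ) (F : ℂ → ℂ), Differentiable ℂ F → tay 0 F = PowerSeries.map σ φ →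
      F 1 = σ β) : EType (divOne φ β) := by
  have hE' := hE
  obtain ⟨C, d, hC, hd⟩ := hE'
  obtain ⟨b, hb, hbβ⟩ := exists_natCast_mul_isIntegral β
  have hb1 : (1 : ℝ) ≤ b := by exact_mod_cast Nat.one_le_iff_ne_zero.mpr hb
  have he : 1 ≤ Real.exp C := Real.one_le_exp (by linarith)
  have hbe : 1 ≤ b * Real.exp C := one_le_mul_of_one_le_of_one_le hb1 he
  have hM : ∀ n : ℕ, b * Real.exp C * C ^ (n + 2) ≤ (b * Real.exp C * C ^ 2) ^ (n + 1) := by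
    intro n
    rw [mul_pow _ (C ^ 2), ← pow_mul]
    gcongr
    · exact le_self_pow₀ hbe (by omega)
    · omega
  refine ⟨b * Real.exp C * C ^ 2, fun n => b * d n,
    one_le_mul_of_one_le_of_one_le hbe (one_le_pow₀ hC), fun n =>
    ⟨house_le_of_forall fun σ => ?_, mul_ne_zero hb (hd n).2.1, ?_, fun m hm => ?_⟩⟩
  · obtain ⟨F, hF, hFt⟩ := hE.exists_entire σ
    refine (norm_factorial_mul_coeff_divOne_le hF hFt (h σ F hF hFt) hC (fun n => (hd n).1) n).trans
      (le_trans ?_ (hM n))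
    have : (0 : ℝ) ≤ C ^ (n + 2) := by positivity
    nlinarith [mul_le_mul_of_nonneg_right hb1 (mul_nonneg this (zero_le_one.trans he))]
  · refine le_trans ?_ (hM n)
    push_cast
    rw [mul_assoc]
    gcongr
    calc (d n : ℝ) ≤ C ^ (n + 1) := (hd n).2.2.1
      _ ≤ C ^ (n + 2) := pow_le_pow_right₀ hC (by omega)
      _ ≤ _ := le_mul_of_one_le_left (by positivity) he
  · have key : ((b * d n : ℕ) : K) * ((m.factorial : K) * PowerSeries.coeff m (EFun.divOne φ β)) =
        (d n : K) * (m.factorial : K) * ((b : K) * β) - ∑ k ∈ Finset.range (m + 1),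
          (b : K) * ((m.factorial / k.factorial : ℕ) : K) *
            ((d n : K) * ((k.factorial : K) * PowerSeries.coeff k φ)) := by
      rw [EFun.divOne, PowerSeries.coeff_mk, mul_sub, mul_sub, Finset.mul_sum, Finset.mul_sum]
      congr 1
      · push_cast; ring
      · refine Finset.sum_congr rfl fun k hk => ?_
        have hk' : k.factorial ∣ m.factorial :=
          Nat.factorial_dvd_factorial (by rw [Finset.mem_range] at hk; omega)
        have : ((m.factorial : ℕ) : K) = ((m.factorial / k.factorial : ℕ) : K) * (k.factorial : K) := by
          rw [← Nat.cast_mul, Nat.div_mul_cancel hk']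
        rw [this]; push_cast; ring
    rw [key]
    refine (((EFun.isIntegral_natCast _).mul (EFun.isIntegral_natCast _)).mul hbβ).sub
      (IsIntegral.sum _ fun k hk => ((EFun.isIntegral_natCast _).mul
        (EFun.isIntegral_natCast _)).mul ((hd n).2.2.2 k ?_))
    rw [Finset.mem_range] at hk
    omega

theorem IsESeries.divOne {φ : PowerSeries K} (hφ : IsESeries φ) {β : K}
    (h : ∀ (σ : K →+* ℂ) (F : ℂ → ℂ), Differentiable ℂ F → tay 0 F = PowerSeries.map σ φ →
      F 1 = σ β) : IsESeries (divOne φ β) := by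
  classical
  have hE := hφ.eType.divOne h
  obtain ⟨σ, _, t, A, w, ht, hw, hwE, ⟨i₀, h0⟩, i₁, h1⟩ := hφ
  have hX : (Polynomial.X - 1 : K[X]) ≠ 0 := Polynomial.X_sub_C_ne_zero 1
  refine ⟨Option σ, inferInstance, t * (Polynomial.X - 1), fun i k =>
    match i, k with
    | none, none => -t
    | none, some k => A i₁ k
    | some _, none => 0
    | some i, some k => (Polynomial.X - 1) * A i k,
    fun i => i.elim (EFun.divOne φ β) w, mul_ne_zero ht hX, ?_, ?_, ⟨some i₀, h0⟩, none, rfl⟩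
  · have hd := congrArg (PowerSeries.derivative K) (sh_mul_divOne φ β)
    rw [Derivation.leibniz, derivative_sh, map_sub (PowerSeries.derivative K)] at hd
    simp only [smul_eq_mul, Polynomial.derivative_sub, Polynomial.derivative_X,
      Polynomial.derivative_one, sub_zero, map_one, mul_one] at hd
    rw [show PowerSeries.derivative K (PowerSeries.C β) = 0 from PowerSeries.derivative_C,
      sub_zero] at hd
    rintro (_ | i)
    · have := hw i₁
      rw [h1] at this
      simp only [Fintype.sum_option, Option.elim, ← this, map_mul, map_neg]
      linear_combination sh 0 t * hd
    · simp only [Fintype.sum_option, Option.elim, map_mul, map_zero, zero_mul, zero_add]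
      rw [mul_comm (sh 0 t), mul_assoc, hw i, Finset.mul_sum]
      exact Finset.sum_congr rfl fun k _ => by ring
  · rintro (_ | i)
    exacts [hE, hwE i]

end Division

section Rescale

open NumberField

theorem rescale_sh {F : Type*} [Field F] (a : F) (p : F[X]) :
    PowerSeries.rescale a (sh 0 p) = sh 0 (p.comp (Polynomial.C a * Polynomial.X)) := by
  induction p using Polynomial.induction_on' with
  | add p q hp hq => simp [Polynomial.add_comp, hp, hq]
  | monomial n b =>
    rw [← Polynomial.C_mul_X_pow_eq_monomial]
    simp only [map_mul, map_pow, sh_C, sh_X, map_zero, add_zero, Polynomial.mul_comp,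
      Polynomial.C_comp, Polynomial.pow_comp, Polynomial.X_comp, PowerSeries.rescale_X]
    congr 1
    ext m
    rw [PowerSeries.coeff_rescale, PowerSeries.coeff_C]
    split_ifs with h <;> simp [h]

theorem independent_rescale {F : Type*} [Field F] {φ : PowerSeries F}
    (hind : ∀ P Q : F[X], sh 0 P + sh 0 Q * φ = 0 → P = 0 ∧ Q = 0) {a : F} (ha : a ≠ 0)
    (P Q : F[X]) (h : sh 0 P + sh 0 Q * PowerSeries.rescale a φ = 0) : P = 0 ∧ Q = 0 := by
  have hresc : PowerSeries.rescale a⁻¹ (PowerSeries.rescale a φ) = φ := by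
    rw [PowerSeries.rescale_rescale, mul_inv_cancel₀ ha, PowerSeries.rescale_one]; rfl
  have h' := congrArg (PowerSeries.rescale a⁻¹) h
  rw [map_add, map_mul, hresc, rescale_sh, rescale_sh, map_zero] at h'
  have hz : a⁻¹ ∈ nonZeroDivisors F := mem_nonZeroDivisors_of_ne_zero (inv_ne_zero ha)
  have := hind _ _ h'
  rwa [Polynomial.comp_C_mul_X_eq_zero_iff hz, Polynomial.comp_C_mul_X_eq_zero_iff hz] at this

theorem derivative_rescale {F : Type*} [Field F] (a : F) (φ : PowerSeries F) :
    PowerSeries.derivative F (PowerSeries.rescale a φ) =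
      PowerSeries.C a * PowerSeries.rescale a (PowerSeries.derivative F φ) := by
  ext n
  rw [PowerSeries.coeff_derivative, PowerSeries.coeff_rescale, PowerSeries.coeff_C_mul,
    PowerSeries.coeff_rescale, PowerSeries.coeff_derivative, pow_succ]
  ring

theorem map_rescale {F L : Type*} [Field F] [Field L] (σ : F →+* L) (a : F) (φ : PowerSeries F) :
    PowerSeries.map σ (PowerSeries.rescale a φ) =
      PowerSeries.rescale (σ a) (PowerSeries.map σ φ) := by
  ext n
  simp [PowerSeries.coeff_rescale]

theorem differentiable_and_tay_comp_mul {f : ℂ → ℂ} (hf : Differentiable ℂ f) (a : ℂ) :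
    Differentiable ℂ (fun z => f (a * z)) ∧
      tay 0 (fun z => f (a * z)) = PowerSeries.rescale a (tay 0 f) := by
  obtain ⟨h1, h2⟩ := differentiable_and_tay_of_hasSum
    (c := fun n => PowerSeries.coeff n (PowerSeries.rescale a (tay 0 f)))
    (G := fun z => f (a * z)) fun z => by
      have := hasSum_tay hf 0 (a * z)
      simp only [sub_zero, mul_pow] at this
      convert this using 2 with n
      rw [PowerSeries.coeff_rescale]
      ring
  exact ⟨h1, h2.trans (by ext n; simp)⟩

variable {K : Type*} [Field K] [NumberField K]

theorem EType.rescale {φ : PowerSeries K} (hφ : EType φ) (a : K) :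
    EType (PowerSeries.rescale a φ) := by
  obtain ⟨C, d, hC, hd⟩ := hφ
  obtain ⟨b, hb, hba⟩ := exists_natCast_mul_isIntegral a
  have hb1 : (1 : ℝ) ≤ b := by exact_mod_cast Nat.one_le_iff_ne_zero.mpr hb
  set B : ℝ := b * max 1 (house a) with hB
  have hm : (1 : ℝ) ≤ max 1 (house a) := le_max_left _ _
  have hB1 : 1 ≤ B := one_le_mul_of_one_le_of_one_le hb1 hm
  have hbB : (b : ℝ) ≤ B := le_mul_of_one_le_right (by positivity) hm
  have haB : house a ≤ B := (le_max_right _ _).trans (le_mul_of_one_le_left (by positivity) hb1)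
  refine ⟨C * B, fun n => d n * b ^ n, one_le_mul_of_one_le_of_one_le hC hB1, fun n =>
    ⟨house_le_of_forall fun σ => ?_, mul_ne_zero (hd n).2.1 (pow_ne_zero _ hb), ?_,
      fun m hm => ?_⟩⟩
  · rw [PowerSeries.coeff_rescale, mul_left_comm, map_mul, norm_mul, mul_comm, mul_pow, map_pow,
      norm_pow]
    refine mul_le_mul ((norm_embedding_le_house _ σ).trans (hd n).1) ?_ (by positivity)
      (by positivity)
    calc _ ≤ B ^ n := pow_le_pow_left₀ (norm_nonneg _) ((norm_embedding_le_house _ σ).trans haB) n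
      _ ≤ _ := pow_le_pow_right₀ hB1 (by omega)
  · push_cast
    rw [mul_pow]
    refine mul_le_mul (hd n).2.2.1 ?_ (by positivity) (by positivity)
    calc _ ≤ B ^ n := pow_le_pow_left₀ (by positivity) hbB n
      _ ≤ _ := pow_le_pow_right₀ hB1 (by omega)
  · have : ((d n * b ^ n : ℕ) : K) *
        ((m.factorial : K) * PowerSeries.coeff m (PowerSeries.rescale a φ)) =
        ((b ^ (n - m) : ℕ) : K) * ((b : K) * a) ^ m *
          ((d n : K) * ((m.factorial : K) * PowerSeries.coeff m φ)) := by
      obtain ⟨k, rfl⟩ := Nat.exists_eq_add_of_le hm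
      rw [PowerSeries.coeff_rescale, Nat.add_sub_cancel_left]
      push_cast
      ring
    rw [this]
    exact ((EFun.isIntegral_natCast _).mul (hba.pow m)).mul ((hd n).2.2.2 m hm)

theorem IsESeries.rescale {φ : PowerSeries K} (hφ : IsESeries φ) {a : K} (ha : a ≠ 0) :
    IsESeries (PowerSeries.rescale a φ) := by
  obtain ⟨σ, _, t, A, w, ht, hw, hwE, ⟨i₀, h0⟩, i₁, h1⟩ := hφ
  refine ⟨σ, inferInstance, t.comp (Polynomial.C a * Polynomial.X), fun i k =>
    Polynomial.C a * (A i k).comp (Polynomial.C a * Polynomial.X),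
    fun i => PowerSeries.rescale a (w i), ?_, fun i => ?_, fun i => (hwE i).rescale a,
    ⟨i₀, by simp only [h0, map_one]⟩, i₁, by simp only [h1]⟩
  · rw [Ne, Polynomial.comp_C_mul_X_eq_zero_iff]
    · exact ht
    · exact mem_nonZeroDivisors_of_ne_zero ha
  · simp only [derivative_rescale, map_mul, ← rescale_sh, sh_C]
    rw [mul_left_comm, ← map_mul, hw i, map_sum, Finset.mul_sum]
    exact Finset.sum_congr rfl fun k _ => by rw [map_mul]; ring

theorem EType.C (a : K) : EType (PowerSeries.C a) := by
  obtain ⟨b, hb, hba⟩ := exists_natCast_mul_isIntegral a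
  have hb1 : (1 : ℝ) ≤ b := by exact_mod_cast Nat.one_le_iff_ne_zero.mpr hb
  have hm : (1 : ℝ) ≤ max 1 (house a) := le_max_left _ _
  have hB1 : 1 ≤ b * max 1 (house a) := one_le_mul_of_one_le_of_one_le hb1 hm
  have hbB : (b : ℝ) ≤ b * max 1 (house a) := le_mul_of_one_le_right (by positivity) hm
  have haB : house a ≤ b * max 1 (house a) :=
    (le_max_right _ _).trans (le_mul_of_one_le_left (by positivity) hb1)
  refine ⟨b * max 1 (house a), fun _ => b, hB1, fun n => ⟨?_, hb, ?_, fun m _ => ?_⟩⟩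
  · rw [PowerSeries.coeff_C]
    split_ifs with h
    · simpa [h] using haB
    · rw [mul_zero, house_zero]; positivity
  · exact hbB.trans (le_self_pow₀ hB1 (by omega))
  · rw [PowerSeries.coeff_C]
    split_ifs with h
    · simpa [h] using hba
    · simpa using isIntegral_zero

theorem IsESeries.C_mul {φ : PowerSeries K} (hφ : IsESeries φ) (a : K) :
    IsESeries (PowerSeries.C a * φ) := by
  have hE := (EType.C a).mul hφ.eType
  obtain ⟨σ, _, t, A, w, ht, hw, hwE, ⟨i₀, h0⟩, i₁, h1⟩ := hφ
  refine ⟨Option σ, inferInstance, t, fun i k =>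
    k.elim 0 fun k => i.elim (Polynomial.C a * A i₁ k) fun i => A i k,
    fun i => i.elim (PowerSeries.C a * φ) w, ht, ?_, ?_, ⟨some i₀, h0⟩, none, rfl⟩
  · rintro (_ | i)
    · have := hw i₁
      simp only [Fintype.sum_option, Option.elim, map_zero, zero_mul, zero_add, map_mul, sh_C,
        Derivation.leibniz, PowerSeries.derivative_C, smul_eq_mul, mul_zero, add_zero]
      rw [← h1, mul_left_comm, this, Finset.mul_sum]
      exact Finset.sum_congr rfl fun k _ => by ring
    · simpa only [Fintype.sum_option, Option.elim, map_zero, zero_mul, zero_add] using hw i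
  · rintro (_ | i)
    exacts [hE, hwE i]

variable [Algebra K ℂ]

/-- An E-function with algebraic value `β` at a nonzero algebraic point `a` has the form
`β + (z - a) g(z)`, where `g` is an E-function. -/
theorem IsESeries.exists_eq_add_sub_mul {φ : PowerSeries K} (hφ : IsESeries φ)
    (hind : ∀ P Q : K[X], sh 0 P + sh 0 Q * φ = 0 → P = 0 ∧ Q = 0) {f : ℂ → ℂ}
    (hf : Differentiable ℂ f) (hft : tay 0 f = PowerSeries.map (algebraMap K ℂ) φ) {a β : K}
    (ha : a ≠ 0) (hβ : f (algebraMap K ℂ a) = algebraMap K ℂ β) :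
    ∃ (ψ : PowerSeries K) (g : ℂ → ℂ), IsESeries ψ ∧ Differentiable ℂ g ∧
      tay 0 g = PowerSeries.map (algebraMap K ℂ) ψ ∧
      ∀ z, f z = algebraMap K ℂ β + (z - algebraMap K ℂ a) * g z := by
  set a' : ℂ := algebraMap K ℂ a with ha'
  have ha0 : a' ≠ 0 := by rwa [ha', Ne, map_eq_zero]
  have hind' := independent_rescale hind ha
  obtain ⟨h1, h2⟩ := differentiable_and_tay_comp_mul hf a'
  have h2' : tay 0 (fun z => f (a' * z)) =
      PowerSeries.map (algebraMap K ℂ) (PowerSeries.rescale a φ) := by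
    rw [h2, hft, map_rescale]
  have hdiv := (hφ.rescale ha).divOne fun σ F hF hFt =>
    (hφ.rescale ha).conj_value hind' h1 h2' (β := β) (by simpa using hβ) σ hF hFt
  obtain ⟨G, hG, hGt⟩ := hdiv.eType.exists_entire (algebraMap K ℂ)
  have hfac : (fun z => f (a' * z)) =
      (fun _ => algebraMap K ℂ β) + (fun z => (Polynomial.X - 1 : ℂ[X]).eval z) * G := by
    have hp : Differentiable ℂ fun z => (Polynomial.X - 1 : ℂ[X]).eval z :=
      (Polynomial.X - 1 : ℂ[X]).differentiable
    refine eq_of_tay_eq h1 ((differentiable_const _).add (hp.mul hG)) (c := 0) ?_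
    rw [tay_add (differentiable_const _) (hp.mul hG), tay_mul hp hG, tay_const, tay_eval, h2', hGt]
    have := congrArg (PowerSeries.map (algebraMap K ℂ))
      (sh_mul_divOne (PowerSeries.rescale a φ) β)
    rw [map_mul, map_sub (PowerSeries.map _), map_sh, PowerSeries.map_C, map_zero,
      Polynomial.map_sub, Polynomial.map_X, Polynomial.map_one] at this
    rw [this]
    ring
  obtain ⟨h3, h4⟩ := differentiable_and_tay_comp_mul hG a'⁻¹
  refine ⟨_, fun z => a'⁻¹ * G (a'⁻¹ * z), (hdiv.rescale (inv_ne_zero ha)).C_mul a⁻¹,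
    h3.const_mul _, ?_, fun z => ?_⟩
  · refine (tay_mul (differentiable_const a'⁻¹) h3 0).trans ?_
    rw [tay_const, h4, hGt, map_mul, map_rescale, PowerSeries.map_C, map_inv₀ (algebraMap K ℂ)]
  · have := congrFun hfac (a'⁻¹ * z)
    simp only [mul_inv_cancel_left₀ ha0, Pi.add_apply, Pi.mul_apply, Polynomial.eval_sub,
      Polynomial.eval_X, Polynomial.eval_one] at this
    rw [this]
    field_simp

end Rescale

section Companion

variable {K L : Type*} [Field K] [Field L] (i : K →+* L)

/-- The companion matrix of a scalar equation with coefficients `Q`, bordered by zeros. -/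
def companion {k : ℕ} (Q : Fin (k + 2) → K[X]) : Option (Fin (k + 1)) → Option (Fin (k + 1)) → K[X]
  | none, _ => 0
  | some _, none => 0
  | some j, some l => if (j : ℕ) < k then if (l : ℕ) = j + 1 then Q (Fin.last _) else 0
      else -Q l.castSucc

/-- The vector `(1, y, y', …, y⁽ᵏ⁾)`. -/
def jet (k : ℕ) (y : PowerSeries L) : Option (Fin (k + 1)) → PowerSeries L
  | none => 1
  | some j => (PowerSeries.derivative L)^[j] y

theorem isSol_companion {k : ℕ} {Q : Fin (k + 2) → K[X]} {y : PowerSeries L}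
    (h : ∑ j, sh 0 ((Q j).map i) * (PowerSeries.derivative L)^[j] y = 0) :
    IsSol 0 ((Q (Fin.last _)).map i) (fun a b => (companion Q a b).map i) (jet k y) := by
  rintro (_ | j)
  · simp only [companion, Polynomial.map_zero, map_zero, zero_mul, Finset.sum_const_zero, jet]
    rw [← map_one PowerSeries.C, PowerSeries.derivative_C, mul_zero]
  · simp only [Fintype.sum_option, companion, Polynomial.map_zero, map_zero, zero_mul, zero_add, jet]
    rw [← Function.iterate_succ_apply' (PowerSeries.derivative L)]
    by_cases hj : (j : ℕ) < k
    · rw [Finset.sum_eq_single (⟨j + 1, by omega⟩ : Fin (k + 1))]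
      · simp [hj]
      · intro l _ hl
        have : (l : ℕ) ≠ j + 1 := fun e => hl (Fin.ext e)
        simp [hj, this]
      · simp
    · have hjk : (j : ℕ) = k := by omega
      rw [Fin.sum_univ_castSucc] at h
      simp only [hjk, lt_irrefl, if_false, Polynomial.map_neg, map_neg, neg_mul,
        Finset.sum_neg_distrib]
      simp only [Fin.val_last, Fin.val_castSucc] at h
      linear_combination h

theorem exists_relation_of_positive_order {r : ℕ} {P : Fin (r + 1) → K[X]} (hP : ∃ j, P j ≠ 0)
    {y : PowerSeries L} (h : ∑ j, sh 0 ((P j).map i) * (PowerSeries.derivative L)^[j] y = 0) :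
    ∃ (k : ℕ) (Q : Fin (k + 2) → K[X]), Q (Fin.last _) ≠ 0 ∧
      ∑ j, sh 0 ((Q j).map i) * (PowerSeries.derivative L)^[j] y = 0 := by
  induction r with
  | zero =>
    obtain ⟨j, hj⟩ := hP
    obtain rfl : j = 0 := by omega
    have hy : y = 0 := by
      simpa [sh_ne_zero _ ((Polynomial.map_ne_zero_iff i.injective).mpr hj)] using h
    refine ⟨0, fun j => if j = 0 then 0 else 1, by simp, ?_⟩
    rw [Fin.sum_univ_two, hy]
    simp
  | succ r ih =>
    by_cases hl : P (Fin.last _) = 0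
    · refine ih (P := fun j => P j.castSucc) ?_ ?_
      · obtain ⟨j, hj⟩ := hP
        refine Fin.lastCases (fun h0 => absurd hl h0) (fun j hj => ⟨j, hj⟩) j hj
      · rw [Fin.sum_univ_castSucc, hl] at h
        simpa using h
    · exact ⟨r, P, hl, h⟩

end Companion

section NumberFields

/-- The algebraic numbers in a finite-dimensional space over a number field lie in a number
field. -/
theorem exists_finiteDimensional_of_span (K : IntermediateField ℚ ℂ) [FiniteDimensional ℚ K]
    {ρ : ℕ} (γ : Fin ρ → ℂ) : ∃ K' : IntermediateField ℚ ℂ, FiniteDimensional ℚ K' ∧ K ≤ K' ∧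
      ∀ x ∈ Submodule.span K (Set.range γ), IsAlgebraic ℚ x → x ∈ K' := by
  let W : Submodule ℚ ℂ := (Submodule.span K (Set.range γ)).restrictScalars ℚ
  have : FiniteDimensional ℚ W := by
    have h1 : FiniteDimensional K (Submodule.span K (Set.range γ)) :=
      FiniteDimensional.span_of_finite K (Set.finite_range γ)
    exact FiniteDimensional.trans ℚ K (Submodule.span K (Set.range γ))
  let M : Submodule ℚ ℂ := W ⊓ (algebraicClosure ℚ ℂ).toSubalgebra.toSubmodule
  have hMfin : FiniteDimensional ℚ M := Submodule.finiteDimensional_inf_left _ _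
  obtain ⟨s, hs⟩ := (Submodule.fg_iff_finiteDimensional M).mpr hMfin
  have hfin : FiniteDimensional ℚ (IntermediateField.adjoin ℚ (s : Set ℂ)) :=
    IntermediateField.finiteDimensional_adjoin fun x hx => by
      have : x ∈ M := hs ▸ Submodule.subset_span hx
      exact (mem_algebraicClosure_iff'.mp this.2)
  refine ⟨K ⊔ IntermediateField.adjoin ℚ (s : Set ℂ), inferInstance, le_sup_left,
    fun x hx hxa => ?_⟩
  have hxM : x ∈ M := ⟨hx, mem_algebraicClosure_iff.mpr hxa⟩
  rw [← hs] at hxM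
  have hle : Submodule.span ℚ (s : Set ℂ) ≤
      (IntermediateField.adjoin ℚ (s : Set ℂ)).toSubalgebra.toSubmodule :=
    Submodule.span_le.mpr (IntermediateField.subset_adjoin ℚ _)
  exact (le_sup_right : IntermediateField.adjoin ℚ (s : Set ℂ) ≤ _) (hle hxM)

theorem exists_finiteDimensional_of_finset (s : Finset ℂ) (hs : ∀ x ∈ s, IsAlgebraic ℚ x) :
    ∃ K : IntermediateField ℚ ℂ, FiniteDimensional ℚ K ∧ ∀ x ∈ s, x ∈ K :=
  ⟨IntermediateField.adjoin ℚ (s : Set ℂ),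
    IntermediateField.finiteDimensional_adjoin fun x hx => (hs x hx).isIntegral,
    fun _ hx => IntermediateField.subset_adjoin ℚ _ hx⟩

theorem numberField_of_finiteDimensional (K : IntermediateField ℚ ℂ) [FiniteDimensional ℚ K] :
    NumberField K := ⟨⟩

theorem exists_ringHom_extension {K L : Type*} [Field K] [Field L] [Algebra K L]
    [Algebra.IsAlgebraic K L] (σ : K →+* ℂ) : ∃ τ : L →+* ℂ, ∀ x, τ (algebraMap K L x) = σ x := by
  let := σ.toAlgebra
  exact ⟨(IsAlgClosed.lift : L →ₐ[K] ℂ).toRingHom,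
    fun x => (IsAlgClosed.lift : L →ₐ[K] ℂ).commutes x⟩

theorem exists_polynomial_lift (K : IntermediateField ℚ ℂ) {p : ℂ[X]} (h : ∀ i, p.coeff i ∈ K) :
    ∃ q : K[X], q.map (algebraMap K ℂ) = p := by
  rw [← Polynomial.mem_lifts, Polynomial.lifts_iff_coeff_lifts]
  exact fun n => ⟨⟨_, h n⟩, rfl⟩

end NumberFields

section Iterate

theorem differentiable_iteratedDeriv {f : ℂ → ℂ} (hf : Differentiable ℂ f) (j : ℕ) :
    Differentiable ℂ (iteratedDeriv j f) := by
  induction j with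
  | zero => simpa
  | succ j ih => rw [iteratedDeriv_succ]; exact ih.deriv

theorem tay_iteratedDeriv (f : ℂ → ℂ) (c : ℂ) (j : ℕ) :
    tay c (iteratedDeriv j f) = (PowerSeries.derivative ℂ)^[j] (tay c f) := by
  induction j with
  | zero => simp
  | succ j ih => rw [iteratedDeriv_succ, ← derivative_tay, ih, Function.iterate_succ_apply']

theorem map_iterate_derivative {K L : Type*} [Field K] [Field L] (i : K →+* L)
    (y : PowerSeries K) (j : ℕ) : PowerSeries.map i ((PowerSeries.derivative K)^[j] y) =
      (PowerSeries.derivative L)^[j] (PowerSeries.map i y) := by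
  induction j with
  | zero => rfl
  | succ j ih => rw [Function.iterate_succ_apply', Function.iterate_succ_apply', map_derivative, ih]

theorem ode_iff {f : ℂ → ℂ} (hf : Differentiable ℂ f) {n : ℕ} (p : Fin n → ℂ[X]) :
    (∀ z : ℂ, ∑ j, (p j).eval z * iteratedDeriv (j : ℕ) f z = 0) ↔
      ∑ j, sh 0 (p j) * (PowerSeries.derivative ℂ)^[j] (tay 0 f) = 0 := by
  have hG : ∀ j : Fin n, Differentiable ℂ (iteratedDeriv (j : ℕ) f) := fun j =>
    differentiable_iteratedDeriv hf j
  have h := tay_sum_eval_mul hG p 0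
  simp only [tay_iteratedDeriv, app] at h
  rw [← h]
  constructor
  · intro h0
    rw [show (fun z => ∑ j, (p j).eval z * iteratedDeriv (j : ℕ) f z) = fun _ => 0 from
      funext h0, tay_const, map_zero]
  · intro h0 z
    have := eq_of_tay_eq (differentiable_sum_eval_mul hG p) (differentiable_const 0) (c := 0)
      (by rw [h0, tay_const, map_zero])
    exact congrFun this z

end Iterate

section EFunctions

open NumberField

theorem _root_.IsEFunctionWith.differentiable_and_tay {a : ℕ → Qbar} {f : ℂ → ℂ}
    (h : IsEFunctionWith a f) : Differentiable ℂ f ∧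
      tay 0 f = PowerSeries.mk fun n => (a n : ℂ) / n.factorial :=
  differentiable_and_tay_of_hasSum h.1

theorem isAlgebraic_of_mem {K : IntermediateField ℚ ℂ} [NumberField K] {x : ℂ} (hx : x ∈ K) :
    IsAlgebraic ℚ x :=
  (Algebra.IsAlgebraic.isAlgebraic (R := ℚ) (⟨x, hx⟩ : K)).algHom K.val

theorem exists_qbar_extension {K : IntermediateField ℚ ℂ} [NumberField K] (σ : K →+* ℂ) :
    ∃ τ : Qbar →+* ℂ, ∀ (x : Qbar) (y : K), (x : ℂ) = y → τ x = σ y := by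
  have hle : K ≤ Qbar := fun x hx => mem_algebraicClosure_iff.mpr (isAlgebraic_of_mem hx)
  let : Algebra K Qbar := (IntermediateField.inclusion hle).toRingHom.toAlgebra
  have : Algebra.IsAlgebraic ℚ Qbar := algebraicClosure.isAlgebraic ℚ ℂ
  have : Algebra.IsAlgebraic K Qbar := Algebra.IsAlgebraic.tower_top (K := ℚ) K
  obtain ⟨τ, hτ⟩ := exists_ringHom_extension (L := Qbar) σ
  refine ⟨τ, fun x y h => ?_⟩
  rw [← hτ y]
  congr 1
  exact Subtype.ext h

theorem _root_.IsEFunctionWith.eType {a : ℕ → Qbar} {f : ℂ → ℂ} (h : IsEFunctionWith a f)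
    {K : IntermediateField ℚ ℂ} [NumberField K] {φ : PowerSeries K}
    (hφ : ∀ n, ((n.factorial : K) * PowerSeries.coeff n φ : K) = (a n : ℂ)) : EType φ := by
  obtain ⟨-, ⟨C, hC, hC'⟩, ⟨D, hD, d, hd, hd'⟩, -⟩ := h
  refine ⟨max 1 (max C D), d, le_max_left _ _, fun n => ⟨?_, (hd n).1, ?_, fun m hm => ?_⟩⟩
  · refine house_le_of_forall fun σ => ?_
    obtain ⟨τ, hτ⟩ := exists_qbar_extension σ
    rw [← hτ (a n) _ (hφ n).symm]
    exact (hC' τ n).trans (pow_le_pow_left₀ hC.le ((le_max_left _ _).trans (le_max_right _ _)) _)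
  · exact (hd n).2.trans (pow_le_pow_left₀ hD.le ((le_max_right _ _).trans (le_max_right _ _)) _)
  · rw [← isIntegral_algebraMap_iff (algebraMap K ℂ).injective]
    have := hd' n m hm
    rwa [← hφ m] at this

theorem isESeries_of_ode {K : Type*} [Field K] [NumberField K] {φ : PowerSeries K} (hφ : EType φ)
    {k : ℕ} {Q : Fin (k + 2) → K[X]} (hQ : Q (Fin.last _) ≠ 0)
    (h : ∑ j, sh 0 (Q j) * (PowerSeries.derivative K)^[j] φ = 0) : IsESeries φ := by
  refine ⟨Option (Fin (k + 1)), inferInstance, Q (Fin.last _), companion Q, jet k φ, hQ, ?_, ?_,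
    ⟨none, rfl⟩, some 0, rfl⟩
  · have := isSol_companion (RingHom.id K) (Q := Q) (y := φ) (by simpa using h)
    simpa using this
  · have hit : ∀ j, EType ((PowerSeries.derivative K)^[j] φ) := fun j => by
      induction j with
      | zero => exact hφ
      | succ j ih => rw [Function.iterate_succ_apply']; exact ih.derivative
    rintro (_ | j)
    exacts [EType.one, hit j]

/-- An E-function has a power series in the sense of `IsESeries` over every sufficiently large
number field. -/
theorem _root_.IsEFunction.exists_isESeries {f : ℂ → ℂ} (hf : IsEFunction f) :
    Differentiable ℂ f ∧ ∃ K₀ : IntermediateField ℚ ℂ, FiniteDimensional ℚ K₀ ∧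
      ∀ K : IntermediateField ℚ ℂ, K₀ ≤ K → ∀ [NumberField K],
        ∃ φ : PowerSeries K, IsESeries φ ∧ tay 0 f = PowerSeries.map (algebraMap K ℂ) φ := by
  classical
  obtain ⟨a, ha⟩ := hf
  obtain ⟨hdiff, htay⟩ := ha.differentiable_and_tay
  refine ⟨hdiff, ?_⟩
  obtain ⟨r, p, hp, ⟨j₀, hj₀⟩, hode⟩ := ha.2.2.2
  rw [ode_iff hdiff] at hode
  obtain ⟨K₁, hK₁, hmem⟩ := exists_finiteDimensional_of_finset
    (Finset.univ.biUnion fun j => (p j).coeffs) fun x hx => by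
      obtain ⟨j, -, hj⟩ := Finset.mem_biUnion.mp hx
      obtain ⟨n, -, rfl⟩ := Polynomial.mem_coeffs_iff.mp hj
      exact hp j n
  have hpK : ∀ K : IntermediateField ℚ ℂ, K₁ ≤ K → ∀ j n, (p j).coeff n ∈ K := by
    intro K hK j n
    by_cases h0 : (p j).coeff n = 0
    · rw [h0]; exact zero_mem K
    · exact hK (hmem _ (Finset.mem_biUnion.mpr ⟨j, Finset.mem_univ _,
        Polynomial.coeff_mem_coeffs h0⟩))
  have hlift : ∀ K : IntermediateField ℚ ℂ, K₁ ≤ K → ∃ (k : ℕ) (Q : Fin (k + 2) → K[X]),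
      Q (Fin.last _) ≠ 0 ∧
      ∑ j, sh 0 ((Q j).map (algebraMap K ℂ)) * (PowerSeries.derivative ℂ)^[j] (tay 0 f) = 0 := by
    intro K hK
    choose P hP using fun j => exists_polynomial_lift K (hpK K hK j)
    refine exists_relation_of_positive_order (algebraMap K ℂ) (P := P) ⟨j₀, fun h0 => hj₀ ?_⟩ ?_
    · rw [← hP, h0, Polynomial.map_zero]
    · simpa only [hP] using hode
  obtain ⟨k, Q, hQ, hrel⟩ := hlift K₁ le_rfl
  have hsol := isSol_companion (algebraMap K₁ ℂ) hrel
  obtain ⟨ρ, γ, y, -, -, -, hy⟩ := EFun.exists_decomposition (c := 0) hQ (by rwa [map_zero])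
  obtain ⟨K₂, hK₂, hle, hmem₂⟩ := exists_finiteDimensional_of_span K₁ γ
  have haK : ∀ n, (a n : ℂ) ∈ K₂ := by
    intro n
    refine hmem₂ _ ?_ (mem_algebraicClosure_iff.mp (a n).2)
    have h1 := congrArg (PowerSeries.coeff n) (hy (some 0))
    rw [show jet k (tay 0 f) (some 0) = tay 0 f from rfl, htay, PowerSeries.coeff_mk, map_sum,
      div_eq_iff (by exact_mod_cast n.factorial_ne_zero)] at h1
    rw [h1, Finset.sum_mul]
    refine Submodule.sum_mem _ fun l _ => ?_
    have : PowerSeries.coeff n (PowerSeries.C (γ l) * PowerSeries.map (algebraMap K₁ ℂ)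
        (y l (some 0))) * (n.factorial : ℂ) =
        (PowerSeries.coeff n (y l (some 0)) * (n.factorial : K₁) : K₁) • γ l := by
      rw [PowerSeries.coeff_C_mul, PowerSeries.coeff_map, Algebra.smul_def, map_mul, map_natCast]
      ring
    rw [this]
    exact Submodule.smul_mem _ _ (Submodule.subset_span ⟨l, rfl⟩)
  refine ⟨K₂, hK₂, fun K hK _ => ?_⟩
  have htayK : tay 0 f = PowerSeries.map (algebraMap K ℂ)
      (PowerSeries.mk fun n => (⟨a n, hK (haK n)⟩ : K) / n.factorial) := by
    rw [htay]
    ext n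
    rw [PowerSeries.coeff_mk, PowerSeries.coeff_map, PowerSeries.coeff_mk, map_div₀, map_natCast]
    rfl
  refine ⟨_, ?_, htayK⟩
  have hE := ha.eType (K := K)
    (φ := PowerSeries.mk fun n => (⟨a n, hK (haK n)⟩ : K) / n.factorial) fun n => by
      rw [PowerSeries.coeff_mk, mul_div_cancel₀ _ (by exact_mod_cast n.factorial_ne_zero)]
  obtain ⟨k, Q, hQ, hrel⟩ := hlift K (hle.trans hK)
  refine isESeries_of_ode hE hQ (PowerSeries.map_injective _ (algebraMap K ℂ).injective ?_)
  rw [htayK] at hrel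
  rw [map_sum, map_zero, ← hrel]
  refine Finset.sum_congr rfl fun j _ => ?_
  rw [map_mul, map_sh, map_zero, map_iterate_derivative]

theorem IsESeries.isEFunction {K : IntermediateField ℚ ℂ} [NumberField K] {φ : PowerSeries K}
    (hφ : IsESeries φ) {f : ℂ → ℂ} (hf : Differentiable ℂ f)
    (hft : tay 0 f = PowerSeries.map (algebraMap K ℂ) φ) : IsEFunction f := by
  classical
  have hE := hφ.eType
  obtain ⟨C, d, hC, hd⟩ := hE
  have hle : K ≤ Qbar := fun x hx => mem_algebraicClosure_iff.mpr (isAlgebraic_of_mem hx)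
  let j : K →+* Qbar := (IntermediateField.inclusion hle).toRingHom
  have hj : ∀ x, (j x : ℂ) = algebraMap K ℂ x := fun _ => rfl
  refine ⟨fun n => j ((n.factorial : K) * PowerSeries.coeff n φ), fun z => ?_,
    ⟨C, by linarith, fun σ n => (norm_embedding_le_house _ (σ.comp j)).trans (hd n).1⟩,
    ⟨C, by linarith, d, fun n => (hd n).2.imp id And.left, fun n m hm => ?_⟩, ?_⟩
  · have := hasSum_tay hf 0 z
    simp only [hft, sub_zero, PowerSeries.coeff_map] at this
    convert this using 3 with n
    rw [hj, map_mul, map_natCast, mul_div_cancel_left₀ _ (by exact_mod_cast n.factorial_ne_zero)]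
  · have := ((hd n).2.2.2 m hm).map (algebraMap K ℂ).toIntAlgHom
    rw [hj]
    simpa using this
  · obtain ⟨σ, _, t, A, w, ht, hw, -, -, i, hi⟩ := hφ
    obtain ⟨q, hq, hrel⟩ := exists_scalar_ode t ht A (fun k => if k = i then 1 else 0)
    have hr := hrel 0 w hw
    have happ : app 0 (fun k => if k = i then (1 : K[X]) else 0) w = φ := by
      rw [app, Finset.sum_eq_single i]
      · simp [hi]
      · intro k _ hk; simp [hk]
      · simp
    rw [happ] at hr
    refine ⟨Fintype.card σ, fun l => (q l).map (algebraMap K ℂ), fun l n => ?_, ?_, ?_⟩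
    · rw [Polynomial.coeff_map]
      exact isAlgebraic_of_mem ((q l).coeff n).2
    · obtain ⟨l, hl⟩ := Function.ne_iff.mp hq
      exact ⟨l, (Polynomial.map_ne_zero_iff (algebraMap K ℂ).injective).mpr hl⟩
    · rw [ode_iff hf, hft]
      have := congrArg (PowerSeries.map (algebraMap K ℂ)) hr
      rw [map_sum, map_zero] at this
      rw [← this]
      refine Finset.sum_congr rfl fun l _ => ?_
      rw [map_mul, map_sh, map_zero, map_iterate_derivative]

end EFunctions

section Transcendence

theorem eval_eval_C (P : ℂ[X][X]) (y z : ℂ) :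
    (P.eval (Polynomial.C y)).eval z = P.eval₂ (Polynomial.evalRingHom z) y := by
  rw [← Polynomial.coe_evalRingHom, Polynomial.eval, Polynomial.hom_eval₂]
  simp

theorem _root_.IsAlgebraicFuncQbar.isAlgebraicFunc {f : ℂ → ℂ} (h : IsAlgebraicFuncQbar f) :
    IsAlgebraicFunc f := by
  obtain ⟨P, h0, -, h1⟩ := h
  exact ⟨P, h0, h1⟩

theorem _root_.IsAlgebraicFunc.add_mul {f g : ℂ → ℂ} (hg : IsAlgebraicFunc g) (p q : ℂ[X])
    (h : ∀ z, f z = p.eval z + q.eval z * g z) : IsAlgebraicFunc f := by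
  obtain ⟨P, hP, h0⟩ := hg
  refine ⟨Polynomial.taylor (-p) (P.scaleRoots q), ?_, fun z => ?_⟩
  · rw [Ne, Polynomial.taylor_eq_zero]
    exact Polynomial.scaleRoots_ne_zero hP q
  · have h1 := Polynomial.scaleRoots_eval₂_mul (p := P) (Polynomial.evalRingHom z) (g z) q
    rw [← eval_eval_C P, h0, mul_zero] at h1
    rw [eval_eval_C, Polynomial.taylor_apply, Polynomial.eval₂_comp, ← h1]
    congr 1
    simp [h z]

theorem linear_independence_of_transcendental {K : Type*} [Field K] [Algebra K ℂ] {f : ℂ → ℂ}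
    (hf : Differentiable ℂ f) (htr : ¬ IsAlgebraicFunc f) {φ : PowerSeries K}
    (hft : tay 0 f = PowerSeries.map (algebraMap K ℂ) φ) (P Q : K[X])
    (h : sh 0 P + sh 0 Q * φ = 0) : P = 0 ∧ Q = 0 := by
  set p := P.map (algebraMap K ℂ) with hp
  set q := Q.map (algebraMap K ℂ) with hq
  have h1 := congrArg (PowerSeries.map (algebraMap K ℂ)) h
  rw [map_add, map_mul, map_sh, map_sh, map_zero, map_zero, ← hft, ← tay_eval, ← tay_eval,
    ← tay_mul q.differentiable hf,
    ← tay_add p.differentiable (q.differentiable.mul hf)] at h1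
  have h2 := eq_of_tay_eq (p.differentiable.add (q.differentiable.mul hf))
    (differentiable_const 0) (c := 0) (by rw [tay_const, map_zero]; exact h1)
  have h3 : Polynomial.C p + Polynomial.C q * Polynomial.X = 0 := by
    by_contra hne
    refine htr ⟨_, hne, fun z => ?_⟩
    have := congrFun h2 z
    simpa using this
  have h4 : p = 0 := by simpa using congrArg (Polynomial.coeff · 0) h3
  have h5 : q = 0 := by simpa using congrArg (Polynomial.coeff · 1) h3
  exact ⟨(Polynomial.map_eq_zero _).mp h4, (Polynomial.map_eq_zero _).mp h5⟩

/-- An E-function with an algebraic value at a nonzero algebraic point can be divided there. -/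
theorem _root_.IsEFunction.exists_eq_add_sub_mul {f : ℂ → ℂ} (hf : IsEFunction f)
    (htr : ¬ IsAlgebraicFunc f) {a : ℂ} (ha : IsAlgebraic ℚ a) (ha0 : a ≠ 0)
    (hfa : IsAlgebraic ℚ (f a)) :
    ∃ g, IsEFunction g ∧ ∀ z, f z = f a + (z - a) * g z := by
  classical
  obtain ⟨hdiff, K₀, hK₀, hK⟩ := hf.exists_isESeries
  obtain ⟨K₁, hK₁, hmem⟩ := exists_finiteDimensional_of_finset {a, f a} (by simp [ha, hfa])
  have : NumberField ↥(K₀ ⊔ K₁) := numberField_of_finiteDimensional _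
  obtain ⟨φ, hφ, hft⟩ := hK (K₀ ⊔ K₁) le_sup_left
  have haK : a ∈ K₀ ⊔ K₁ := (le_sup_right : K₁ ≤ _) (hmem a (by simp))
  have hfaK : f a ∈ K₀ ⊔ K₁ := (le_sup_right : K₁ ≤ _) (hmem (f a) (by simp))
  obtain ⟨ψ, g, hψ, hg, hgt, h⟩ := hφ.exists_eq_add_sub_mul
    (linear_independence_of_transcendental hdiff htr hft) hdiff hft
    (a := (⟨a, haK⟩ : ↥(K₀ ⊔ K₁))) (β := ⟨f a, hfaK⟩) (fun h0 => ha0 (congrArg Subtype.val h0)) rfl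
  exact ⟨g, hψ.isEFunction hg hgt, h⟩

theorem exists_coeff_tay_one_not_isAlgebraic {f : ℂ → ℂ} {K₀ : IntermediateField ℚ ℂ}
    [FiniteDimensional ℚ K₀] (hK : ∀ K : IntermediateField ℚ ℂ, K₀ ≤ K → ∀ [NumberField K],
      ∃ φ : PowerSeries K, IsESeries φ ∧ tay 0 f = PowerSeries.map (algebraMap K ℂ) φ ∧
        ∀ P Q : K[X], sh 0 P + sh 0 Q * φ = 0 → P = 0 ∧ Q = 0) (hf : Differentiable ℂ f) :
    ∃ n, ¬ IsAlgebraic ℚ (PowerSeries.coeff n (tay 1 f)) := by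
  classical
  by_contra! hcon
  have := numberField_of_finiteDimensional K₀
  obtain ⟨φ, hφ, hft, hind⟩ := hK K₀ le_rfl
  obtain ⟨ι, _, t, A, u, G, i₀, i₁, S, -, -, h1⟩ := hφ.exists_system hind
  obtain ⟨ρ, γ, y, -, -, -, hy, -⟩ := S.exists_basis
  have hG : G i₁ = f := eq_of_tay_eq (S.differentiable i₁) hf (c := 0) (by
    rw [S.tay_zero, hft, h1])
  obtain ⟨K, hKfin, hle, hmem⟩ := exists_finiteDimensional_of_span K₀ γ
  have := numberField_of_finiteDimensional K
  have hcoeff : ∀ n, PowerSeries.coeff n (tay 1 f) ∈ K := by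
    intro n
    refine hmem _ ?_ (hcon n)
    rw [← hG, hy, map_sum]
    refine Submodule.sum_mem _ fun l _ => ?_
    rw [PowerSeries.coeff_C_mul, PowerSeries.coeff_map, mul_comm, ← Algebra.smul_def]
    exact Submodule.smul_mem _ _ (Submodule.subset_span ⟨l, rfl⟩)
  clear! ι
  obtain ⟨φ, hφ, hft, hind⟩ := hK K hle
  obtain ⟨ι, _, t, A, u, G, i₀, i₁, S, hne, h0, h1⟩ := hφ.exists_system hind
  have hG : G i₁ = f := eq_of_tay_eq (S.differentiable i₁) hf (c := 0) (by
    rw [S.tay_zero, hft, h1])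
  have hG₀ : G i₀ = fun _ => 1 := eq_of_tay_eq (S.differentiable i₀) (differentiable_const _)
    (c := 0) (by rw [S.tay_zero, h0, map_one, tay_const, map_one])
  let e : PowerSeries K := PowerSeries.mk fun n => ⟨_, hcoeff n⟩
  have he : PowerSeries.map (algebraMap K ℂ) e = tay 1 f := by
    ext n
    rw [PowerSeries.coeff_map, PowerSeries.coeff_mk]
    rfl
  have := S.eq_zero_of_relation
    (e := fun i => if i = i₀ then e else if i = i₁ then -1 else 0) (by
      rw [← Finset.add_sum_erase _ _ (Finset.mem_univ i₀),
        ← Finset.add_sum_erase (Finset.univ.erase i₀) _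
          (Finset.mem_erase.mpr ⟨hne.symm, Finset.mem_univ i₁⟩), Finset.sum_eq_zero]
      · simp [hne.symm, he, hG, hG₀, tay_const]
      · intro i hi
        simp only [Finset.mem_erase] at hi
        simp [hi.1, hi.2.1])
  have := congrFun this i₁
  simp [hne.symm] at this

/-- Some Taylor coefficient of a transcendental E-function at a nonzero algebraic point is
transcendental. -/
theorem _root_.IsEFunction.exists_coeff_not_isAlgebraic {f : ℂ → ℂ} (hf : IsEFunction f)
    (htr : ¬ IsAlgebraicFunc f) {a : ℂ} (ha : IsAlgebraic ℚ a) (ha0 : a ≠ 0) :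
    ∃ n, ¬ IsAlgebraic ℚ (PowerSeries.coeff n (tay a f)) := by
  classical
  obtain ⟨hdiff, K₀, hK₀, hK⟩ := hf.exists_isESeries
  obtain ⟨K₁, hK₁, hmem⟩ := exists_finiteDimensional_of_finset {a} (by simp [ha])
  obtain ⟨h1, h2⟩ := differentiable_and_tay_comp_mul hdiff a
  obtain ⟨n, hn⟩ := exists_coeff_tay_one_not_isAlgebraic (f := fun z => f (a * z)) (K₀ := K₀ ⊔ K₁)
    (by
      intro K hle _
      obtain ⟨φ, hφ, hft⟩ := hK K (le_sup_left.trans hle)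
      have haK : a ∈ K := hle ((le_sup_right : K₁ ≤ _) (hmem a (by simp)))
      have haK0 : (⟨a, haK⟩ : K) ≠ 0 := fun h0 => ha0 (congrArg Subtype.val h0)
      refine ⟨_, hφ.rescale haK0, ?_, independent_rescale
        (linear_independence_of_transcendental hdiff htr hft) haK0⟩
      rw [h2, hft, map_rescale]
      rfl) h1
  refine ⟨n, fun h => hn ?_⟩
  rw [coeff_tay] at h ⊢
  rw [iteratedDeriv_comp_const_mul hdiff.contDiff]
  simp only [mul_one, mul_div_assoc]
  exact (ha.pow n).mul h

end Transcendence

section Factorization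

/-- Polynomials with algebraic coefficients. -/
def algPoly : Subsemiring ℂ[X] := Polynomial.lifts (algebraMap (algebraicClosure ℚ ℂ) ℂ)

theorem mem_algPoly {p : ℂ[X]} : p ∈ algPoly ↔ ∀ k, IsAlgebraic ℚ (p.coeff k) := by
  rw [algPoly, Polynomial.lifts_iff_coeff_lifts]
  refine forall_congr' fun k => ?_
  rw [← mem_algebraicClosure_iff]
  exact ⟨fun ⟨x, hx⟩ => hx ▸ x.2, fun h => ⟨⟨_, h⟩, rfl⟩⟩

theorem C_mem_algPoly {a : ℂ} (ha : IsAlgebraic ℚ a) : Polynomial.C a ∈ algPoly :=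
  Polynomial.C_mem_lifts _ (⟨a, mem_algebraicClosure_iff.mpr ha⟩ : algebraicClosure ℚ ℂ)

theorem X_sub_C_mem_algPoly {a : ℂ} (ha : IsAlgebraic ℚ a) :
    Polynomial.X - Polynomial.C a ∈ algPoly := by
  rw [sub_eq_add_neg, ← Polynomial.C_neg]
  exact add_mem (Polynomial.X_mem_lifts _) (C_mem_algPoly ha.neg)

theorem isAlgebraic_eval {p : ℂ[X]} (hp : p ∈ algPoly) {a : ℂ} (ha : IsAlgebraic ℚ a) :
    IsAlgebraic ℚ (p.eval a) := by
  obtain ⟨q, rfl⟩ := (Polynomial.mem_lifts _).mp hp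
  have := Polynomial.eval_map_apply (p := q) (f := algebraMap (algebraicClosure ℚ ℂ) ℂ)
    (⟨a, mem_algebraicClosure_iff.mpr ha⟩ : algebraicClosure ℚ ℂ)
  exact mem_algebraicClosure_iff.mp (this ▸ (q.eval _).2)

theorem coeff_tay_of_eq_add_sub_mul {f g : ℂ → ℂ} (hg : Differentiable ℂ g) {a b : ℂ}
    (h : ∀ z, f z = b + (z - a) * g z) (n : ℕ) :
    PowerSeries.coeff (n + 1) (tay a f) = PowerSeries.coeff n (tay a g) := by
  have hX : Differentiable ℂ fun z => (Polynomial.X - Polynomial.C a).eval z :=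
    (Polynomial.X - Polynomial.C a).differentiable
  have hf : f = (fun _ => b) + (fun z => (Polynomial.X - Polynomial.C a).eval z) * g := by
    ext z; simp [h z]
  rw [hf, tay_add (differentiable_const _) (hX.mul hg), tay_mul hX hg, tay_const, tay_eval,
    map_sub, sh_X, sh_C, add_sub_cancel_right, map_add, PowerSeries.coeff_succ_X_mul,
    PowerSeries.coeff_C, if_neg (Nat.succ_ne_zero n), zero_add]

/-- Repeated division at one point. -/
theorem exists_factorization_at {a : ℂ} (ha : IsAlgebraic ℚ a) (ha0 : a ≠ 0) {n : ℕ} {f : ℂ → ℂ}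
    (hf : IsEFunction f) (htr : ¬ IsAlgebraicFunc f)
    (hn : ¬ IsAlgebraic ℚ (PowerSeries.coeff n (tay a f))) :
    ∃ (m : ℕ) (p : ℂ[X]) (g : ℂ → ℂ), p ∈ algPoly ∧ p.degree < m ∧ IsEFunction g ∧
      ¬ IsAlgebraicFunc g ∧ (∀ z, f z = p.eval z + (z - a) ^ m * g z) ∧
      Transcendental ℚ (g a) ∧ (IsAlgebraic ℚ (f a) → 1 ≤ m) := by
  induction n generalizing f with
  | zero =>
    rw [PowerSeries.coeff_zero_eq_constantCoeff_apply, constantCoeff_tay] at hn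
    exact ⟨0, 0, f, zero_mem _, by simp, hf, htr, fun z => by simp, hn, fun h => absurd h hn⟩
  | succ n ih =>
    by_cases hfa : IsAlgebraic ℚ (f a)
    · obtain ⟨g, hg, hfg⟩ := hf.exists_eq_add_sub_mul htr ha ha0 hfa
      have hgtr : ¬ IsAlgebraicFunc g := fun h => htr <| h.add_mul (Polynomial.C (f a))
        (Polynomial.X - Polynomial.C a) fun z => by simpa using hfg z
      rw [coeff_tay_of_eq_add_sub_mul hg.exists_isESeries.1 hfg] at hn
      obtain ⟨m, p, g', hp, hdeg, hg', hg'tr, h1, h2, -⟩ := ih hg hgtr hn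
      refine ⟨m + 1, Polynomial.C (f a) + (Polynomial.X - Polynomial.C a) * p, g',
        add_mem (C_mem_algPoly hfa) (mul_mem (X_sub_C_mem_algPoly ha) hp), ?_, hg', hg'tr,
        fun z => ?_, h2, fun _ => by omega⟩
      · refine (Polynomial.degree_add_le _ _).trans_lt (max_lt ?_ ?_)
        · exact Polynomial.degree_C_le.trans_lt (by exact_mod_cast Nat.succ_pos m)
        · rw [Polynomial.degree_mul, Polynomial.degree_X_sub_C, add_comm, Nat.cast_add, Nat.cast_one]
          exact WithBot.add_lt_add_right WithBot.one_ne_bot hdeg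
      · rw [hfg, h1]
        simp
        ring
    · exact ⟨0, 0, f, zero_mem _, by simp, hf, htr, fun z => by simp, hfa, fun h => absurd h hfa⟩

/-- Division at finitely many points. -/
theorem exists_factorization (T : Finset ℂ) (hT : ∀ x ∈ T, IsAlgebraic ℚ x ∧ x ≠ 0) {f : ℂ → ℂ}
    (hf : IsEFunction f) (htr : ¬ IsAlgebraicFunc f) :
    ∃ (m : ℂ → ℕ) (p : ℂ[X]) (g : ℂ → ℂ), p ∈ algPoly ∧ p.degree < (∑ x ∈ T, m x : ℕ) ∧
      IsEFunction g ∧ ¬ IsAlgebraicFunc g ∧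
      (∀ z, f z = p.eval z + (∏ x ∈ T, (z - x) ^ m x) * g z) ∧
      ∀ x ∈ T, Transcendental ℚ (g x) ∧ (IsAlgebraic ℚ (f x) → 1 ≤ m x) := by
  classical
  induction T using Finset.induction_on with
  | empty => exact ⟨fun _ => 0, 0, f, zero_mem _, by simp, hf, htr, fun z => by simp, by simp⟩
  | insert a T haT ih =>
    obtain ⟨m, p, g, hp, hdeg, hg, hgtr, hfg, hgT⟩ := ih fun x hx => hT x (Finset.mem_insert_of_mem hx)
    obtain ⟨ha, ha0⟩ := hT a (Finset.mem_insert_self a T)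
    obtain ⟨n, hn⟩ := hg.exists_coeff_not_isAlgebraic hgtr ha ha0
    obtain ⟨k, q, h, hq, hqdeg, hh, hhtr, hgh, hha, hk⟩ := exists_factorization_at ha ha0 hg hgtr hn
    let D : ℂ[X] := ∏ x ∈ T, (Polynomial.X - Polynomial.C x) ^ m x
    have hD : D ∈ algPoly := prod_mem fun x hx =>
      pow_mem (X_sub_C_mem_algPoly (hT x (Finset.mem_insert_of_mem hx)).1) _
    have hDdeg : D.degree = (∑ x ∈ T, m x : ℕ) := by
      rw [Polynomial.degree_prod, Nat.cast_sum]
      exact Finset.sum_congr rfl fun x _ => by simp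
    have hDeval : ∀ z, D.eval z = ∏ x ∈ T, (z - x) ^ m x := fun z => by
      simp [D, Polynomial.eval_prod]
    have hm : ∀ x ∈ T, Function.update m a k x = m x := fun x hx =>
      Function.update_of_ne (ne_of_mem_of_not_mem hx haT) _ _
    have hsum : ∑ x ∈ insert a T, Function.update m a k x = ∑ x ∈ T, m x + k := by
      rw [Finset.sum_insert haT, Function.update_self, Finset.sum_congr rfl hm, add_comm]
    refine ⟨Function.update m a k, p + D * q, h, add_mem hp (mul_mem hD hq), ?_, hh, hhtr,
      fun z => ?_, fun x hx => ?_⟩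
    · rw [hsum]
      refine (Polynomial.degree_add_le _ _).trans_lt (max_lt ?_ ?_)
      · exact hdeg.trans_le (by exact_mod_cast Nat.le_add_right _ _)
      · rw [Polynomial.degree_mul, hDdeg, Nat.cast_add]
        exact WithBot.add_lt_add_left (WithBot.natCast_ne_bot _) hqdeg
    · rw [Finset.prod_insert haT, Function.update_self,
        Finset.prod_congr rfl fun x hx => by rw [hm x hx], hfg, hgh, Polynomial.eval_add,
        Polynomial.eval_mul, hDeval]
      ring
    · rcases Finset.mem_insert.mp hx with rfl | hxT
      · refine ⟨hha, fun hfx => ?_⟩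
        rw [Function.update_self]
        have hDx : D.eval x ≠ 0 := by
          rw [hDeval]
          exact Finset.prod_ne_zero_iff.mpr fun y hy =>
            pow_ne_zero _ (sub_ne_zero.mpr fun e => haT (e ▸ hy))
        have : g x = (f x - p.eval x) * (D.eval x)⁻¹ := by
          rw [hfg x, ← hDeval]
          field_simp
          ring
        refine hk ?_
        rw [this]
        exact (hfx.sub (isAlgebraic_eval hp ha)).mul (isAlgebraic_eval hD ha).inv
      · rw [hm x hxT]
        have hx' := (hT x hx).1
        refine ⟨fun hhx => (hgT x hxT).1 ?_, (hgT x hxT).2⟩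
        rw [hgh]
        exact (isAlgebraic_eval hq hx').add (((hx'.sub ha).pow k).mul hhx)

end Factorization

end EFun

/-- If `f` is an E-function transcendental over `ℂ(z)` whose set of nonzero algebraic
exceptional points is `{α 0, …, α (s-1)}` with `s ≥ 1`, then
`f(z) = p(z) + ∏ⱼ (z - αⱼ)^{mⱼ} · g(z)` for some positive integers `mⱼ`, some
`p ∈ ℚ̄[z]` of degree at most `m₀ + ⋯ + m_{s-1} - 1`, and some E-function `g`
transcendental over `ℚ̄(z)` taking transcendental values at all nonzero algebraic
points. -/
theorem exceptional_points_factorization (f : ℂ → ℂ)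
    (hf : IsEFunction f) (htr : ¬ IsAlgebraicFunc f)
    (s : ℕ) (hs : 1 ≤ s) (α : Fin s → ℂ) (hinj : Function.Injective α)
    (hexc : {x : ℂ | IsAlgebraic ℚ x ∧ x ≠ 0 ∧ IsAlgebraic ℚ (f x)} = Set.range α) :
    ∃ m : Fin s → ℕ, (∀ j, 1 ≤ m j) ∧
    ∃ p : Polynomial ℂ, (∀ k, IsAlgebraic ℚ (p.coeff k)) ∧
      p.degree ≤ (((∑ j, m j) - 1 : ℕ) : WithBot ℕ) ∧
    ∃ g : ℂ → ℂ, IsEFunction g ∧ ¬ IsAlgebraicFuncQbar g ∧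
      (∀ z : ℂ, f z = p.eval z + (∏ j, (z - α j) ^ m j) * g z) ∧
      (∀ x : ℂ, IsAlgebraic ℚ x → x ≠ 0 → Transcendental ℚ (g x)) := by
  have hα : ∀ j, IsAlgebraic ℚ (α j) ∧ α j ≠ 0 ∧ IsAlgebraic ℚ (f (α j)) := fun j =>
    (hexc ▸ Set.mem_range_self j : α j ∈ {x : ℂ | IsAlgebraic ℚ x ∧ x ≠ 0 ∧ IsAlgebraic ℚ (f x)})
  obtain ⟨m, p, g, hp, hdeg, hg, hgtr, hfg, hT⟩ := EFun.exists_factorization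
    (Finset.univ.map ⟨α, hinj⟩) (by
      intro x hx
      obtain ⟨j, -, rfl⟩ := Finset.mem_map.mp hx
      exact ⟨(hα j).1, (hα j).2.1⟩) hf htr
  simp only [Finset.sum_map, Finset.prod_map, Function.Embedding.coeFn_mk] at hdeg hfg
  refine ⟨fun j => m (α j), fun j => (hT (α j) (by simp)).2 (hα j).2.2, p,
    EFun.mem_algPoly.mp hp, ?_, g, hg, fun h => hgtr h.isAlgebraicFunc, hfg, fun x hx hx0 => ?_⟩
  · by_cases hp0 : p = 0
    · simp [hp0]
    · rw [Polynomial.degree_eq_natDegree hp0] at hdeg ⊢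
      have : p.natDegree < ∑ j, m (α j) := by exact_mod_cast hdeg
      exact_mod_cast Nat.le_sub_one_of_lt this
  · by_cases hxα : x ∈ Set.range α
    · obtain ⟨j, rfl⟩ := hxα
      exact (hT (α j) (by simp)).1
    · intro hgx
      refine hxα (hexc ▸ ⟨hx, hx0, ?_⟩)
      rw [hfg x]
      refine (EFun.isAlgebraic_eval hp hx).add (IsAlgebraic.mul ?_ hgx)
      rw [← mem_algebraicClosure_iff]
      exact prod_mem fun j _ => pow_mem (sub_mem (mem_algebraicClosure_iff.mpr hx)
        (mem_algebraicClosure_iff.mpr (hα j).1)) _
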